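/- arXiv:1912.03084 — 2 statements merged into one kernel-verified Lean document; each statement's English description precedes it below -/
import Mathlib

section
/- Let M ≥ 1 and ω ∈ ℝ. Then 𝒜 generates an eventually differentiable C₀-semigroup (𝒯(t))_{t≥0} on L²(Ω, μ; H) satisfying ‖𝒯(t)‖ ≤ M e^{ωt} for all t ≥ 0 if and only if the following hold: for a.e. s ∈ Ω, A(s) generates a C₀-semigroup (T(s,t))_{t≥0} on H with ‖T(s,t)‖ ≤ M e^{ωt} for all t ≥ 0, and there exist constants a, b, C > 0 such that for a.e. s ∈ Ω the set Θ := {λ ∈ ℂ : a e^{−b Re λ} ≤ |Im λ|} satisfies Θ ⊆ ρ(A(s)) and ‖R(λ, A(s))‖ ≤ C |Im λ| for all λ ∈ Θ with Re λ ≤ ω. -/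
open MeasureTheory Filter Topology Set

noncomputable section

/-- A `C₀`-semigroup: a family `(T t)_{t ≥ 0}` of bounded operators with `T 0 = I`,
`T (t+u) = T t ∘ T u` for `t, u ≥ 0`, and `t ↦ T t x` continuous on `[0, ∞)` for each `x`.
(Values at negative times are irrelevant.) -/
def IsC0Semigroup {K : Type*} [NormedAddCommGroup K] [NormedSpace ℂ K]
    (T : ℝ → K →L[ℂ] K) : Prop :=
  T 0 = 1 ∧
  (∀ t u : ℝ, 0 ≤ t → 0 ≤ u → T (t + u) = (T t).comp (T u)) ∧
  ∀ x : K, ContinuousOn (fun t => T t x) (Set.Ici (0 : ℝ))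

/-- `R` is the resolvent of the (possibly unbounded) operator `B` at `lam`, i.e.
`lam ∈ ρ(B)` with `R = (lam - B)⁻¹` as a bounded operator. -/
def ResolventAt {K : Type*} [NormedAddCommGroup K] [NormedSpace ℂ K]
    (B : K →ₗ.[ℂ] K) (lam : ℂ) (R : K →L[ℂ] K) : Prop :=
  (∀ y : K, ∃ hy : R y ∈ B.domain, lam • R y - B ⟨R y, hy⟩ = y) ∧
  ∀ x : B.domain, R (lam • (x : K) - B x) = x

/-- `B` is the generator of the semigroup `T`: its domain is the set of `x` for which
`t⁻¹ (T t x - x)` converges as `t → 0⁺`, and `B x` is that limit. -/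
def IsGenerator {K : Type*} [NormedAddCommGroup K] [NormedSpace ℂ K]
    (T : ℝ → K →L[ℂ] K) (B : K →ₗ.[ℂ] K) : Prop :=
  (∀ x : K, x ∈ B.domain ↔
    ∃ y : K, Tendsto (fun t : ℝ => t⁻¹ • (T t x - x)) (𝓝[>] (0:ℝ)) (𝓝 y)) ∧
  ∀ x : B.domain, Tendsto (fun t : ℝ => t⁻¹ • (T t (x : K) - (x : K))) (𝓝[>] (0:ℝ)) (𝓝 (B x))

section Resolvent

variable {K : Type*} [NormedAddCommGroup K] [NormedSpace ℂ K]

theorem clm_mul_apply (S T : K →L[ℂ] K) (x : K) : (S * T) x = S (T x) := rfl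

theorem ResolventAt.mem_graph_iff {B : K →ₗ.[ℂ] K} {ν : ℂ} {R : K →L[ℂ] K}
    (h : ResolventAt B ν R) (x y : K) : (x, y) ∈ B.graph ↔ R (ν • x - y) = x := by
  rw [LinearPMap.mem_graph_iff]
  constructor
  · rintro ⟨z, rfl, rfl⟩
    exact h.2 z
  · intro hx
    obtain ⟨hy, hv⟩ := h.1 (ν • x - y)
    refine ⟨⟨x, hx ▸ hy⟩, rfl, ?_⟩
    have : (⟨R (ν • x - y), hy⟩ : B.domain) = ⟨x, hx ▸ hy⟩ := Subtype.ext hx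
    rw [this] at hv
    have hv' : ν • x - B ⟨x, hx ▸ hy⟩ = ν • x - y :=
      (congrArg (fun w => ν • w - B ⟨x, hx ▸ hy⟩) hx).symm.trans hv
    exact sub_right_injective hv'

/-- `S` is the resolvent at `lam` of the operator whose resolvent at `ν` is `R`. -/
def ResolventPair (R : K →L[ℂ] K) (ν lam : ℂ) (S : K →L[ℂ] K) : Prop :=
  S + (lam - ν) • (R * S) = R ∧ S + (lam - ν) • (S * R) = R

theorem ResolventAt.injective {B : K →ₗ.[ℂ] K} {ν : ℂ} {R : K →L[ℂ] K}
    (h : ResolventAt B ν R) : Function.Injective R := by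
  intro x y hxy
  obtain ⟨h1, h1'⟩ := h.1 x
  obtain ⟨h2, h2'⟩ := h.1 y
  rw [← h1', ← h2']
  have : (⟨R x, h1⟩ : B.domain) = ⟨R y, h2⟩ := Subtype.ext hxy
  rw [this, hxy]

theorem ResolventAt.resolventAt_iff {B : K →ₗ.[ℂ] K} {ν : ℂ} {R : K →L[ℂ] K}
    (h : ResolventAt B ν R) (lam : ℂ) (S : K →L[ℂ] K) :
    ResolventAt B lam S ↔ ResolventPair R ν lam S := by
  have key : ∀ y, (∃ hy : S y ∈ B.domain, lam • S y - B ⟨S y, hy⟩ = y) ↔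
      (S + (lam - ν) • (R * S)) y = R y := by
    intro y
    have : (∃ hy : S y ∈ B.domain, lam • S y - B ⟨S y, hy⟩ = y) ↔
        (S y, lam • S y - y) ∈ B.graph := by
      rw [LinearPMap.mem_graph_iff]
      constructor
      · rintro ⟨hy, hv⟩
        exact ⟨⟨S y, hy⟩, rfl, eq_sub_of_add_eq' (sub_eq_iff_eq_add.1 hv).symm⟩
      · rintro ⟨⟨z, hz⟩, h1, h2⟩
        simp only at h1
        subst h1
        exact ⟨hz, by rw [h2]; simp⟩
    rw [this, h.mem_graph_iff]
    have e : R (ν • S y - (lam • S y - y)) = R y - (lam - ν) • R (S y) := by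
      have : ν • S y - (lam • S y - y) = y - (lam - ν) • S y := by module
      rw [this, map_sub, map_smul]
    rw [e, sub_eq_iff_eq_add]
    simp [eq_comm]
  constructor
  · rintro ⟨h1, h2⟩
    refine ⟨ContinuousLinearMap.ext fun y => (key y).1 (h1 y), ContinuousLinearMap.ext fun y => ?_⟩
    obtain ⟨hy, hv⟩ := h.1 y
    have := h2 ⟨R y, hy⟩
    have e : B ⟨R y, hy⟩ = ν • R y - y :=
      eq_sub_of_add_eq' (sub_eq_iff_eq_add.1 hv).symm
    rw [e] at this
    simp only [add_apply, smul_apply,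
      clm_mul_apply]
    refine Eq.trans ?_ this
    rw [← map_smul, ← map_add]
    congr 1
    module
  · rintro ⟨h1, h2⟩
    refine ⟨fun y => (key y).2 (by rw [h1]), fun x => ?_⟩
    have hx := h.2 x
    set z := ν • (x : K) - B x with hz
    have e : lam • (x : K) - B x = z + (lam - ν) • R z := by rw [hx, hz]; module
    rw [e, map_add, map_smul]
    have := congrArg (fun P => P z) h2
    simp only [add_apply, smul_apply,
      clm_mul_apply] at this
    rw [this, hx]

namespace ResolventPair

variable {R S : K →L[ℂ] K} {ν lam : ℂ}

theorem mul_comm (h : ResolventPair R ν lam S) : R * S = S * R := by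
  by_cases hl : lam - ν = 0
  · have h1 : S = R := by simpa [ResolventPair, hl] using h.1
    rw [h1]
  · have := h.1.trans h.2.symm
    have := add_left_cancel this
    exact smul_right_injective _ hl this

theorem mul_eq_one_right (h : ResolventPair R ν lam S) :
    (1 + (lam - ν) • R) * (1 - (lam - ν) • S) = 1 := by
  have h1 := h.1
  have : (1 + (lam - ν) • R) * (1 - (lam - ν) • S)
      = 1 + (lam - ν) • (R - (S + (lam - ν) • (R * S))) := by
    simp only [add_mul, mul_sub, one_mul, mul_one, smul_mul_assoc, mul_smul_comm]
    module
  rw [this, h1]; simp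

theorem mul_eq_one_left (h : ResolventPair R ν lam S) :
    (1 - (lam - ν) • S) * (1 + (lam - ν) • R) = 1 := by
  have h1 := h.2
  have : (1 - (lam - ν) • S) * (1 + (lam - ν) • R)
      = 1 + (lam - ν) • (R - (S + (lam - ν) • (S * R))) := by
    simp only [mul_add, sub_mul, one_mul, mul_one, smul_mul_assoc, mul_smul_comm]
    module
  rw [this, h1]; simp

theorem isUnit (h : ResolventPair R ν lam S) : IsUnit (1 + (lam - ν) • R) :=
  ⟨⟨_, _, h.mul_eq_one_right, h.mul_eq_one_left⟩, rfl⟩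

theorem unique {S' : K →L[ℂ] K} (h : ResolventPair R ν lam S) (h' : ResolventPair R ν lam S') :
    S = S' := by
  have h1 : (1 + (lam - ν) • R) * S = (1 + (lam - ν) • R) * S' := by
    have a := h.1
    have b := h'.1
    simp only [add_mul, one_mul, smul_mul_assoc]
    rw [a, b]
  exact h.isUnit.mul_left_cancel h1

theorem eq_mul_inverse (h : ResolventPair R ν lam S) :
    S = R * Ring.inverse (1 + (lam - ν) • R) := by
  have : S * (1 + (lam - ν) • R) = R := by
    rw [mul_add, mul_one, mul_smul_comm]; exact h.2
  rw [Ring.eq_mul_inverse_iff_mul_eq _ _ _ h.isUnit, this]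

theorem commute {P : K →L[ℂ] K} (h : ResolventPair R ν lam S) (hP : P * R = R * P) :
    P * S = S * P := by
  have h1 := h.isUnit
  apply h1.mul_left_cancel
  have a : (1 + (lam - ν) • R) * S = R := by
    rw [add_mul, one_mul, smul_mul_assoc]; exact h.1
  have b : (1 + (lam - ν) • R) * P = P * (1 + (lam - ν) • R) := by
    simp only [add_mul, mul_add, one_mul, mul_one, smul_mul_assoc, mul_smul_comm, hP]
  rw [← mul_assoc, b, mul_assoc, a, ← mul_assoc, a, hP]

/-- The resolvent identity. -/
theorem sub_eq {S' : K →L[ℂ] K} {lam' : ℂ} (h : ResolventPair R ν lam S)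
    (h' : ResolventPair R ν lam' S') : S - S' = (lam' - lam) • (S * S') := by
  have h1 := h.isUnit
  apply h1.mul_left_cancel
  have a : (1 + (lam - ν) • R) * S = R := by
    rw [add_mul, one_mul, smul_mul_assoc]; exact h.1
  have b : (1 + (lam - ν) • R) * S' = R + (lam - lam') • (R * S') := by
    have := h'.1
    rw [add_mul, one_mul, smul_mul_assoc]
    calc S' + (lam - ν) • (R * S')
        = (S' + (lam' - ν) • (R * S')) + (lam - lam') • (R * S') := by module
      _ = _ := by rw [this]
  rw [mul_sub, a, b, mul_smul_comm, ← mul_assoc, a]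
  module

end ResolventPair

end Resolvent

section Semigroup

variable {K : Type*} [NormedAddCommGroup K] [NormedSpace ℂ K]

/-- A `C₀`-semigroup bounded by `M e^{ωt}` whose generator has resolvent `R` at `ν`, expressed
through the bounded operators `T t` and `R` only. -/
structure SGData (T : ℝ → K →L[ℂ] K) (R : K →L[ℂ] K) (ν : ℂ) (M ω : ℝ) : Prop where
  c0 : IsC0Semigroup T
  bound : ∀ t : ℝ, 0 ≤ t → ‖T t‖ ≤ M * Real.exp (ω * t)
  inj : Function.Injective R
  comm : ∀ t : ℝ, 0 ≤ t → ∀ z, T t (R z) = R (T t z)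
  quot : ∀ z, Tendsto (fun t : ℝ => t⁻¹ • (T t (R z) - R z)) (𝓝[>] (0 : ℝ)) (𝓝 (ν • R z - z))

theorem IsGenerator.sgData {T : ℝ → K →L[ℂ] K} {A : K →ₗ.[ℂ] K} {R : K →L[ℂ] K} {ν : ℂ}
    {M ω : ℝ} (hT : IsC0Semigroup T) (hA : IsGenerator T A) (hR : ResolventAt A ν R)
    (hb : ∀ t : ℝ, 0 ≤ t → ‖T t‖ ≤ M * Real.exp (ω * t)) : SGData T R ν M ω := by
  have quot : ∀ z, Tendsto (fun t : ℝ => t⁻¹ • (T t (R z) - R z)) (𝓝[>] (0 : ℝ))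
      (𝓝 (ν • R z - z)) := by
    intro z
    obtain ⟨hz, hv⟩ := hR.1 z
    have := hA.2 ⟨R z, hz⟩
    rwa [eq_sub_of_add_eq' (sub_eq_iff_eq_add.1 hv).symm] at this
  refine ⟨hT, hb, hR.injective, fun t ht z => ?_, quot⟩
  have h1 : Tendsto (fun h : ℝ => h⁻¹ • (T h (T t (R z)) - T t (R z))) (𝓝[>] (0 : ℝ))
      (𝓝 (T t (ν • R z - z))) := by
    refine (((T t).continuous.tendsto _).comp (quot z)).congr' ?_
    filter_upwards [self_mem_nhdsWithin] with h hh
    have hh' : (0 : ℝ) ≤ h := le_of_lt hh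
    have e : T h (T t (R z)) = T t (T h (R z)) := by
      have a := hT.2.1 h t hh' ht
      have b := hT.2.1 t h ht hh'
      rw [add_comm] at a
      exact congrArg (fun P => P (R z)) (a.symm.trans b)
    rw [e, ← map_sub]
    exact ((T t : K →L[ℂ] K).restrictScalars ℝ).map_smul _ _
  have h2 := (hA.1 (T t (R z))).2 ⟨_, h1⟩
  have h3 := tendsto_nhds_unique (hA.2 ⟨_, h2⟩) h1
  have h4 : (T t (R z), T t (ν • R z - z)) ∈ A.graph :=
    (LinearPMap.mem_graph_iff _).2 ⟨⟨_, h2⟩, rfl, h3⟩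
  rw [hR.mem_graph_iff] at h4
  rw [← h4]
  congr 1
  simp

namespace SGData

variable {T : ℝ → K →L[ℂ] K} {R : K →L[ℂ] K} {ν : ℂ} {M ω : ℝ}

theorem isGenerator (h : SGData T R ν M ω) {A : K →ₗ.[ℂ] K} (hR : ResolventAt A ν R) :
    IsGenerator T A := by
  have hgr : ∀ x : A.domain, (x : K) = R (ν • (x : K) - A x) := fun x => (hR.2 x).symm
  have h2 : ∀ x : A.domain,
      Tendsto (fun t : ℝ => t⁻¹ • (T t (x : K) - (x : K))) (𝓝[>] (0:ℝ)) (𝓝 (A x)) := by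
    intro x
    have := h.quot (ν • (x : K) - A x)
    rw [← hgr x] at this
    simpa using this
  refine ⟨fun x => ⟨fun hx => ⟨_, h2 ⟨x, hx⟩⟩, ?_⟩, h2⟩
  rintro ⟨y, hy⟩
  have h3 : Tendsto (fun t : ℝ => t⁻¹ • (T t (R x) - R x)) (𝓝[>] (0 : ℝ)) (𝓝 (R y)) := by
    refine ((R.continuous.tendsto _).comp hy).congr' ?_
    filter_upwards [self_mem_nhdsWithin] with t ht
    rw [h.comm t (le_of_lt ht), ← map_sub]
    exact (R.restrictScalars ℝ).map_smul _ _
  have h4 := tendsto_nhds_unique h3 (h.quot x)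
  have h5 : (x, y) ∈ A.graph := by
    rw [hR.mem_graph_iff, map_sub, map_smul, h4]; simp
  exact LinearPMap.mem_domain_of_mem_graph h5

theorem zero_apply (h : SGData T R ν M ω) (x : K) : T 0 x = x := by rw [h.c0.1]; rfl

theorem add_apply (h : SGData T R ν M ω) {t u : ℝ} (ht : 0 ≤ t) (hu : 0 ≤ u) (x : K) :
    T (t + u) x = T t (T u x) := by rw [h.c0.2.1 t u ht hu]; rfl

theorem norm_apply_le (h : SGData T R ν M ω) {t : ℝ} (ht : 0 ≤ t) (x : K) :
    ‖T t x‖ ≤ M * Real.exp (ω * t) * ‖x‖ :=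
  (T t).le_of_opNorm_le (h.bound t ht) x

theorem continuousOn (h : SGData T R ν M ω) (x : K) : ContinuousOn (fun t => T t x) (Ici 0) :=
  h.c0.2.2 x

theorem continuousOn_exp (h : SGData T R ν M ω) (lam : ℂ) (x : K) :
    ContinuousOn (fun t : ℝ => Complex.exp (-(lam * t)) • T t x) (Ici 0) :=
  ContinuousOn.smul (by fun_prop) (h.continuousOn x)

theorem hasDerivWithinAt (h : SGData T R ν M ω) (z : K) {t : ℝ} (ht : 0 ≤ t) :
    HasDerivWithinAt (fun r => T r (R z)) (T t (ν • R z - z)) (Ioi t) t := by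
  rw [hasDerivWithinAt_iff_tendsto_slope' (by simp)]
  have h1 : Tendsto (fun h : ℝ => h⁻¹ • (T t (T h (R z)) - T t (R z))) (𝓝[>] (0 : ℝ))
      (𝓝 (T t (ν • R z - z))) := by
    refine (((T t).continuous.tendsto _).comp (h.quot z)).congr fun s => ?_
    rw [← map_sub]
    exact ((T t : K →L[ℂ] K).restrictScalars ℝ).map_smul _ _
  have h2 : Tendsto (fun r : ℝ => r - t) (𝓝[>] t) (𝓝[>] 0) := by
    refine tendsto_nhdsWithin_iff.2 ⟨?_, ?_⟩
    · have : Tendsto (fun r : ℝ => r - t) (𝓝 t) (𝓝 (t - t)) := by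
        exact (continuous_sub_right t).tendsto t
      rw [sub_self] at this
      exact this.mono_left nhdsWithin_le_nhds
    · filter_upwards [self_mem_nhdsWithin] with r hr
      exact sub_pos.2 (mem_Ioi.1 hr)
  refine (h1.comp h2).congr' ?_
  filter_upwards [self_mem_nhdsWithin] with r hr
  have hr' : 0 ≤ r - t := (sub_pos.2 (mem_Ioi.1 hr)).le
  simp only [Function.comp, slope_def_module]
  rw [← h.add_apply ht hr']
  simp

theorem hasDerivWithinAt_exp (h : SGData T R ν M ω) (lam : ℂ) (z : K) {t : ℝ} (ht : 0 ≤ t) :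
    HasDerivWithinAt (fun r : ℝ => Complex.exp (-(lam * r)) • T r (R z))
      (Complex.exp (-(lam * t)) • T t ((ν - lam) • R z - z)) (Ioi t) t := by
  have h1 : HasDerivAt (fun r : ℝ => Complex.exp (-(lam * r)))
      (Complex.exp (-(lam * t)) * (-(lam * 1))) t :=
    ((((hasDerivAt_id (t : ℝ)).ofReal_comp).const_mul lam).neg).cexp
  convert! h1.hasDerivWithinAt.smul (h.hasDerivWithinAt z ht) using 1
  simp only [map_sub, map_smul]
  module

theorem intervalIntegrable_exp (h : SGData T R ν M ω) (lam : ℂ) (x : K) {a b : ℝ}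
    (ha : 0 ≤ a) (hb : 0 ≤ b) :
    IntervalIntegrable (fun t : ℝ => Complex.exp (-(lam * t)) • T t x) volume a b := by
  refine ((h.continuousOn_exp lam x).mono ?_).intervalIntegrable
  intro r hr
  exact (le_inf ha hb).trans hr.1

variable [CompleteSpace K]

theorem integral_exp_resolvent (h : SGData T R ν M ω) (lam : ℂ) (z : K) {t : ℝ} (ht : 0 ≤ t) :
    ∫ r in (0 : ℝ)..t, Complex.exp (-(lam * r)) • T r ((ν - lam) • R z - z)
      = Complex.exp (-(lam * t)) • T t (R z) - R z := by
  have := intervalIntegral.integral_eq_sub_of_hasDeriv_right_of_le ht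
    ((h.continuousOn_exp lam (R z)).mono Icc_subset_Ici_self)
    (fun r hr => h.hasDerivWithinAt_exp lam z hr.1.le)
    (h.intervalIntegrable_exp lam _ le_rfl ht)
  rw [this]
  simp [h.zero_apply]

theorem integral_exp_add (h : SGData T R ν M ω) (lam : ℂ) (x : K) {t : ℝ} (ht : 0 ≤ t) :
    (∫ r in (0 : ℝ)..t, Complex.exp (-(lam * r)) • T r x)
      + (lam - ν) • R (∫ r in (0 : ℝ)..t, Complex.exp (-(lam * r)) • T r x)
      = R (x - Complex.exp (-(lam * t)) • T t x) := by
  have h1 := h.integral_exp_resolvent lam x ht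
  have h2 : R (∫ r in (0 : ℝ)..t, Complex.exp (-(lam * r)) • T r x)
      = ∫ r in (0 : ℝ)..t, Complex.exp (-(lam * r)) • T r (R x) := by
    rw [← R.intervalIntegral_comp_comm (h.intervalIntegrable_exp lam x le_rfl ht)]
    refine intervalIntegral.integral_congr fun r hr => ?_
    rw [uIcc_of_le ht] at hr
    simp [h.comm r hr.1]
  rw [h2]
  have h3 : ∫ r in (0 : ℝ)..t, Complex.exp (-(lam * r)) • T r ((ν - lam) • R x - x)
      = (ν - lam) • (∫ r in (0 : ℝ)..t, Complex.exp (-(lam * r)) • T r (R x))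
        - ∫ r in (0 : ℝ)..t, Complex.exp (-(lam * r)) • T r x := by
    rw [← intervalIntegral.integral_smul, ← intervalIntegral.integral_sub]
    · refine intervalIntegral.integral_congr fun r _ => ?_
      simp only [map_sub, map_smul]
      module
    · exact (h.intervalIntegrable_exp lam (R x) le_rfl ht).smul _
    · exact h.intervalIntegrable_exp lam x le_rfl ht
  rw [h3] at h1
  have h4 : R (x - Complex.exp (-(lam * t)) • T t x)
      = -(Complex.exp (-(lam * t)) • T t (R x) - R x) := by
    rw [map_sub, map_smul, ← h.comm t ht]; abel
  rw [h4, ← h1]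
  module

theorem integral_resolvent (h : SGData T R ν M ω) (z : K) {t : ℝ} (ht : 0 ≤ t) :
    ∫ r in (0 : ℝ)..t, T r (ν • R z - z) = T t (R z) - R z := by
  simpa using h.integral_exp_resolvent 0 z ht

theorem denseRange (h : SGData T R ν M ω) : DenseRange R := by
  intro x
  have h1 : HasDerivWithinAt (fun t : ℝ => ∫ r in (0 : ℝ)..t, Complex.exp (-(0 * r)) • T r x)
      (Complex.exp (-(0 * (0 : ℝ))) • T 0 x) (Ici 0) 0 := by
    refine intervalIntegral.integral_hasDerivWithinAt_right (t := Ioi 0) (by simp) ?_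
      (((h.continuousOn_exp 0 x) 0 (by simp)).mono Ioi_subset_Ici_self)
    exact ((h.continuousOn_exp 0 x).mono Ioi_subset_Ici_self).stronglyMeasurableAtFilter_nhdsWithin
      measurableSet_Ioi 0
  have h2 := (hasDerivWithinAt_iff_tendsto_slope' (by simp)).1 (h1.mono Ioi_subset_Ici_self)
  simp only [h.zero_apply, zero_mul, neg_zero, Complex.exp_zero, one_smul] at h2
  refine mem_closure_of_tendsto h2 ?_
  filter_upwards [self_mem_nhdsWithin] with t ht
  have ht' : (0 : ℝ) ≤ t := le_of_lt ht
  have h3 := h.integral_exp_add 0 x ht'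
  simp only [zero_mul, neg_zero, Complex.exp_zero, one_smul, zero_sub, neg_smul] at h3
  have h4 := eq_sub_of_add_eq h3
  simp only [slope_def_module, intervalIntegral.integral_same, sub_zero]
  rw [h4]
  refine ⟨t⁻¹ • ((x - T t x) + ν • ∫ r in (0 : ℝ)..t, T r x), ?_⟩
  have : R (t⁻¹ • ((x - T t x) + ν • ∫ r in (0 : ℝ)..t, T r x))
      = t⁻¹ • R ((x - T t x) + ν • ∫ r in (0 : ℝ)..t, T r x) :=
    (R.restrictScalars ℝ).map_smul _ _
  rw [this, map_add, map_smul, sub_neg_eq_add]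

theorem hasDerivAt (h : SGData T R ν M ω) (z : K) {t : ℝ} (ht : 0 < t) :
    HasDerivAt (fun r => T r (R z)) (T t (ν • R z - z)) t := by
  have hc := h.continuousOn (ν • R z - z)
  have h1 : HasDerivAt (fun u : ℝ => R z + ∫ r in (0 : ℝ)..u, T r (ν • R z - z))
      (T t (ν • R z - z)) t := by
    refine HasDerivAt.const_add _ (intervalIntegral.integral_hasDerivAt_right ?_ ?_ ?_)
    · refine (hc.mono ?_).intervalIntegrable
      rw [uIcc_of_le ht.le]; exact Icc_subset_Ici_self
    · exact (hc.mono Ioi_subset_Ici_self).stronglyMeasurableAtFilter isOpen_Ioi t ht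
    · exact hc.continuousAt (Ici_mem_nhds ht)
  refine h1.congr_of_eventuallyEq ?_
  filter_upwards [lt_mem_nhds ht] with u hu
  rw [h.integral_resolvent z hu.le]; abel

end SGData

end Semigroup

section Laplace

variable {K : Type*} [NormedAddCommGroup K] [NormedSpace ℂ K]

/-- The resolvent at `lam` of the operator whose resolvent at `ν` is `R`
(meaningful where `1 + (lam - ν) R` is invertible). -/
def Res (R : K →L[ℂ] K) (ν lam : ℂ) : K →L[ℂ] K := R * Ring.inverse (1 + (lam - ν) • R)

theorem ResolventPair.eq_res {R S : K →L[ℂ] K} {ν lam : ℂ} (h : ResolventPair R ν lam S) :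
    S = Res R ν lam := h.eq_mul_inverse

theorem ResolventPair.res {R S : K →L[ℂ] K} {ν lam : ℂ} (h : ResolventPair R ν lam S) :
    ResolventPair R ν lam (Res R ν lam) := h.eq_res ▸ h

theorem differentiableAt_res [CompleteSpace K] {R : K →L[ℂ] K} {ν lam : ℂ}
    (h : ResolventPair R ν lam (Res R ν lam)) : DifferentiableAt ℂ (Res R ν) lam := by
  have h1 : DifferentiableAt ℂ (fun l : ℂ => 1 + (l - ν) • R) lam := by fun_prop
  have h2 := (differentiableAt_inverse (𝕜 := ℂ) h.isUnit).comp lam h1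
  exact (differentiableAt_const R).mul h2

/-- The resolvent gains decay on the range of `R`. -/
theorem ResolventPair.norm_mul_le {R S : K →L[ℂ] K} {ν lam : ℂ} (h : ResolventPair R ν lam S) :
    ‖lam - ν‖ * ‖S * R‖ ≤ ‖R‖ + ‖S‖ := by
  rw [← norm_smul]
  have : (lam - ν) • (S * R) = R - S := by rw [eq_sub_iff_add_eq', h.2]
  rw [this]
  exact norm_sub_le _ _

theorem integrable_inv_one_add_mul_sub_sq (a c : ℝ) (ha : a ≠ 0) :
    Integrable fun w : ℝ => (1 + (a * w - c) ^ 2)⁻¹ :=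
  (integrable_inv_one_add_sq.comp_sub_right c).comp_mul_left' ha

namespace SGData

variable {T : ℝ → K →L[ℂ] K} {R : K →L[ℂ] K} {ν : ℂ} {M ω : ℝ}

theorem nonneg_bound (h : SGData T R ν M ω) : 0 ≤ M := by
  have := (norm_nonneg _).trans (h.bound 0 le_rfl)
  simpa using this

theorem norm_exp_smul_le (h : SGData T R ν M ω) (lam : ℂ) (x : K) {t : ℝ} (ht : 0 ≤ t) :
    ‖Complex.exp (-(lam * t)) • T t x‖ ≤ M * ‖x‖ * Real.exp (-(lam.re - ω) * t) := by
  rw [norm_smul, Complex.norm_exp]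
  refine (mul_le_mul_of_nonneg_left (h.norm_apply_le ht x) (Real.exp_nonneg _)).trans (le_of_eq ?_)
  have e : Real.exp (-(lam.re - ω) * t) = Real.exp (-(lam * t)).re * Real.exp (ω * t) := by
    rw [← Real.exp_add]; congr 1; simp; ring
  rw [e]; ring

theorem integrableOn_exp (h : SGData T R ν M ω) {lam : ℂ} (hl : ω < lam.re) (x : K) :
    IntegrableOn (fun t : ℝ => Complex.exp (-(lam * t)) • T t x) (Ioi 0) := by
  have hb : IntegrableOn (fun t : ℝ => M * ‖x‖ * Real.exp (-(lam.re - ω) * t)) (Ioi 0) :=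
    (exp_neg_integrableOn_Ioi 0 (sub_pos.2 hl)).const_mul _
  refine Integrable.mono' hb
    (((h.continuousOn_exp lam x).mono Ioi_subset_Ici_self).aestronglyMeasurable
      measurableSet_Ioi) ?_
  filter_upwards [ae_restrict_mem measurableSet_Ioi] with t ht
  exact h.norm_exp_smul_le lam x (le_of_lt ht)

theorem norm_mul_exp_smul_le (h : SGData T R ν M ω) {lam : ℂ} (hl : ω < lam.re) (x : K) {t : ℝ}
    (ht : 0 ≤ t) : ‖t • Complex.exp (-(lam * t)) • T t x‖
      ≤ 2 / (lam.re - ω) * (M * ‖x‖) * Real.exp (-((lam.re - ω) / 2) * t) := by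
  have hd : 0 < lam.re - ω := sub_pos.2 hl
  rw [norm_smul, Real.norm_of_nonneg ht]
  refine (mul_le_mul_of_nonneg_left (h.norm_exp_smul_le lam x ht) ht).trans ?_
  have e : Real.exp (-(lam.re - ω) * t)
      = Real.exp (-((lam.re - ω) / 2) * t) * Real.exp (-((lam.re - ω) / 2) * t) := by
    rw [← Real.exp_add]; congr 1; ring
  have e2 : t * Real.exp (-((lam.re - ω) / 2) * t) ≤ 2 / (lam.re - ω) := by
    have h1 : (lam.re - ω) / 2 * t ≤ Real.exp ((lam.re - ω) / 2 * t) := by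
      linarith [Real.add_one_le_exp ((lam.re - ω) / 2 * t)]
    have h2 : Real.exp (-((lam.re - ω) / 2) * t) * Real.exp ((lam.re - ω) / 2 * t) = 1 := by
      rw [← Real.exp_add]; simp
    rw [le_div_iff₀ hd]
    nlinarith [Real.exp_pos (-((lam.re - ω) / 2) * t), mul_le_mul_of_nonneg_left h1
      (Real.exp_pos (-((lam.re - ω) / 2) * t)).le]
  rw [e]
  have h3 : 0 ≤ M * ‖x‖ * Real.exp (-((lam.re - ω) / 2) * t) :=
    mul_nonneg (mul_nonneg h.nonneg_bound (norm_nonneg _)) (Real.exp_nonneg _)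
  nlinarith [mul_le_mul_of_nonneg_left e2 h3]

theorem integrableOn_mul_exp (h : SGData T R ν M ω) {lam : ℂ} (hl : ω < lam.re) (x : K) :
    IntegrableOn (fun t : ℝ => t • Complex.exp (-(lam * t)) • T t x) (Ioi 0) := by
  have hb : IntegrableOn (fun t : ℝ => 2 / (lam.re - ω) * (M * ‖x‖) *
      Real.exp (-((lam.re - ω) / 2) * t)) (Ioi 0) :=
    (exp_neg_integrableOn_Ioi 0 (half_pos (sub_pos.2 hl))).const_mul _
  refine Integrable.mono' hb
    ((((continuousOn_id' _).smul (h.continuousOn_exp lam x)).mono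
      Ioi_subset_Ici_self).aestronglyMeasurable measurableSet_Ioi) ?_
  filter_upwards [ae_restrict_mem measurableSet_Ioi] with t ht
  exact h.norm_mul_exp_smul_le hl x (le_of_lt ht)

theorem tendsto_exp_neg_mul {δ : ℝ} (hδ : 0 < δ) (c : ℝ) :
    Tendsto (fun t : ℝ => c * Real.exp (-δ * t)) atTop (𝓝 0) := by
  have : Tendsto (fun t : ℝ => -δ * t) atTop atBot :=
    tendsto_id.const_mul_atTop_of_neg (by linarith)
  simpa using (Real.tendsto_exp_atBot.comp this).const_mul c

/-- The Laplace transform of the semigroup. -/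
def lap (T : ℝ → K →L[ℂ] K) (lam : ℂ) (x : K) : K :=
  ∫ t in Ioi (0 : ℝ), Complex.exp (-(lam * t)) • T t x

theorem norm_lap_le (h : SGData T R ν M ω) {lam : ℂ} (hl : ω < lam.re) (x : K) :
    ‖lap T lam x‖ ≤ M / (lam.re - ω) * ‖x‖ := by
  have hb : IntegrableOn (fun t : ℝ => M * ‖x‖ * Real.exp (-(lam.re - ω) * t)) (Ioi 0) :=
    (exp_neg_integrableOn_Ioi 0 (sub_pos.2 hl)).const_mul _
  refine (norm_integral_le_of_norm_le hb ?_).trans (le_of_eq ?_)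
  · filter_upwards [ae_restrict_mem measurableSet_Ioi] with t ht
    exact h.norm_exp_smul_le lam x (le_of_lt ht)
  · rw [integral_const_mul, integral_exp_mul_Ioi (by linarith)]
    have : lam.re - ω ≠ 0 := (sub_pos.2 hl).ne'
    rw [mul_zero, Real.exp_zero, neg_div, div_neg, neg_neg]
    field_simp

variable [CompleteSpace K]

theorem hasDerivAt_exp (h : SGData T R ν M ω) (lam : ℂ) (z : K) {t : ℝ} (ht : 0 < t) :
    HasDerivAt (fun r : ℝ => Complex.exp (-(lam * r)) • T r (R z))
      (Complex.exp (-(lam * t)) • T t ((ν - lam) • R z - z)) t := by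
  have h1 : HasDerivAt (fun r : ℝ => Complex.exp (-(lam * r)))
      (Complex.exp (-(lam * t)) * (-(lam * 1))) t :=
    ((((hasDerivAt_id (t : ℝ)).ofReal_comp).const_mul lam).neg).cexp
  convert! h1.smul (h.hasDerivAt z ht) using 1
  simp only [map_sub, map_smul]
  module

/-- Laplace transform as a bounded operator. -/
theorem exists_lap (h : SGData T R ν M ω) {lam : ℂ} (hl : ω < lam.re) :
    ∃ S : K →L[ℂ] K, (∀ x, S x = lap T lam x) ∧ ‖S‖ ≤ M / (lam.re - ω) ∧
      ResolventPair R ν lam S := by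
  let L : K →ₗ[ℂ] K :=
    { toFun := lap T lam
      map_add' := fun x y => by
        rw [lap, lap, lap, ← integral_add (h.integrableOn_exp hl x) (h.integrableOn_exp hl y)]
        simp only [map_add, smul_add]
      map_smul' := fun c x => by
        rw [lap, lap, RingHom.id_apply, ← integral_smul]
        simp only [map_smul, smul_comm c] }
  let S : K →L[ℂ] K := L.mkContinuous (M / (lam.re - ω)) (h.norm_lap_le hl)
  have hS : ∀ x, S x = lap T lam x := fun x => rfl
  have hcomm : ∀ x, S (R x) = R (S x) := by
    intro x
    rw [hS, hS, lap, lap, ← R.integral_comp_comm (h.integrableOn_exp hl x)]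
    refine setIntegral_congr_fun measurableSet_Ioi fun t ht => ?_
    simp [h.comm t (le_of_lt ht)]
  have hid : ∀ x, S ((ν - lam) • R x - x) = - R x := by
    intro x
    rw [hS, lap, integral_Ioi_of_hasDerivAt_of_tendsto
      (f := fun r : ℝ => Complex.exp (-(lam * r)) • T r (R x)) (m := 0)
      ((h.continuousOn_exp lam (R x)) 0 self_mem_Ici)
      (fun t ht => h.hasDerivAt_exp lam x ht) (h.integrableOn_exp hl _)]
    · simp [h.zero_apply]
    · refine squeeze_zero_norm' ?_ (tendsto_exp_neg_mul (sub_pos.2 hl) (M * ‖R x‖))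
      filter_upwards [eventually_ge_atTop 0] with t ht
      exact h.norm_exp_smul_le lam _ ht
  have h2 : S + (lam - ν) • (S * R) = R := by
    ext x
    have := hid x
    rw [map_sub, map_smul, ← neg_eq_iff_eq_neg] at this
    simp only [_root_.add_apply, smul_apply, clm_mul_apply]
    refine Eq.trans ?_ this
    module
  refine ⟨S, hS, LinearMap.mkContinuous_norm_le _
    (div_nonneg h.nonneg_bound (sub_pos.2 hl).le) _, ?_, h2⟩
  have : R * S = S * R := by ext x; exact (hcomm x).symm
  rw [this]; exact h2

theorem resolventPair (h : SGData T R ν M ω) {lam : ℂ} (hl : ω < lam.re) :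
    ResolventPair R ν lam (Res R ν lam) := (h.exists_lap hl).choose_spec.2.2.res

theorem norm_res_le (h : SGData T R ν M ω) {lam : ℂ} (hl : ω < lam.re) :
    ‖Res R ν lam‖ ≤ M / (lam.re - ω) := by
  obtain ⟨S, -, h1, h2⟩ := h.exists_lap hl
  rwa [← h2.eq_res]

theorem res_apply (h : SGData T R ν M ω) {lam : ℂ} (hl : ω < lam.re) (x : K) :
    Res R ν lam x = ∫ t in Ioi (0 : ℝ), Complex.exp (-(lam * t)) • T t x := by
  obtain ⟨S, h0, h1, h2⟩ := h.exists_lap hl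
  rw [← h2.eq_res, h0, lap]

theorem res_res_apply (h : SGData T R ν M ω) {lam : ℂ} (hl : ω < lam.re) (x : K) :
    ∫ t in Ioi (0 : ℝ), t • Complex.exp (-(lam * t)) • T t x = Res R ν lam (Res R ν lam x) := by
  have hp := h.resolventPair hl
  have hS := h.res_apply hl
  set S := Res R ν lam
  set L : K → K := fun x => ∫ t in Ioi (0 : ℝ), t • Complex.exp (-(lam * t)) • T t x with hL
  have hadd : ∀ x y, L (x - y) = L x - L y := fun x y => by
    simp only [hL]
    rw [← integral_sub (h.integrableOn_mul_exp hl x) (h.integrableOn_mul_exp hl y)]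
    simp only [map_sub, smul_sub]
  have hsmul : ∀ (c : ℂ) x, L (c • x) = c • L x := fun c x => by
    simp only [hL]
    rw [← integral_smul]
    simp only [map_smul, smul_comm c]
  have hcomm : ∀ x, L (R x) = R (L x) := by
    intro x
    simp only [hL]
    rw [← R.integral_comp_comm (h.integrableOn_mul_exp hl x)]
    refine setIntegral_congr_fun measurableSet_Ioi fun t ht => ?_
    have := (R.restrictScalars ℝ).map_smul t (Complex.exp (-(lam * t)) • T t x)
    simp only [ContinuousLinearMap.coe_restrictScalars'] at this
    simp only [h.comm t (le_of_lt ht), this, map_smul]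
  have hid : S (R x) + L ((ν - lam) • R x - x) = 0 := by
    rw [hS]
    simp only [hL]
    rw [← integral_add (h.integrableOn_exp hl _) (h.integrableOn_mul_exp hl _)]
    refine (integral_Ioi_of_hasDerivAt_of_tendsto
      (f := fun r : ℝ => r • Complex.exp (-(lam * r)) • T r (R x)) (m := 0)
      (((continuousOn_id' _).smul (h.continuousOn_exp lam (R x))) 0 self_mem_Ici)
      (fun t ht => ?_) ((h.integrableOn_exp hl _).add (h.integrableOn_mul_exp hl _)) ?_).trans ?_
    rotate_left
    · refine squeeze_zero_norm' ?_ (tendsto_exp_neg_mul (half_pos (sub_pos.2 hl))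
        (2 / (lam.re - ω) * (M * ‖R x‖)))
      filter_upwards [eventually_ge_atTop 0] with t ht
      exact h.norm_mul_exp_smul_le hl _ ht
    · simp
    · have := (hasDerivAt_id t).smul (h.hasDerivAt_exp lam x ht)
      convert! this using 1
      simp [add_comm]
  rw [hadd, hsmul, hcomm] at hid
  have hRS : R (S x) = S (R x) := congrArg (fun P => P x) hp.mul_comm
  have e1 : (1 + (lam - ν) • R) (L x) = R (S x) := by
    rw [hRS]
    have : S (R x) = - ((ν - lam) • R (L x) - L x) := eq_neg_of_add_eq_zero_left hid
    rw [this]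
    simp only [_root_.add_apply, smul_apply, one_apply_eq_self]
    module
  have e2 : (1 + (lam - ν) • R) (S (S x)) = R (S x) := by
    have := congrArg (fun P => P (S x)) hp.1
    simpa [clm_mul_apply] using this
  have hinj : Function.Injective (1 + (lam - ν) • R : K →L[ℂ] K) := by
    intro u v huv
    have := congrArg (1 - (lam - ν) • S : K →L[ℂ] K) huv
    have h3 := fun u => congrArg (fun P => P u) hp.mul_eq_one_left
    simp only [clm_mul_apply, one_apply_eq_self] at h3
    rwa [h3, h3] at this
  exact hinj (e1.trans e2.symm)

end SGData

end Laplace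

section Inversion

variable {K : Type*} [NormedAddCommGroup K] [NormedSpace ℂ K] [CompleteSpace K]

/-- The vertical line `Re = σ`, parametrised by frequency. -/
def vline (σ w : ℝ) : ℂ := σ + (2 * Real.pi * w : ℝ) * Complex.I

@[simp] theorem vline_re (σ w : ℝ) : (vline σ w).re = σ := by simp [vline]

@[simp] theorem vline_im (σ w : ℝ) : (vline σ w).im = 2 * Real.pi * w := by simp [vline]

theorem continuous_vline (σ : ℝ) : Continuous (vline σ) := by unfold vline; fun_prop

namespace SGData

variable {T : ℝ → K →L[ℂ] K} {R : K →L[ℂ] K} {ν : ℂ} {M ω : ℝ}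

theorem inversion_aux (h : SGData T R ν M ω) {σ : ℝ} (hσ : ω < σ) (x : K) {t : ℝ} (ht : 0 < t)
    (hFint : Integrable fun w : ℝ => Res R ν (vline σ w) (Res R ν (vline σ w) x)) :
    ∫ w : ℝ, Complex.exp (vline σ w * t) • Res R ν (vline σ w) (Res R ν (vline σ w) x)
      = t • T t x := by
  set f : ℝ → K := indicator (Ioi 0) fun t : ℝ => t • Complex.exp (-((σ : ℂ) * t)) • T t x with hf
  have hσ' : ω < ((σ : ℂ)).re := by simpa
  have hfi : Integrable f := (integrable_indicator_iff measurableSet_Ioi).2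
    (h.integrableOn_mul_exp hσ' x)
  have hF : ∀ w : ℝ, FourierTransform.fourier f w
      = Res R ν (vline σ w) (Res R ν (vline σ w) x) := by
    intro w
    rw [← h.res_res_apply (by simpa) x, Real.fourier_real_eq_integral_exp_smul,
      ← integral_indicator measurableSet_Ioi]
    refine integral_congr_ae (ae_of_all _ fun r => ?_)
    by_cases hr : r ∈ Ioi (0 : ℝ)
    · simp only [hf, indicator_of_mem hr]
      rw [smul_comm _ r, smul_smul, ← Complex.exp_add]
      congr 3
      simp only [vline]; push_cast; ring
    · simp [hf, indicator_of_notMem hr]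
  have hF' : FourierTransform.fourier f
      = fun w => Res R ν (vline σ w) (Res R ν (vline σ w) x) := funext hF
  have hft : f t = t • Complex.exp (-((σ : ℂ) * t)) • T t x := indicator_of_mem (mem_Ioi.2 ht) _
  have hc : ContinuousAt f t := by
    have h1 : ContinuousAt (fun t : ℝ => t • Complex.exp (-((σ : ℂ) * t)) • T t x) t :=
      continuousAt_id.smul ((h.continuousOn_exp σ x).continuousAt (Ici_mem_nhds ht))
    refine h1.congr ?_
    filter_upwards [lt_mem_nhds ht] with r hr
    simp only [hf, indicator_of_mem (mem_Ioi.2 hr)]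
  have key := hfi.fourierInv_fourier_eq (by rw [hF']; exact hFint) hc
  rw [hF', Real.fourierInv_eq', hft] at key
  have e : ∀ w : ℝ, Complex.exp (vline σ w * t) • Res R ν (vline σ w) (Res R ν (vline σ w) x)
      = Complex.exp ((σ : ℂ) * t) • Complex.exp (((2 * Real.pi * inner ℝ w t : ℝ) : ℂ) * Complex.I)
        • Res R ν (vline σ w) (Res R ν (vline σ w) x) := by
    intro w
    rw [smul_smul, ← Complex.exp_add]
    congr 2
    simp only [vline, RCLike.inner_apply, conj_trivial]; push_cast; ring
  simp_rw [e]
  rw [integral_smul, key, smul_comm _ t, smul_smul, ← Complex.exp_add]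
  simp

theorem continuous_res (h : SGData T R ν M ω) {σ : ℝ} (hσ : ω < σ) :
    Continuous fun w : ℝ => Res R ν (vline σ w) :=
  continuous_iff_continuousAt.2 fun w =>
    ((differentiableAt_res (h.resolventPair (by simpa))).continuousAt).comp
      (continuous_vline σ).continuousAt

theorem norm_res_mul_le (h : SGData T R ν M ω) {lam : ℂ} (hl : ω < lam.re) :
    (1 + ‖lam - ν‖) * ‖Res R ν lam * R‖
      ≤ ‖R‖ + M / (lam.re - ω) + M / (lam.re - ω) * ‖R‖ := by
  have h1 := (h.resolventPair hl).norm_mul_le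
  have h2 := h.norm_res_le hl
  have h3 := norm_mul_le (Res R ν lam) R
  nlinarith [norm_nonneg R, mul_le_mul_of_nonneg_right h2 (norm_nonneg R)]

theorem norm_res_res_le (h : SGData T R ν M ω) {σ : ℝ} (hσ : ω < σ) (z : K) (w : ℝ) :
    ‖Res R ν (vline σ w) (Res R ν (vline σ w) (R (R z)))‖ ≤
      (‖R‖ + M / (σ - ω) + M / (σ - ω) * ‖R‖) ^ 2 * ‖z‖
        * (1 + (2 * Real.pi * w - ν.im) ^ 2)⁻¹ := by
  have hl : ω < (vline σ w).re := by simpa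
  have h1 := h.norm_res_mul_le hl
  have hp := h.resolventPair hl
  rw [vline_re] at h1
  set S := Res R ν (vline σ w)
  set c := ‖R‖ + M / (σ - ω) + M / (σ - ω) * ‖R‖
  have e : S (S (R (R z))) = (S * R) ((S * R) z) := by
    have : S (R (R z)) = R (S (R z)) := congrArg (fun P => P (R z)) hp.mul_comm.symm
    simp only [clm_mul_apply, this]
  have h2 : ‖S (S (R (R z)))‖ ≤ ‖S * R‖ ^ 2 * ‖z‖ := by
    rw [e, sq, mul_assoc]
    exact (ContinuousLinearMap.le_opNorm _ _).trans
      (mul_le_mul_of_nonneg_left (ContinuousLinearMap.le_opNorm _ _) (norm_nonneg _))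
  have h3 : |2 * Real.pi * w - ν.im| ≤ ‖vline σ w - ν‖ := by
    simpa using Complex.abs_im_le_norm (vline σ w - ν)
  have h4 : 1 + (2 * Real.pi * w - ν.im) ^ 2 ≤ (1 + ‖vline σ w - ν‖) ^ 2 := by
    rw [← sq_abs]
    nlinarith [abs_nonneg (2 * Real.pi * w - ν.im)]
  have h5 : (1 + (2 * Real.pi * w - ν.im) ^ 2) * ‖S * R‖ ^ 2 ≤ c ^ 2 := by
    calc _ ≤ (1 + ‖vline σ w - ν‖) ^ 2 * ‖S * R‖ ^ 2 := by gcongr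
      _ = ((1 + ‖vline σ w - ν‖) * ‖S * R‖) ^ 2 := by ring
      _ ≤ c ^ 2 := by gcongr
  have h6 : 0 < 1 + (2 * Real.pi * w - ν.im) ^ 2 := by positivity
  refine h2.trans ?_
  rw [mul_right_comm, ← div_eq_mul_inv]
  refine mul_le_mul_of_nonneg_right ?_ (norm_nonneg _)
  rw [le_div_iff₀ h6]
  linarith

theorem integrable_res_res (h : SGData T R ν M ω) {σ : ℝ} (hσ : ω < σ) (z : K) :
    Integrable fun w : ℝ => Res R ν (vline σ w) (Res R ν (vline σ w) (R (R z))) := by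
  refine Integrable.mono' ((integrable_inv_one_add_mul_sub_sq (2 * Real.pi) ν.im
    (by positivity)).const_mul _) ?_ (ae_of_all _ (h.norm_res_res_le hσ z))
  have hc := h.continuous_res hσ
  exact (hc.clm_apply (hc.clm_apply continuous_const)).aestronglyMeasurable

/-- Inversion of the squared Laplace transform. -/
theorem inversion (h : SGData T R ν M ω) {σ : ℝ} (hσ : ω < σ) (z : K) {t : ℝ} (ht : 0 < t) :
    ∫ w : ℝ, Complex.exp (vline σ w * t) • Res R ν (vline σ w) (Res R ν (vline σ w) (R (R z)))
      = t • T t (R (R z)) :=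
  h.inversion_aux hσ _ ht (h.integrable_res_res hσ z)

theorem integrable_exp_res_res (h : SGData T R ν M ω) {σ : ℝ} (hσ : ω < σ) (z : K) (t : ℝ) :
    Integrable fun w : ℝ => Complex.exp (vline σ w * t) •
      Res R ν (vline σ w) (Res R ν (vline σ w) (R (R z))) := by
  refine (h.integrable_res_res hσ z).bdd_smul (C := Real.exp (σ * t)) ?_ ?_
  · have := continuous_vline σ
    exact (by fun_prop : Continuous fun w => Complex.exp (vline σ w * t)).aestronglyMeasurable
  · exact ae_of_all _ fun w => by simp [Complex.norm_exp]

theorem ext_dense (h : SGData T R ν M ω) {P Q : K →L[ℂ] K} (hPQ : ∀ z, P (R (R z)) = Q (R (R z))) :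
    P = Q := by
  have hd : DenseRange (fun z => R (R z)) := h.denseRange.comp h.denseRange R.continuous
  exact ContinuousLinearMap.coeFn_injective (hd.equalizer P.continuous Q.continuous (funext hPQ))

/-- Bounded operators commuting with the resolvent commute with the semigroup. -/
theorem commute (h : SGData T R ν M ω) {P : K →L[ℂ] K} (hP : P * R = R * P) {t : ℝ}
    (ht : 0 ≤ t) : P * T t = T t * P := by
  rcases ht.eq_or_lt with rfl | ht
  · rw [h.c0.1, mul_one, one_mul]
  refine h.ext_dense fun z => ?_
  have hPR : ∀ x, P (R x) = R (P x) := fun x => congrArg (fun Q => Q x) hP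
  have hσ : ω < ω + 1 := by linarith
  have hPS : ∀ w x, P (Res R ν (vline (ω + 1) w) x) = Res R ν (vline (ω + 1) w) (P x) :=
    fun w x => congrArg (fun Q => Q x) ((h.resolventPair (lam := vline (ω + 1) w)
      (by simp)).commute hP)
  have h1 := congrArg P (h.inversion hσ z ht)
  have h2 := h.inversion hσ (P z) ht
  rw [← P.integral_comp_comm (h.integrable_exp_res_res hσ z t)] at h1
  simp only [map_smul, hPS, hPR] at h1
  rw [h2] at h1
  have h3 : P (t • T t (R (R z))) = t • P (T t (R (R z))) := (P.restrictScalars ℝ).map_smul _ _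
  rw [h3] at h1
  have := smul_right_injective K ht.ne' h1
  simp only [clm_mul_apply, hPR]
  exact this.symm

end SGData

end Inversion

section Region

variable {K : Type*} [NormedAddCommGroup K] [NormedSpace ℂ K] [CompleteSpace K]

theorem exists_inverse_one_sub {E : K →L[ℂ] K} (hE : ‖E‖ ≤ 1 / 2) :
    ∃ Y : K →L[ℂ] K, (1 - E) * Y = 1 ∧ Y * (1 - E) = 1 ∧ ‖Y‖ ≤ 2 := by
  have hu : IsUnit (1 - E) := isUnit_one_sub_of_norm_lt_one (by linarith)
  refine ⟨Ring.inverse (1 - E), Ring.mul_inverse_cancel _ hu, Ring.inverse_mul_cancel _ hu, ?_⟩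
  set Y := Ring.inverse (1 - E)
  have h1 : Y = 1 + E * Y := by
    have := Ring.mul_inverse_cancel _ hu
    rw [sub_mul, one_mul] at this
    exact eq_add_of_sub_eq this
  have h2 : ‖Y‖ ≤ 1 + 1 / 2 * ‖Y‖ := by
    calc ‖Y‖ = ‖1 + E * Y‖ := by rw [← h1]
      _ ≤ ‖(1 : K →L[ℂ] K)‖ + ‖E‖ * ‖Y‖ := (norm_add_le _ _).trans
          (add_le_add le_rfl (norm_mul_le _ _))
      _ ≤ _ := add_le_add ContinuousLinearMap.norm_id_le
          (mul_le_mul_of_nonneg_right hE (norm_nonneg _))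
  linarith

namespace SGData

variable {T : ℝ → K →L[ℂ] K} {R : K →L[ℂ] K} {ν : ℂ} {M ω : ℝ}

/-- The truncated Laplace transform as a bounded operator. -/
theorem exists_truncated_lap (h : SGData T R ν M ω) (lam : ℂ) {t : ℝ} (ht : 0 ≤ t) :
    ∃ U : K →L[ℂ] K, ‖U‖ ≤ M * Real.exp (|ω - lam.re| * t) * t ∧ U * R = R * U ∧
      U + (lam - ν) • (R * U) = R * (1 - Complex.exp (-(lam * t)) • T t) := by
  have hi := fun x => h.intervalIntegrable_exp lam x le_rfl ht
  let L : K →ₗ[ℂ] K :=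
    { toFun := fun x => ∫ r in (0 : ℝ)..t, Complex.exp (-(lam * r)) • T r x
      map_add' := fun x y => by
        rw [← intervalIntegral.integral_add (hi x) (hi y)]
        simp only [map_add, smul_add]
      map_smul' := fun c x => by
        rw [RingHom.id_apply, ← intervalIntegral.integral_smul]
        simp only [map_smul, smul_comm c] }
  have hL : ∀ x, ‖L x‖ ≤ M * Real.exp (|ω - lam.re| * t) * t * ‖x‖ := by
    intro x
    refine (intervalIntegral.norm_integral_le_of_norm_le_const
      (C := M * Real.exp (|ω - lam.re| * t) * ‖x‖) fun r hr => ?_).trans (le_of_eq ?_)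
    · rw [uIoc_of_le ht] at hr
      refine (h.norm_exp_smul_le lam x hr.1.le).trans ?_
      rw [mul_right_comm]
      refine mul_le_mul_of_nonneg_right (mul_le_mul_of_nonneg_left (Real.exp_le_exp.2 ?_)
        h.nonneg_bound) (norm_nonneg _)
      have := mul_le_mul_of_nonneg_left hr.2 (abs_nonneg (ω - lam.re))
      have h3 := mul_le_mul_of_nonneg_right (le_abs_self (ω - lam.re)) hr.1.le
      linarith
    · rw [sub_zero, abs_of_nonneg ht]; ring
  refine ⟨L.mkContinuous _ hL, L.mkContinuous_norm_le
    (mul_nonneg (mul_nonneg h.nonneg_bound (Real.exp_nonneg _)) ht) _, ?_, ?_⟩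
  · ext x
    change (∫ r in (0 : ℝ)..t, Complex.exp (-(lam * r)) • T r (R x))
      = R (∫ r in (0 : ℝ)..t, Complex.exp (-(lam * r)) • T r x)
    rw [← R.intervalIntegral_comp_comm (hi x)]
    refine intervalIntegral.integral_congr fun r hr => ?_
    rw [uIcc_of_le ht] at hr
    simp [h.comm r hr.1]
  · ext x
    exact h.integral_exp_add lam x ht

theorem region_aux (h : SGData T R ν M ω) {t : ℝ} (ht : 0 < t) {N : ℝ} {Q : K →L[ℂ] K}
    (hQ : ‖Q‖ ≤ N) (hTQ : T t = R * Q) {lam : ℂ}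
    (hl : (2 * (‖ν‖ * (M * Real.exp (ω * t)) + N) + 1) * Real.exp (-t * lam.re) ≤ |lam.im|) :
    ∃ S, ResolventPair R ν lam S ∧
      ‖S‖ ≤ 2 * M * (Real.exp (|ω - lam.re| * t) * t
        + Real.exp (-t * lam.re) * Real.exp (ω * t) / ‖lam‖) := by
  obtain ⟨U, hU, hUR, hUid⟩ := h.exists_truncated_lap lam ht.le
  set e := Complex.exp (-(lam * t)) with he
  set d := ‖ν‖ * (M * Real.exp (ω * t)) + N with hd
  have hN : 0 ≤ N := (norm_nonneg _).trans hQ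
  have hM := h.nonneg_bound
  have hd0 : 0 ≤ d := by positivity
  have hen : ‖e‖ = Real.exp (-t * lam.re) := by
    rw [he, Complex.norm_exp]; congr 1; simp; ring
  have hTR : T t * R = R * T t := ContinuousLinearMap.ext fun x => h.comm t ht.le x
  have hQR : Q * R = R * Q := by
    ext x
    apply h.inj
    have := congrArg (fun P => P x) hTR
    rw [hTQ] at this
    simpa [clm_mul_apply] using this
  set D := ν • T t - Q with hD
  have hDn : ‖D‖ ≤ d := by
    refine (norm_sub_le _ _).trans (add_le_add ?_ hQ)
    rw [norm_smul]
    exact mul_le_mul_of_nonneg_left (h.bound t ht.le) (norm_nonneg _)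
  have hDR : D * R = R * D := by
    simp only [hD, sub_mul, mul_sub, smul_mul_assoc, mul_smul_comm, hTR, hQR]
  have him : |lam.im| ≤ ‖lam‖ := Complex.abs_im_le_norm lam
  have hexp := Real.exp_pos (-t * lam.re)
  have hl0 : 0 < ‖lam‖ := lt_of_lt_of_le (by positivity) (hl.trans him)
  have hlne : lam ≠ 0 := norm_pos_iff.1 hl0
  obtain ⟨Y, hY1, hY2, hYn⟩ := exists_inverse_one_sub (E := (lam⁻¹ * e) • D) (by
    rw [norm_smul, norm_mul, norm_inv, hen, mul_assoc, inv_mul_le_iff₀ hl0]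
    nlinarith [mul_le_mul_of_nonneg_left hDn hexp.le])
  have hYR : Y * R = R * Y := by
    have hc : (1 - (lam⁻¹ * e) • D) * R = R * (1 - (lam⁻¹ * e) • D) := by
      simp only [sub_mul, mul_sub, one_mul, mul_one, smul_mul_assoc, mul_smul_comm, hDR]
    calc Y * R = Y * (R * ((1 - (lam⁻¹ * e) • D) * Y)) := by rw [hY1, mul_one]
      _ = Y * ((1 - (lam⁻¹ * e) • D) * R) * Y := by rw [hc]; simp only [mul_assoc]
      _ = R * Y := by rw [← mul_assoc, hY2, one_mul]
  set V := U + (lam⁻¹ * e) • T t with hV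
  have hVR : V * R = R * V := by
    simp only [hV, add_mul, mul_add, smul_mul_assoc, mul_smul_comm, hTR, hUR]
  have hVid : V + (lam - ν) • (R * V) = R * (1 - (lam⁻¹ * e) • D) := by
    have e1 : V + (lam - ν) • (R * V)
        = (U + (lam - ν) • (R * U)) + (lam⁻¹ * e) • T t
          + ((lam - ν) * (lam⁻¹ * e)) • (R * T t) := by
      simp only [hV, mul_add, mul_smul_comm]; module
    rw [e1, hUid]
    have e2 : (lam - ν) * (lam⁻¹ * e) = e - ν * (lam⁻¹ * e) := by field_simp
    rw [e2]
    simp only [hD, mul_sub, mul_smul_comm, mul_one, ← hTQ]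
    module
  refine ⟨V * Y, ⟨?_, ?_⟩, ?_⟩
  · rw [← mul_assoc, ← smul_mul_assoc, ← add_mul, hVid, mul_assoc, hY1, mul_one]
  · rw [mul_assoc, hYR, ← mul_assoc, hVR, ← smul_mul_assoc, ← add_mul, hVid, mul_assoc, hY1,
      mul_one]
  · have hVn : ‖V‖ ≤ M * (Real.exp (|ω - lam.re| * t) * t
        + Real.exp (-t * lam.re) * Real.exp (ω * t) / ‖lam‖) := by
      refine (norm_add_le _ _).trans ?_
      rw [mul_add]
      refine add_le_add (by rw [← mul_assoc]; exact hU) ?_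
      rw [norm_smul, norm_mul, norm_inv, hen]
      refine (mul_le_mul_of_nonneg_left (h.bound t ht.le) (by positivity)).trans (le_of_eq ?_)
      field_simp
    refine (norm_mul_le _ _).trans ?_
    have := mul_le_mul hVn hYn (norm_nonneg _) ((norm_nonneg _).trans hVn)
    refine this.trans (le_of_eq (by ring))

/-- If `T t` maps boundedly into the domain of the generator, the resolvent exists and is bounded
in an exponential region, with constants depending only on the bounds. -/
theorem exists_region (ν : ℂ) {M ω t N : ℝ} (hM : 0 ≤ M) (hN : 0 ≤ N) (ht : 0 < t) :
    ∃ a b C : ℝ, 0 < a ∧ 0 < b ∧ 0 < C ∧ ∀ (T : ℝ → K →L[ℂ] K) (R Q : K →L[ℂ] K),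
      SGData T R ν M ω → ‖Q‖ ≤ N → T t = R * Q → ∀ lam : ℂ,
      a * Real.exp (-b * lam.re) ≤ |lam.im| → ∃ S, ResolventPair R ν lam S ∧
        (lam.re ≤ ω → ‖S‖ ≤ C * |lam.im|) := by
  set a := 2 * (‖ν‖ * (M * Real.exp (ω * t)) + N) + 1 with ha
  have ha0 : 0 < a := by positivity
  refine ⟨a, t, 2 * M * Real.exp (ω * t) * (t + Real.exp (ω * t) / a) / a + 1, ha0, ht,
    by positivity, ?_⟩
  intro T R Q h hQ hTQ lam hl
  obtain ⟨S, hS, hSn⟩ := h.region_aux ht hQ hTQ hl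
  refine ⟨S, hS, fun hre => hSn.trans ?_⟩
  have him : |lam.im| ≤ ‖lam‖ := Complex.abs_im_le_norm lam
  have h1 : a * Real.exp (-(ω * t)) ≤ ‖lam‖ := by
    refine le_trans ?_ (hl.trans him)
    gcongr
    nlinarith
  have h2 : Real.exp (ω * t) / ‖lam‖ ≤ Real.exp (ω * t) * (Real.exp (ω * t) / a) := by
    rw [div_eq_mul_inv]
    gcongr
    have : Real.exp (ω * t) / a = (a * Real.exp (-(ω * t)))⁻¹ := by
      rw [mul_inv, Real.exp_neg, inv_inv, div_eq_inv_mul]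
    rw [this]
    gcongr
  have h3 : Real.exp (-t * lam.re) ≤ |lam.im| / a := by
    rw [le_div_iff₀ ha0]; linarith
  have h4 : Real.exp (|ω - lam.re| * t) = Real.exp (ω * t) * Real.exp (-t * lam.re) := by
    rw [abs_of_nonneg (by linarith), ← Real.exp_add]; congr 1; ring
  rw [h4]
  calc 2 * M * (Real.exp (ω * t) * Real.exp (-t * lam.re) * t
        + Real.exp (-t * lam.re) * Real.exp (ω * t) / ‖lam‖)
      = 2 * M * Real.exp (-t * lam.re) * (Real.exp (ω * t) * t + Real.exp (ω * t) / ‖lam‖) := by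
        ring
    _ ≤ 2 * M * (|lam.im| / a) *
        (Real.exp (ω * t) * t + Real.exp (ω * t) * (Real.exp (ω * t) / a)) := by gcongr
    _ = 2 * M * Real.exp (ω * t) * (t + Real.exp (ω * t) / a) / a * |lam.im| := by
        field_simp
    _ ≤ _ := by
        rw [add_mul, one_mul]
        exact le_add_of_nonneg_right (abs_nonneg _)

end SGData

end Region

section Contour

variable {K : Type*} [NormedAddCommGroup K] [NormedSpace ℂ K] [CompleteSpace K]

/-- The point `x + i ε τ`. -/
def cpt (ε x τ : ℝ) : ℂ := x + (ε * τ : ℝ) * Complex.I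

@[simp] theorem cpt_re (ε x τ : ℝ) : (cpt ε x τ).re = x := by simp [cpt]

@[simp] theorem cpt_im (ε x τ : ℝ) : (cpt ε x τ).im = ε * τ := by simp [cpt]

theorem convex_expRegion {a b ε : ℝ} (ha : 0 < a) :
    Convex ℝ {z : ℂ | a * Real.exp (-b * z.re) < ε * z.im} := by
  intro p hp q hq α β hα hβ hαβ
  simp only [mem_ofPred_eq, Complex.add_re, Complex.add_im, Complex.real_smul, Complex.mul_re,
    Complex.mul_im, Complex.ofReal_re, Complex.ofReal_im, zero_mul, sub_zero, add_zero] at *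
  have h1 := convexOn_exp.2 (mem_univ (-b * p.re)) (mem_univ (-b * q.re)) hα hβ hαβ
  simp only [smul_eq_mul] at h1
  have e : -b * (α * p.re + β * q.re) = α * (-b * p.re) + β * (-b * q.re) := by ring
  rw [e]
  have h2 : α * (a * Real.exp (-b * p.re)) + β * (a * Real.exp (-b * q.re))
      < α * (ε * p.im) + β * (ε * q.im) := by
    rcases hα.eq_or_lt with rfl | hα
    · have : β = 1 := by linarith
      subst this; simpa using hq
    · exact add_lt_add_of_lt_of_le (mul_lt_mul_of_pos_left hp hα)
        (mul_le_mul_of_nonneg_left hq.le hβ)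
  nlinarith [mul_le_mul_of_nonneg_left h1 ha.le]

theorem isOpen_expRegion {a b ε : ℝ} : IsOpen {z : ℂ | a * Real.exp (-b * z.re) < ε * z.im} :=
  isOpen_lt (by fun_prop) (by fun_prop)

/-- The abscissa of the contour `a' e^{-b x} = τ`. -/
def crv (A b τ : ℝ) : ℝ := (Real.log A - Real.log τ) / b

theorem exp_crv {A b τ : ℝ} (hA : 0 < A) (hb : 0 < b) (hτ : 0 < τ) :
    Real.exp (-b * crv A b τ) = τ / A := by
  have : -b * crv A b τ = Real.log τ - Real.log A := by unfold crv; field_simp; ring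
  rw [this, Real.exp_sub, Real.exp_log hτ, Real.exp_log hA]

theorem crv_anti {A b τ τ' : ℝ} (hb : 0 < b) (hτ : 0 < τ) (h : τ ≤ τ') :
    crv A b τ' ≤ crv A b τ := by
  unfold crv
  have := Real.log_le_log hτ h
  gcongr

theorem hasDerivAt_crv {A b τ : ℝ} (hτ : 0 < τ) :
    HasDerivAt (crv A b) (-(b * τ)⁻¹) τ := by
  have := ((hasDerivAt_const τ (Real.log A)).sub (Real.hasDerivAt_log hτ.ne')).div_const b
  convert! this using 1
  rw [mul_inv]; ring

theorem mem_expRegion {a b A ε x τ : ℝ} (ha : 0 < a) (hb : 0 < b) (hA : a < A) (hε : ε * ε = 1)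
    (hτ : 0 < τ) (hx : crv A b τ ≤ x) :
    cpt ε x τ ∈ {z : ℂ | a * Real.exp (-b * z.re) < ε * z.im} := by
  simp only [mem_ofPred_eq, cpt_re, cpt_im]
  have h1 : Real.exp (-b * x) ≤ τ / A := by
    rw [← exp_crv (ha.trans hA) hb hτ]
    apply Real.exp_le_exp.2
    nlinarith
  have h2 : ε * (ε * τ) = τ := by rw [← mul_assoc, hε, one_mul]
  rw [h2]
  calc a * Real.exp (-b * x) ≤ a * (τ / A) := by gcongr
    _ = (a / A) * τ := by ring
    _ < 1 * τ := by
      have : a / A < 1 := (div_lt_one (ha.trans hA)).2 hA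
      gcongr
    _ = τ := one_mul _

/-- Integrals along a half-line can be moved to an exponential contour. -/
theorem norm_integral_vertical_le {F : ℂ → K} {a b A ε σ c h₀ h β : ℝ} (ha : 0 < a) (hb : 0 < b)
    (hA : a < A) (hε : ε * ε = 1) (hh₀ : 0 < h₀) (hσ : crv A b h₀ = σ) (hh : h₀ ≤ h)
    (hF : DifferentiableOn ℂ F {z : ℂ | a * Real.exp (-b * z.re) < ε * z.im})
    (hcrv : ∀ τ, h₀ ≤ τ → ‖F (cpt ε (crv A b τ) τ)‖ ≤ c / τ ^ 2)
    (hhor : ∀ x, crv A b h ≤ x → x ≤ σ → ‖F (cpt ε x h)‖ ≤ β) :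
    ‖∫ τ in h₀..h, F (cpt ε σ τ)‖ ≤ c * (1 + (b * h₀)⁻¹) / h₀ + β * (σ - crv A b h) := by
  set U := {z : ℂ | a * Real.exp (-b * z.re) < ε * z.im} with hU
  obtain ⟨G, hG'⟩ := (convex_expRegion (ε := ε) (b := b) ha).exists_forall_hasDerivWithinAt hF
  have hG : ∀ z ∈ U, HasDerivAt G (F z) z := fun z hz =>
    (hG' z hz).hasDerivAt (isOpen_expRegion.mem_nhds hz)
  have hεn : |ε| = 1 := by
    have : |ε| * |ε| = 1 := by rw [abs_mul_abs_self, hε]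
    nlinarith [abs_nonneg ε]
  have hc0 : 0 ≤ c := by
    have := (norm_nonneg _).trans (hcrv h₀ le_rfl)
    by_contra hc
    exact absurd this (not_le.2 (div_neg_of_neg_of_pos (not_le.1 hc) (by positivity)))
  have hmem : ∀ τ, h₀ ≤ τ → ∀ x, crv A b τ ≤ x → cpt ε x τ ∈ U := fun τ hτ x hx =>
    mem_expRegion ha hb hA hε (hh₀.trans_le hτ) hx
  have hvmem : ∀ τ, h₀ ≤ τ → cpt ε σ τ ∈ U := fun τ hτ =>
    hmem τ hτ σ (by rw [← hσ]; exact crv_anti hb hh₀ hτ)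
  -- the vertical side
  have hv : ∀ τ : ℝ, HasDerivAt (cpt ε σ) ((ε : ℂ) * Complex.I) τ := by
    intro τ
    have h1 : HasDerivAt (fun τ : ℝ => ((ε * τ : ℝ) : ℂ)) ((ε : ℝ) : ℂ) τ := by
      simpa using ((hasDerivAt_id τ).const_mul ε).ofReal_comp
    exact (h1.mul_const Complex.I).const_add _
  have hvd : ∀ τ ∈ uIcc h₀ h, HasDerivAt (fun τ => G (cpt ε σ τ))
      (((ε : ℂ) * Complex.I) • F (cpt ε σ τ)) τ := by
    intro τ hτ
    rw [uIcc_of_le hh] at hτ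
    exact HasDerivAt.scomp τ (hG _ (hvmem τ hτ.1)) (hv τ)
  have hcont : ContinuousOn (fun τ => F (cpt ε σ τ)) (uIcc h₀ h) := by
    refine hF.continuousOn.comp (fun τ _ => (hv τ).continuousAt.continuousWithinAt) ?_
    intro τ hτ
    rw [uIcc_of_le hh] at hτ
    exact hvmem τ hτ.1
  have h1 := intervalIntegral.integral_eq_sub_of_hasDerivAt hvd
    (hcont.const_smul _).intervalIntegrable
  rw [intervalIntegral.integral_smul] at h1
  have h1' : ‖∫ τ in h₀..h, F (cpt ε σ τ)‖ = ‖G (cpt ε σ h) - G (cpt ε σ h₀)‖ := by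
    rw [← h1, norm_smul, norm_mul, Complex.norm_I, Complex.norm_real, Real.norm_eq_abs, hεn]
    simp
  -- the horizontal side
  have hhd : ∀ x : ℝ, HasDerivAt (fun x => cpt ε x h) 1 x := fun x =>
    ((hasDerivAt_id x).ofReal_comp).add_const _
  have hgh : crv A b h ≤ σ := by rw [← hσ]; exact crv_anti hb hh₀ hh
  have hhd' : ∀ x ∈ Icc (crv A b h) σ, HasDerivAt (fun x => G (cpt ε x h)) (F (cpt ε x h)) x := by
    intro x hx
    simpa using! HasDerivAt.scomp x (hG _ (hmem h hh x hx.1)) (hhd x)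
  have h2 : ‖G (cpt ε σ h) - G (cpt ε (crv A b h) h)‖ ≤ β * (σ - crv A b h) :=
    norm_image_sub_le_of_norm_deriv_right_le_segment
      (fun x hx => (hhd' x hx).continuousAt.continuousWithinAt)
      (fun x hx => (hhd' x ⟨hx.1, hx.2.le⟩).hasDerivWithinAt)
      (fun x hx => hhor x hx.1 hx.2.le) σ (right_mem_Icc.2 hgh)
  -- the curved side
  have hγ : ∀ τ, h₀ ≤ τ → HasDerivAt (fun τ => cpt ε (crv A b τ) τ)
      (((-(b * τ)⁻¹ : ℝ) : ℂ) + (ε : ℂ) * Complex.I) τ := by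
    intro τ hτ
    have h1 : HasDerivAt (fun τ : ℝ => ((ε * τ : ℝ) : ℂ)) ((ε : ℝ) : ℂ) τ := by
      simpa using ((hasDerivAt_id τ).const_mul ε).ofReal_comp
    exact ((hasDerivAt_crv (hh₀.trans_le hτ)).ofReal_comp).add (h1.mul_const Complex.I)
  have hγd : ∀ τ, h₀ ≤ τ → HasDerivAt
      (fun τ => G (cpt ε (crv A b τ) τ) - G (cpt ε (crv A b h₀) h₀))
      ((((-(b * τ)⁻¹ : ℝ) : ℂ) + (ε : ℂ) * Complex.I) • F (cpt ε (crv A b τ) τ)) τ := by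
    intro τ hτ
    exact (HasDerivAt.scomp (h := fun τ => cpt ε (crv A b τ) τ) τ (hG _ (hmem τ hτ _ le_rfl))
      (hγ τ hτ)).sub_const _
  have h3 : ‖G (cpt ε (crv A b h) h) - G (cpt ε (crv A b h₀) h₀)‖
      ≤ c * (1 + (b * h₀)⁻¹) * (h₀⁻¹ - h⁻¹) := by
    have hB : ∀ τ, h₀ ≤ τ → HasDerivAt (fun τ : ℝ => c * (1 + (b * h₀)⁻¹) * (h₀⁻¹ - τ⁻¹))
        (c * (1 + (b * h₀)⁻¹) * (τ ^ 2)⁻¹) τ := by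
      intro τ hτ
      have := ((hasDerivAt_inv (hh₀.trans_le hτ).ne').const_sub h₀⁻¹).const_mul
        (c * (1 + (b * h₀)⁻¹))
      simpa using this
    refine image_norm_le_of_norm_deriv_right_le_deriv_boundary' (a := h₀) (b := h)
      (f := fun τ => G (cpt ε (crv A b τ) τ) - G (cpt ε (crv A b h₀) h₀))
      (B := fun τ : ℝ => c * (1 + (b * h₀)⁻¹) * (h₀⁻¹ - τ⁻¹))
      (fun τ hτ => (hγd τ hτ.1).continuousAt.continuousWithinAt)
      (fun τ hτ => (hγd τ hτ.1).hasDerivWithinAt) (by simp)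
      (fun τ hτ => (hB τ hτ.1).continuousAt.continuousWithinAt)
      (fun τ hτ => (hB τ hτ.1).hasDerivWithinAt) ?_ (right_mem_Icc.2 hh)
    intro τ hτ
    have hτ0 : 0 < τ := hh₀.trans_le hτ.1
    rw [norm_smul, mul_comm c, mul_assoc]
    refine mul_le_mul ?_ (hcrv τ hτ.1) (norm_nonneg _) (by positivity)
    refine (norm_add_le _ _).trans ?_
    rw [norm_mul, Complex.norm_I, Complex.norm_real, Complex.norm_real, Real.norm_eq_abs,
      Real.norm_eq_abs, hεn, abs_neg, abs_of_pos (by positivity), add_comm, mul_one]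
    gcongr
    exact hτ.1
  rw [hσ] at h3
  rw [h1']
  have h4 : G (cpt ε σ h) - G (cpt ε σ h₀) = (G (cpt ε (crv A b h) h) - G (cpt ε σ h₀))
      + (G (cpt ε σ h) - G (cpt ε (crv A b h) h)) := by abel
  rw [h4]
  refine (norm_add_le _ _).trans (add_le_add (h3.trans ?_) h2)
  rw [div_eq_mul_inv]
  have : 0 < h := hh₀.trans_le hh
  gcongr
  simp [this.le]

end Contour

section Factor

variable {K : Type*} [NormedAddCommGroup K] [NormedSpace ℂ K]

/-- The resolvent exists in the region `a e^{-b Re} ≤ |Im|`, with linear growth for `Re ≤ ω`. -/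
def RegionBound (R : K →L[ℂ] K) (ν : ℂ) (a b C ω : ℝ) : Prop :=
  ∀ lam : ℂ, a * Real.exp (-b * lam.re) ≤ |lam.im| →
    ResolventPair R ν lam (Res R ν lam) ∧ (lam.re ≤ ω → ‖Res R ν lam‖ ≤ C * |lam.im|)

theorem ResolventPair.apply_eq {R S : K →L[ℂ] K} {ν lam : ℂ} (h : ResolventPair R ν lam S)
    (z : K) : S (ν • R z - z) = lam • S (R z) - R z := by
  have := congrArg (fun P => P z) h.2
  simp only [_root_.add_apply, smul_apply, clm_mul_apply] at this
  have h' := eq_sub_of_add_eq this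
  rw [map_sub, map_smul, h']
  module

theorem ResolventPair.mul_res {R S : K →L[ℂ] K} {ν lam : ℂ} (h : ResolventPair R ν lam S) (z : K) :
    S (R z) = R (S z) :=
  congrArg (fun P => P z) h.mul_comm.symm

/-- Decay of the squared resolvent on the range of `R⁴`. -/
theorem ResolventPair.norm_sq_le {R S : K →L[ℂ] K} {ν lam : ℂ} (h : ResolventPair R ν lam S)
    {C τ : ℝ} (hS : ‖S‖ ≤ C * τ) (hτ : 1 ≤ τ) (hν : τ ≤ 2 * ‖lam - ν‖) (v : K) :
    ‖S (S (R (R (R (R v)))))‖ ≤ (2 * (‖R‖ ^ 2 + 2 * (‖R‖ + C))) ^ 2 / τ ^ 2 * ‖v‖ := by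
  have hτ0 : 0 < τ := by linarith
  have h1 : ‖S * R‖ ≤ 2 * (‖R‖ + C) := by
    have h2 := h.norm_mul_le
    have h3 : τ * ‖S * R‖ ≤ τ * (2 * (‖R‖ + C)) := by
      nlinarith [norm_nonneg (S * R), norm_nonneg R, mul_le_mul_of_nonneg_right hν
        (norm_nonneg (S * R)), mul_le_mul_of_nonneg_right hτ (norm_nonneg R)]
    exact le_of_mul_le_mul_left h3 hτ0
  have h2 : ‖S * (R * R)‖ ≤ 2 * (‖R‖ ^ 2 + 2 * (‖R‖ + C)) / τ := by
    have e : (lam - ν) • (S * (R * R)) = R * R - S * R := by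
      have := congrArg (fun P => P * R) h.2
      simp only [add_mul, smul_mul_assoc, mul_assoc] at this
      exact eq_sub_of_add_eq' this
    have h3 : ‖lam - ν‖ * ‖S * (R * R)‖ ≤ ‖R‖ ^ 2 + ‖S * R‖ := by
      rw [← norm_smul, e, sq]
      exact (norm_sub_le _ _).trans (add_le_add (_root_.norm_mul_le _ _) le_rfl)
    rw [le_div_iff₀ hτ0]
    nlinarith [mul_le_mul_of_nonneg_right hν (norm_nonneg (S * (R * R)))]
  have e : S (S (R (R (R (R v))))) = (S * (R * R)) ((S * (R * R)) v) := by
    simp only [clm_mul_apply, h.mul_res]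
  rw [e]
  calc _ ≤ ‖S * (R * R)‖ * (‖S * (R * R)‖ * ‖v‖) := (ContinuousLinearMap.le_opNorm _ _).trans
        (mul_le_mul_of_nonneg_left (ContinuousLinearMap.le_opNorm _ _) (norm_nonneg _))
    _ = ‖S * (R * R)‖ ^ 2 * ‖v‖ := by ring
    _ ≤ (2 * (‖R‖ ^ 2 + 2 * (‖R‖ + C)) / τ) ^ 2 * ‖v‖ := by gcongr
    _ = _ := by rw [div_pow]

theorem abs_crv_le {A b h₀ τ σ : ℝ} (hb : 0 < b) (hh : 0 < h₀) (hσ : crv A b h₀ = σ)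
    (hτ : h₀ ≤ τ) : |crv A b τ| ≤ ((|σ| + b⁻¹) / h₀) * τ := by
  have e : crv A b τ = σ - b⁻¹ * Real.log (τ / h₀) := by
    rw [← hσ, Real.log_div (hh.trans_le hτ).ne' hh.ne']; unfold crv; field_simp; ring
  have h1 : 1 ≤ τ / h₀ := (one_le_div hh).2 hτ
  have h2 : 0 ≤ Real.log (τ / h₀) := Real.log_nonneg h1
  have h3 : Real.log (τ / h₀) ≤ τ / h₀ := (Real.log_le_sub_one_of_pos (by linarith)).trans
    (by linarith)
  rw [e]
  refine (abs_sub _ _).trans ?_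
  rw [abs_of_nonneg (by positivity : 0 ≤ b⁻¹ * Real.log (τ / h₀))]
  calc |σ| + b⁻¹ * Real.log (τ / h₀) ≤ |σ| * (τ / h₀) + b⁻¹ * (τ / h₀) := by
        gcongr
        exact le_mul_of_one_le_right (abs_nonneg _) h1
    _ = _ := by ring

theorem norm_cpt_le {ε x τ : ℝ} (hε : ε * ε = 1) (hτ : 0 ≤ τ) : ‖cpt ε x τ‖ ≤ |x| + τ := by
  have hεn : |ε| = 1 := by
    have : |ε| * |ε| = 1 := by rw [abs_mul_abs_self, hε]
    nlinarith [abs_nonneg ε]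
  refine (Complex.norm_le_abs_re_add_abs_im _).trans ?_
  rw [cpt_re, cpt_im, abs_mul, hεn, one_mul, abs_of_nonneg hτ]

variable [CompleteSpace K]

namespace SGData

variable {T : ℝ → K →L[ℂ] K} {R : K →L[ℂ] K} {ν : ℂ} {M ω : ℝ}

theorem region_norm_le (h : SGData T R ν M ω) {a b C A ε x τ h₀ : ℝ}
    (hreg : RegionBound R ν a b C ω) (ha : 0 < a) (hb : 0 < b) (hC : 0 ≤ C) (hA : a < A)
    (hε : ε * ε = 1) (hh₀ : 0 < h₀) (hω : a * Real.exp (-b * ω) ≤ h₀) (hτ : h₀ ≤ τ)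
    (hx : crv A b τ ≤ x) : ResolventPair R ν (cpt ε x τ) (Res R ν (cpt ε x τ)) ∧
      ‖Res R ν (cpt ε x τ)‖ ≤ ((1 + M) * C) * τ := by
  have hεn : |ε| = 1 := by
    have : |ε| * |ε| = 1 := by rw [abs_mul_abs_self, hε]
    nlinarith [abs_nonneg ε]
  have hτ0 : 0 < τ := hh₀.trans_le hτ
  have him : ∀ y, |(cpt ε y τ).im| = τ := fun y => by
    rw [cpt_im, abs_mul, hεn, one_mul, abs_of_pos hτ0]
  have hmem := mem_expRegion ha hb hA hε hτ0 hx
  simp only [mem_ofPred_eq, cpt_im, ← mul_assoc, hε, one_mul] at hmem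
  have h1 := hreg (cpt ε x τ) (by rw [him]; exact hmem.le)
  refine ⟨h1.1, ?_⟩
  rw [him, cpt_re] at h1
  have hM := h.nonneg_bound
  rcases le_or_gt x ω with hxω | hxω
  · refine (h1.2 hxω).trans ?_
    have := mul_nonneg hM (mul_nonneg hC hτ0.le)
    nlinarith
  · have h2 := hreg (cpt ε ω τ) (by rw [him, cpt_re]; exact hω.trans hτ)
    rw [him, cpt_re] at h2
    have h3 := h1.1.sub_eq h2.1
    have h4 := h.norm_res_le (lam := cpt ε x τ) (by simpa)
    rw [cpt_re, le_div_iff₀ (sub_pos.2 hxω)] at h4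
    have h5 := h2.2 le_rfl
    have e : cpt ε ω τ - cpt ε x τ = ((ω - x : ℝ) : ℂ) := by simp [cpt]
    rw [e] at h3
    have h6 := eq_add_of_sub_eq h3
    set S := Res R ν (cpt ε x τ)
    set S' := Res R ν (cpt ε ω τ)
    calc ‖S‖ = ‖((ω - x : ℝ) : ℂ) • (S * S') + S'‖ := by rw [← h6]
      _ ≤ (x - ω) * (‖S‖ * ‖S'‖) + ‖S'‖ := by
        refine (norm_add_le _ _).trans (add_le_add ?_ le_rfl)
        rw [norm_smul, Complex.norm_real, Real.norm_eq_abs, abs_sub_comm,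
          abs_of_pos (sub_pos.2 hxω)]
        exact mul_le_mul_of_nonneg_left (norm_mul_le _ _) (sub_pos.2 hxω).le
      _ = (1 + ‖S‖ * (x - ω)) * ‖S'‖ := by ring
      _ ≤ (1 + M) * (C * τ) := by gcongr
      _ = _ := by ring

/-- Bound for the integrand on the exponential contour. -/
theorem norm_crv_le (h : SGData T R ν M ω) {a b C A ε τ h₀ σ : ℝ}
    (hreg : RegionBound R ν a b C ω) (ha : 0 < a) (hb : 0 < b) (hC : 0 ≤ C) (hA : a < A)
    (hε : ε * ε = 1) (hh₀ : 0 < h₀) (hω : a * Real.exp (-b * ω) ≤ h₀) (hσ : crv A b h₀ = σ)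
    (hτ : h₀ ≤ τ) (z : K) :
    ‖Complex.exp (cpt ε (crv A b τ) τ * ((5 * b : ℝ) : ℂ)) • Res R ν (cpt ε (crv A b τ) τ)
      (Res R ν (cpt ε (crv A b τ) τ) (ν • R z - z))‖
      ≤ A ^ 5 * (((|σ| + b⁻¹) / h₀ + 1) * ((1 + M) * C) ^ 2 + (1 + M) * C / h₀ ^ 2) * ‖R z‖
        / τ ^ 2 := by
  have hτ0 : 0 < τ := hh₀.trans_le hτ
  have hA0 : 0 < A := ha.trans hA
  obtain ⟨hp, hn⟩ := h.region_norm_le hreg ha hb hC hA hε hh₀ hω hτ le_rfl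
  have hlam : ‖cpt ε (crv A b τ) τ‖ ≤ ((|σ| + b⁻¹) / h₀ + 1) * τ := by
    refine (norm_cpt_le hε hτ0.le).trans ?_
    have := abs_crv_le hb hh₀ hσ hτ
    linarith
  have hexp : ‖Complex.exp (cpt ε (crv A b τ) τ * ((5 * b : ℝ) : ℂ))‖ = A ^ 5 / τ ^ 5 := by
    rw [Complex.norm_exp]
    have : (cpt ε (crv A b τ) τ * ((5 * b : ℝ) : ℂ)).re = -((5 : ℕ) * (-b * crv A b τ)) := by
      rw [Complex.re_mul_ofReal, cpt_re]; push_cast; ring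
    rw [this, Real.exp_neg, Real.exp_nat_mul, exp_crv hA0 hb hτ0, ← inv_pow, inv_div, div_pow]
  rw [norm_smul, hexp, hp.apply_eq, map_sub, map_smul]
  set S := Res R ν (cpt ε (crv A b τ) τ)
  set c1 := (|σ| + b⁻¹) / h₀ + 1
  set C1 := (1 + M) * C
  have hM := h.nonneg_bound
  have hc1 : 0 ≤ c1 := by positivity
  have hC1 : 0 ≤ C1 := by positivity
  have hS1 : ‖S (R z)‖ ≤ C1 * τ * ‖R z‖ := S.le_of_opNorm_le hn _
  have hS2 : ‖S (S (R z))‖ ≤ C1 * τ * (C1 * τ * ‖R z‖) :=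
    (S.le_of_opNorm_le hn _).trans (mul_le_mul_of_nonneg_left hS1 (by positivity))
  have h1 : ‖cpt ε (crv A b τ) τ • S (S (R z)) - S (R z)‖
      ≤ c1 * τ * (C1 * τ * (C1 * τ * ‖R z‖)) + C1 * τ * ‖R z‖ := by
    refine (norm_sub_le _ _).trans (add_le_add ?_ hS1)
    rw [norm_smul]
    exact mul_le_mul hlam hS2 (norm_nonneg _) (by positivity)
  calc _ ≤ A ^ 5 / τ ^ 5 * (c1 * τ * (C1 * τ * (C1 * τ * ‖R z‖)) + C1 * τ * ‖R z‖) := by gcongr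
    _ = A ^ 5 * (c1 * C1 ^ 2 + C1 / τ ^ 2) * ‖R z‖ / τ ^ 2 := by field_simp
    _ ≤ _ := by gcongr

/-- Bound for the part of the inversion integral far from the real axis. -/
theorem norm_tail_le (h : SGData T R ν M ω) {a b C A ε h₀ σ : ℝ}
    (hreg : RegionBound R ν a b C ω) (ha : 0 < a) (hb : 0 < b) (hC : 0 ≤ C) (hA : a < A)
    (hε : ε * ε = 1) (hh₀ : 0 < h₀) (hω : a * Real.exp (-b * ω) ≤ h₀) (hσ : crv A b h₀ = σ)
    (v z : K) (hz : ν • R z - z = R (R (R (R v))))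
    (hFint : IntegrableOn (fun τ : ℝ => Complex.exp (cpt ε σ τ * ((5 * b : ℝ) : ℂ)) •
      Res R ν (cpt ε σ τ) (Res R ν (cpt ε σ τ) (ν • R z - z))) (Ioi h₀)) :
    ‖∫ τ in Ioi h₀, Complex.exp (cpt ε σ τ * ((5 * b : ℝ) : ℂ)) •
      Res R ν (cpt ε σ τ) (Res R ν (cpt ε σ τ) (ν • R z - z))‖
      ≤ A ^ 5 * (((|σ| + b⁻¹) / h₀ + 1) * ((1 + M) * C) ^ 2 + (1 + M) * C / h₀ ^ 2) * ‖R z‖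
        * (1 + (b * h₀)⁻¹) / h₀ := by
  have hM := h.nonneg_bound
  set C1 := (1 + M) * C with hC1
  set k := Real.exp (|σ| * (5 * b)) * ((2 * (‖R‖ ^ 2 + 2 * (‖R‖ + C1))) ^ 2 * ‖v‖) with hk
  set F : ℂ → K := fun l => Complex.exp (l * ((5 * b : ℝ) : ℂ)) •
      Res R ν l (Res R ν l (ν • R z - z)) with hFdef
  have hF : DifferentiableOn ℂ F {z : ℂ | a * Real.exp (-b * z.re) < ε * z.im} := by
    intro l hl
    have hεn : |ε| = 1 := by
      have : |ε| * |ε| = 1 := by rw [abs_mul_abs_self, hε]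
      nlinarith [abs_nonneg ε]
    have h1 : a * Real.exp (-b * l.re) ≤ |l.im| := by
      refine (le_of_lt hl).trans ((le_abs_self _).trans ?_)
      rw [abs_mul, hεn, one_mul]
    have h2 := differentiableAt_res (hreg l h1).1
    have h3 := h2.clm_apply (h2.clm_apply (differentiableAt_const (ν • R z - z)))
    refine (DifferentiableAt.smul ?_ h3).differentiableWithinAt
    fun_prop
  have hlim : Tendsto (fun t => ∫ τ in h₀..t, F (cpt ε σ τ)) atTop
      (𝓝 (∫ τ in Ioi h₀, F (cpt ε σ τ))) := intervalIntegral_tendsto_integral_Ioi _ hFint tendsto_id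
  set c := A ^ 5 * (((|σ| + b⁻¹) / h₀ + 1) * C1 ^ 2 + C1 / h₀ ^ 2) * ‖R z‖ with hc
  have hlim2 : Tendsto (fun t : ℝ => c * (1 + (b * h₀)⁻¹) / h₀
      + k * ((|σ| + (|σ| + b⁻¹) / h₀)) * t⁻¹) atTop (𝓝 (c * (1 + (b * h₀)⁻¹) / h₀)) := by
    simpa using (tendsto_inv_atTop_zero.const_mul
      (k * ((|σ| + (|σ| + b⁻¹) / h₀)))).const_add (c * (1 + (b * h₀)⁻¹) / h₀)
  refine le_of_tendsto_of_tendsto hlim.norm hlim2 ?_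
  filter_upwards [eventually_ge_atTop h₀, eventually_ge_atTop 1,
    eventually_ge_atTop (2 * |ν.im|)] with t ht1 ht2 ht3
  have ht0 : 0 < t := by linarith
  have hk0 : 0 ≤ k := by positivity
  refine (norm_integral_vertical_le (β := k / t ^ 2) (c := c) ha hb hA hε hh₀ hσ ht1 hF
    (fun τ hτ => h.norm_crv_le hreg ha hb hC hA hε hh₀ hω hσ hτ z) ?_).trans ?_
  · intro x hx1 hx2
    obtain ⟨hp, hn⟩ := h.region_norm_le hreg ha hb hC hA hε hh₀ hω ht1 hx1
    have h1 : t ≤ 2 * ‖cpt ε x t - ν‖ := by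
      have h2 := Complex.abs_im_le_norm (cpt ε x t - ν)
      rw [Complex.sub_im, cpt_im] at h2
      have h3 := abs_sub_abs_le_abs_sub (ε * t) ν.im
      have h4 : |ε * t| = t := by
        rw [abs_mul, abs_of_pos ht0]
        have : |ε| * |ε| = 1 := by rw [abs_mul_abs_self, hε]
        have : |ε| = 1 := by nlinarith [abs_nonneg ε]
        rw [this, one_mul]
      linarith
    have h2 := hp.norm_sq_le hn ht2 h1 v
    simp only [hFdef]
    rw [hz, norm_smul, Complex.norm_exp, Complex.re_mul_ofReal, cpt_re]
    have h3 : Real.exp (x * (5 * b)) ≤ Real.exp (|σ| * (5 * b)) := by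
      have := hx2.trans (le_abs_self σ)
      gcongr
    calc _ ≤ Real.exp (|σ| * (5 * b)) *
        ((2 * (‖R‖ ^ 2 + 2 * (‖R‖ + C1))) ^ 2 / t ^ 2 * ‖v‖) := by gcongr
      _ = _ := by rw [hk]; ring
  · refine add_le_add le_rfl ?_
    have h1 := abs_crv_le hb hh₀ hσ ht1
    have h2 : σ - crv A b t ≤ (|σ| + (|σ| + b⁻¹) / h₀) * t := by
      have := (le_abs_self _).trans (abs_sub σ (crv A b t))
      have h4 : |σ| ≤ |σ| * t := le_mul_of_one_le_right (abs_nonneg _) ht2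
      rw [add_mul]; linarith
    calc k / t ^ 2 * (σ - crv A b t) ≤ k / t ^ 2 * ((|σ| + (|σ| + b⁻¹) / h₀) * t) := by gcongr
      _ = _ := by field_simp

end SGData

end Factor

section Factor

variable {K : Type*} [NormedAddCommGroup K] [NormedSpace ℂ K]

theorem cpt_one_mul (σ w : ℝ) : cpt 1 σ (2 * Real.pi * w) = vline σ w := by
  simp [cpt, vline]

theorem iterate_identity (R : K →L[ℂ] K) (ν : ℂ) (z : K) :
    ν • R (R (R (R (R z)))) - R (R (R (R z))) = R (R (R (R (ν • R z - z)))) := by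
  simp only [map_sub, map_smul]

variable [CompleteSpace K]

namespace SGData

variable {T : ℝ → K →L[ℂ] K} {R : K →L[ℂ] K} {ν : ℂ} {M ω : ℝ}

/-- Contour deformation bound with explicit constants. -/
theorem norm_apply_le_of_regionBound (h : SGData T R ν M ω) {a b C A h₀ : ℝ}
    (hreg : RegionBound R ν a b C ω) (ha : 0 < a) (hb : 0 < b) (hC : 0 ≤ C) (hA : a < A)
    (hh₀ : 0 < h₀) (hω : a * Real.exp (-b * ω) ≤ h₀) (hσ : crv A b h₀ = ω + 1)
    (v z : K) (hz : ν • R z - z = R (R (R (R v)))) :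
    ‖T (5 * b) (ν • R z - z)‖ ≤ (5 * b)⁻¹ * (|(2 * Real.pi)⁻¹| *
      (2 * (A ^ 5 * (((|ω + 1| + b⁻¹) / h₀ + 1) * ((1 + M) * C) ^ 2 + (1 + M) * C / h₀ ^ 2)
        * (1 + (b * h₀)⁻¹) / h₀)
      + Real.exp ((ω + 1) * (5 * b)) * ((|ω + 1| + h₀) * M ^ 2 + M) * (2 * h₀))) * ‖R z‖ := by
  have hM := h.nonneg_bound
  set σ := ω + 1 with hσdef
  have hσω : ω < σ := by linarith
  have ht : 0 < 5 * b := by linarith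
  set F : ℂ → K := fun l => Complex.exp (l * ((5 * b : ℝ) : ℂ)) •
      Res R ν l (Res R ν l (ν • R z - z)) with hFdef
  set c := A ^ 5 * (((|σ| + b⁻¹) / h₀ + 1) * ((1 + M) * C) ^ 2 + (1 + M) * C / h₀ ^ 2) with hc
  have hFint : Integrable fun τ => F (cpt 1 σ τ) := by
    have h1 := h.integrable_exp_res_res hσω (R (R v)) (5 * b)
    rw [← hz] at h1
    rw [← integrable_comp_mul_left_iff _ (by positivity : (2 * Real.pi) ≠ 0)]
    simpa only [cpt_one_mul] using h1
  have hinv : (5 * b) • T (5 * b) (ν • R z - z) = |(2 * Real.pi)⁻¹| • ∫ τ, F (cpt 1 σ τ) := by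
    have h1 := h.inversion hσω (R (R v)) ht
    rw [← hz] at h1
    rw [← h1, ← Measure.integral_comp_mul_left (fun τ => F (cpt 1 σ τ)) (2 * Real.pi)]
    simp only [cpt_one_mul, hFdef]
  have hneg : ∀ τ, cpt 1 σ (-τ) = cpt (-1) σ τ := fun τ => by simp [cpt]
  have htop : ‖∫ τ in Ioi h₀, F (cpt 1 σ τ)‖ ≤ c * ‖R z‖ * (1 + (b * h₀)⁻¹) / h₀ :=
    h.norm_tail_le hreg ha hb hC hA (by norm_num) hh₀ hω hσ v z hz hFint.integrableOn
  have hbot : ‖∫ τ in Iic (-h₀), F (cpt 1 σ τ)‖ ≤ c * ‖R z‖ * (1 + (b * h₀)⁻¹) / h₀ := by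
    rw [← integral_comp_neg_Ioi]
    simp only [hneg]
    refine h.norm_tail_le hreg ha hb hC hA (by norm_num) hh₀ hω hσ v z hz ?_
    have := hFint.comp_neg
    simp only [hneg] at this
    exact this.integrableOn
  have hmid : ‖∫ τ in (-h₀)..h₀, F (cpt 1 σ τ)‖
      ≤ Real.exp (σ * (5 * b)) * ((|σ| + h₀) * M ^ 2 + M) * ‖R z‖ * |h₀ - -h₀| := by
    refine intervalIntegral.norm_integral_le_of_norm_le_const fun τ hτ => ?_
    rw [uIoc_of_le (by linarith)] at hτ
    have hre : ω < (cpt 1 σ τ).re := by simpa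
    have hp := h.resolventPair hre
    have hn := h.norm_res_le hre
    rw [cpt_re, hσdef, add_sub_cancel_left, div_one, ← hσdef] at hn
    have hlam : ‖cpt 1 σ τ‖ ≤ |σ| + h₀ := by
      refine (Complex.norm_le_abs_re_add_abs_im _).trans ?_
      rw [cpt_re, cpt_im, one_mul]
      gcongr
      exact abs_le.2 ⟨hτ.1.le, hτ.2⟩
    simp only [hFdef]
    rw [norm_smul, Complex.norm_exp, Complex.re_mul_ofReal, cpt_re, hp.apply_eq, map_sub,
      map_smul, mul_assoc]
    set S := Res R ν (cpt 1 σ τ)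
    have hS1 : ‖S (R z)‖ ≤ M * ‖R z‖ := S.le_of_opNorm_le hn _
    have hS2 : ‖S (S (R z))‖ ≤ M * (M * ‖R z‖) :=
      (S.le_of_opNorm_le hn _).trans (mul_le_mul_of_nonneg_left hS1 hM)
    refine mul_le_mul_of_nonneg_left ?_ (Real.exp_nonneg _)
    calc _ ≤ (|σ| + h₀) * (M * (M * ‖R z‖)) + M * ‖R z‖ := by
          refine (norm_sub_le _ _).trans (add_le_add ?_ hS1)
          rw [norm_smul]
          exact mul_le_mul hlam hS2 (norm_nonneg _) (by positivity)
      _ = _ := by ring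
  have hsplit : ∫ τ, F (cpt 1 σ τ) = (∫ τ in Iic (-h₀), F (cpt 1 σ τ)) +
      ((∫ τ in (-h₀)..h₀, F (cpt 1 σ τ)) + ∫ τ in Ioi h₀, F (cpt 1 σ τ)) := by
    rw [intervalIntegral.integral_interval_add_Ioi hFint.integrableOn hFint.integrableOn,
      intervalIntegral.integral_Iic_add_Ioi hFint.integrableOn hFint.integrableOn]
  have hfin : ‖(5 * b) • T (5 * b) (ν • R z - z)‖ ≤ |(2 * Real.pi)⁻¹| *
      (c * ‖R z‖ * (1 + (b * h₀)⁻¹) / h₀ +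
        (Real.exp (σ * (5 * b)) * ((|σ| + h₀) * M ^ 2 + M) * ‖R z‖ * |h₀ - -h₀| +
        c * ‖R z‖ * (1 + (b * h₀)⁻¹) / h₀)) := by
    rw [hinv, norm_smul, Real.norm_eq_abs, abs_abs, hsplit]
    refine mul_le_mul_of_nonneg_left ?_ (abs_nonneg _)
    exact (norm_add_le _ _).trans (add_le_add hbot
      ((norm_add_le _ _).trans (add_le_add hmid htop)))
  rw [norm_smul, Real.norm_of_nonneg ht.le, ← le_inv_mul_iff₀ ht] at hfin
  refine hfin.trans (le_of_eq ?_)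
  rw [abs_of_pos (by linarith : 0 < h₀ - -h₀)]
  ring

theorem denseRange_four (h : SGData T R ν M ω) : DenseRange fun z => R (R (R (R z))) := by
  have h2 : DenseRange fun z => R (R z) := h.denseRange.comp h.denseRange R.continuous
  exact h2.comp h2 (R.continuous.comp R.continuous)

/-- A resolvent bound in an exponential region forces `T t` to map into the range of `R`,
with uniform bounds. -/
theorem exists_factor (ν : ℂ) {M ω a b C : ℝ} (hM : 0 ≤ M) (ha : 0 < a) (hb : 0 < b)
    (hC : 0 ≤ C) : ∃ t N : ℝ, 0 < t ∧ 0 ≤ N ∧ ∀ (T : ℝ → K →L[ℂ] K) (R : K →L[ℂ] K),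
      SGData T R ν M ω → RegionBound R ν a b C ω → ∃ Q : K →L[ℂ] K, ‖Q‖ ≤ N ∧ T t = R * Q := by
  set A := 2 * a * Real.exp b with hAdef
  set h₀ := 2 * a * Real.exp (-b * ω) with hh₀def
  have hh₀ : 0 < h₀ := by positivity
  have hA : a < A := by
    have := Real.one_lt_exp_iff.2 hb
    nlinarith
  have hω : a * Real.exp (-b * ω) ≤ h₀ := by
    have := mul_pos ha (Real.exp_pos (-b * ω))
    rw [hh₀def]; linarith
  have hσ : crv A b h₀ = ω + 1 := by
    rw [crv, hAdef, hh₀def, Real.log_mul (by positivity) (Real.exp_ne_zero _),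
      Real.log_mul (by positivity) (Real.exp_ne_zero _), Real.log_exp, Real.log_exp]
    field_simp; ring
  set N₁ := (5 * b)⁻¹ * (|(2 * Real.pi)⁻¹| *
      (2 * (A ^ 5 * (((|ω + 1| + b⁻¹) / h₀ + 1) * ((1 + M) * C) ^ 2 + (1 + M) * C / h₀ ^ 2)
        * (1 + (b * h₀)⁻¹) / h₀)
      + Real.exp ((ω + 1) * (5 * b)) * ((|ω + 1| + h₀) * M ^ 2 + M) * (2 * h₀))) with hN₁
  have hA0 : 0 < A := ha.trans hA
  have hN₁0 : 0 ≤ N₁ := by positivity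
  set N := ‖ν‖ * (M * Real.exp (ω * (5 * b))) + N₁ with hN
  have hN0 : 0 ≤ N := by positivity
  refine ⟨5 * b, N, by linarith, hN0, fun T R h hreg => ?_⟩
  have ht : (0 : ℝ) ≤ 5 * b := by linarith
  have key : ∀ z, ‖T (5 * b) (R (R (R (R z))))‖ ≤ N * ‖R (R (R (R (R z))))‖ := by
    intro z
    set w := R (R (R (R z))) with hw
    have h1 := h.norm_apply_le_of_regionBound hreg ha hb hC hA hh₀ hω hσ (ν • R z - z) w
      (iterate_identity R ν z)
    rw [← hN₁] at h1
    have e : T (5 * b) w = ν • T (5 * b) (R w) - T (5 * b) (ν • R w - w) := by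
      simp only [map_sub, map_smul]; abel
    rw [e]
    refine (norm_sub_le _ _).trans ?_
    rw [norm_smul, hN, add_mul, mul_assoc]
    exact add_le_add (mul_le_mul_of_nonneg_left ((T (5 * b)).le_of_opNorm_le (h.bound _ ht) _)
      (norm_nonneg _)) h1
  set P : K →ₗ[ℂ] K := (T (5 * b) * (R * R * R * R) : K →L[ℂ] K).toLinearMap with hP
  set e : K →ₗ[ℂ] K := (R * (R * R * R * R) : K →L[ℂ] K).toLinearMap with he
  have hd : DenseRange e := h.denseRange.comp h.denseRange_four R.continuous
  have hbd : ∀ z, ‖P z‖ ≤ N * ‖e z‖ := key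
  refine ⟨P.extendOfNorm e, LinearMap.opNorm_extendOfNorm_le hd hN0 hbd, ?_⟩
  have hpt : ∀ z, T (5 * b) (R (R (R (R (R z))))) =
      (R * P.extendOfNorm e) (R (R (R (R (R z))))) := by
    intro z
    have h1 : P.extendOfNorm e (e z) = P z := LinearMap.extendOfNorm_eq hd ⟨N, hbd⟩ z
    rw [clm_mul_apply, h.comm _ ht]
    exact congrArg R h1.symm
  exact ContinuousLinearMap.coeFn_injective (hd.equalizer (T (5 * b)).continuous
    (R * P.extendOfNorm e).continuous (funext hpt))

end SGData

end Factor

section Bounds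

variable {K : Type*} [NormedAddCommGroup K] [NormedSpace ℂ K]

/-- Strong convergence of a bounded family follows from convergence on a dense set. -/
theorem tendsto_apply_of_denseRange {ι β : Type*} {l : Filter ι} {S : ι → K →L[ℂ] K}
    {S₀ : K →L[ℂ] K} {C : ℝ} (hS : ∀ᶠ i in l, ‖S i‖ ≤ C) {e : β → K} (he : DenseRange e)
    (h : ∀ z, Tendsto (fun i => S i (e z)) l (𝓝 (S₀ (e z)))) (x : K) :
    Tendsto (fun i => S i x) l (𝓝 (S₀ x)) := by
  rw [Metric.tendsto_nhds]
  intro ε hε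
  set D := |C| + ‖S₀‖ + 1 with hD
  have hD0 : 0 < D := by positivity
  obtain ⟨z, hz⟩ := he.exists_dist_lt x (ε := ε / (2 * D)) (by positivity)
  filter_upwards [hS, Metric.tendsto_nhds.1 (h z) (ε / 2) (by positivity)] with i h1 h2
  rw [dist_eq_norm] at hz h2 ⊢
  have e1 : S i x - S₀ x = S i (x - e z) + (S i (e z) - S₀ (e z)) - S₀ (x - e z) := by
    simp only [map_sub]; abel
  have h3 : ‖S i (x - e z)‖ ≤ |C| * ‖x - e z‖ :=
    (S i).le_of_opNorm_le (h1.trans (le_abs_self C)) _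
  have h4 : ‖S₀ (x - e z)‖ ≤ ‖S₀‖ * ‖x - e z‖ := S₀.le_opNorm _
  rw [lt_div_iff₀ (by positivity)] at hz
  calc ‖S i x - S₀ x‖ ≤ ‖S i (x - e z)‖ + ‖S i (e z) - S₀ (e z)‖ + ‖S₀ (x - e z)‖ := by
        rw [e1]; exact (norm_sub_le _ _).trans (add_le_add (norm_add_le _ _) le_rfl)
    _ ≤ (|C| + ‖S₀‖) * ‖x - e z‖ + ‖S i (e z) - S₀ (e z)‖ := by linarith
    _ ≤ D * ‖x - e z‖ + ‖S i (e z) - S₀ (e z)‖ := by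
        have := norm_nonneg (x - e z); nlinarith
    _ < ε := by linarith

theorem norm_resolvent_sub_le {R : K →L[ℂ] K} {ν : ℂ} {ρ : ℝ} (hρ : ‖R‖ ≤ ρ) (z : K) :
    ‖ν • R z - z‖ ≤ (‖ν‖ * ρ + 1) * ‖z‖ := by
  refine (norm_sub_le _ _).trans ?_
  rw [norm_smul, add_mul, one_mul, mul_assoc]
  gcongr
  exact R.le_of_opNorm_le hρ z

theorem exp_mul_le_exp_abs (ω : ℝ) {t : ℝ} (ht : 0 ≤ t) (ht1 : t ≤ 1) :
    Real.exp (ω * t) ≤ Real.exp |ω| := by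
  refine Real.exp_le_exp.2 ((le_abs_self _).trans ?_)
  rw [abs_mul, abs_of_nonneg ht]
  exact mul_le_of_le_one_right (abs_nonneg _) ht1

namespace SGData

variable {T : ℝ → K →L[ℂ] K} {R : K →L[ℂ] K} {ν : ℂ} {M ω : ℝ}

theorem norm_apply_sub_le (h : SGData T R ν M ω) {ρ : ℝ} (hρ : ‖R‖ ≤ ρ) {t : ℝ} (ht : 0 ≤ t)
    (ht1 : t ≤ 1) (z : K) :
    ‖T t (R z) - R z‖ ≤ M * Real.exp |ω| * (‖ν‖ * ρ + 1) * t * ‖z‖ := by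
  have h1 := norm_image_sub_le_of_norm_deriv_right_le_segment (f := fun r => T r (R z))
    (f' := fun r => T r (ν • R z - z)) (a := 0) (b := 1)
    (C := M * Real.exp |ω| * ((‖ν‖ * ρ + 1) * ‖z‖))
    ((h.continuousOn _).mono Icc_subset_Ici_self)
    (fun x hx => hasDerivWithinAt_Ioi_iff_Ici.1 (h.hasDerivWithinAt z hx.1)) (fun x hx => by
      refine (h.norm_apply_le hx.1 _).trans ?_
      have := h.nonneg_bound
      gcongr
      · exact (Real.exp_le_exp.1 (exp_mul_le_exp_abs ω hx.1 hx.2.le))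
      · exact norm_resolvent_sub_le hρ z) t ⟨ht, ht1⟩
  simp only [h.zero_apply, sub_zero] at h1
  exact h1.trans (le_of_eq (by ring))

theorem norm_apply_sub_sub_le (h : SGData T R ν M ω) {ρ : ℝ} (hρ : ‖R‖ ≤ ρ) {t : ℝ}
    (ht : 0 ≤ t) (ht1 : t ≤ 1) (z : K) :
    ‖T t (R (R z)) - R (R z) - (t : ℂ) • (ν • R (R z) - R z)‖
      ≤ M * Real.exp |ω| * (‖ν‖ * ρ + 1) ^ 2 * t ^ 2 * ‖z‖ := by
  have hρ0 : 0 ≤ ρ := (norm_nonneg _).trans hρ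
  have hM := h.nonneg_bound
  have hd : ∀ x, HasDerivAt (fun r : ℝ => (r : ℂ) • (ν • R (R z) - R z))
      (ν • R (R z) - R z) x := fun x => by
    simpa using ((hasDerivAt_id x).ofReal_comp).smul_const (ν • R (R z) - R z)
  have h1 := norm_image_sub_le_of_norm_deriv_right_le_segment
    (f := fun r => T r (R (R z)) - (r : ℂ) • (ν • R (R z) - R z))
    (f' := fun r => T r (ν • R (R z) - R z) - (ν • R (R z) - R z)) (a := 0) (b := t)
    (C := M * Real.exp |ω| * (‖ν‖ * ρ + 1) * t * ((‖ν‖ * ρ + 1) * ‖z‖))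
    (((h.continuousOn _).mono Icc_subset_Ici_self).sub (by fun_prop))
    (fun x hx => (hasDerivWithinAt_Ioi_iff_Ici.1 (h.hasDerivWithinAt (R z) hx.1)).sub
      (hd x).hasDerivWithinAt) (fun x hx => by
      have e : ν • R (R z) - R z = R (ν • R z - z) := by rw [map_sub, map_smul]
      rw [e]
      refine (h.norm_apply_sub_le hρ hx.1 (hx.2.le.trans ht1) _).trans ?_
      gcongr
      · exact hx.2.le
      · exact norm_resolvent_sub_le hρ z) t ⟨ht, le_rfl⟩
  simp only [h.zero_apply, sub_zero, Complex.ofReal_zero, zero_smul] at h1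
  rw [sub_right_comm] at h1
  exact h1.trans (le_of_eq (by ring))

/-- A criterion for `SGData` in terms of norm bounds only. -/
theorem of_bounds {L J : ℝ} (h0 : T 0 = 1)
    (hadd : ∀ t u : ℝ, 0 ≤ t → 0 ≤ u → T (t + u) = T t * T u)
    (hb : ∀ t : ℝ, 0 ≤ t → ‖T t‖ ≤ M * Real.exp (ω * t)) (hinj : Function.Injective R)
    (hd : DenseRange R) (hcomm : ∀ t : ℝ, 0 ≤ t → T t * R = R * T t)
    (h1 : ∀ t : ℝ, 0 ≤ t → t ≤ 1 → ‖T t * R - R‖ ≤ L * t)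
    (h2 : ∀ t : ℝ, 0 ≤ t → t ≤ 1 →
      ‖T t * (R * R) - R * R - (t : ℂ) • (ν • (R * R) - R)‖ ≤ J * t ^ 2) :
    SGData T R ν M ω := by
  have hM : 0 ≤ M := by simpa using (norm_nonneg _).trans (hb 0 le_rfl)
  refine ⟨⟨h0, hadd, fun x t₀ ht₀ => ?_⟩, hb, hinj,
    fun t ht z => congrArg (fun P => P z) (hcomm t ht), fun z => ?_⟩
  · have ht₀ : 0 ≤ t₀ := ht₀
    refine tendsto_apply_of_denseRange (C := M * Real.exp (|ω| * (t₀ + 1))) ?_ hd (fun z => ?_) x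
    · filter_upwards [self_mem_nhdsWithin,
        nhdsWithin_le_nhds (Iio_mem_nhds (by linarith : t₀ < t₀ + 1))] with t ht ht1
      have ht : 0 ≤ t := ht
      have ht1 : t < t₀ + 1 := ht1
      refine (hb t ht).trans ?_
      have : ω * t ≤ |ω| * (t₀ + 1) :=
        mul_le_mul (le_abs_self _) ht1.le ht (abs_nonneg _)
      gcongr
    · have key : ∀ p q : ℝ, 0 ≤ p → p ≤ q → q ≤ p + 1 →
          ‖T q (R z) - T p (R z)‖ ≤ M * Real.exp (|ω| * p) * (|L| * (q - p) * ‖z‖) := by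
        intro p q hp hpq hq
        have e : T q (R z) - T p (R z) = T p ((T (q - p) * R - R) z) := by
          have := hadd p (q - p) hp (by linarith)
          rw [add_sub_cancel] at this
          rw [this]
          change _ = T p (T (q - p) (R z) - R z)
          rw [map_sub]; rfl
        rw [e]
        have h3 := (T (q - p) * R - R).le_of_opNorm_le ((h1 (q - p) (by linarith)
          (by linarith)).trans (mul_le_mul_of_nonneg_right (le_abs_self L) (sub_nonneg.2 hpq))) z
        refine ((T p).le_of_opNorm_le (hb p hp) _).trans ?_
        have : ω * p ≤ |ω| * p := mul_le_mul_of_nonneg_right (le_abs_self _) hp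
        gcongr
      rw [tendsto_iff_norm_sub_tendsto_zero]
      have hlim : Tendsto (fun t => M * Real.exp (|ω| * (t₀ + 1)) * (|L| * |t - t₀| * ‖z‖))
          (𝓝[Ici 0] t₀) (𝓝 0) := by
        have hc : Continuous fun t => M * Real.exp (|ω| * (t₀ + 1)) * (|L| * |t - t₀| * ‖z‖) := by
          fun_prop
        have := (hc.tendsto t₀).mono_left (nhdsWithin_le_nhds (s := Ici 0))
        simpa using this
      refine squeeze_zero' (Eventually.of_forall fun _ => norm_nonneg _) ?_ hlim
      filter_upwards [self_mem_nhdsWithin,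
        nhdsWithin_le_nhds (Iio_mem_nhds (by linarith : t₀ < t₀ + 1)),
        nhdsWithin_le_nhds (Ioi_mem_nhds (by linarith : t₀ - 1 < t₀))] with t ht ht1 ht2
      have ht : 0 ≤ t := ht
      have ht1 : t < t₀ + 1 := ht1
      have ht2 : t₀ - 1 < t := ht2
      rcases le_total t₀ t with hle | hle
      · refine (key t₀ t ht₀ hle ht1.le).trans ?_
        rw [abs_of_nonneg (sub_nonneg.2 hle)]
        have := sub_nonneg.2 hle
        gcongr
        linarith
      · rw [norm_sub_rev]
        refine (key t t₀ ht hle (by linarith)).trans ?_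
        rw [abs_sub_comm, abs_of_nonneg (sub_nonneg.2 hle)]
        have := sub_nonneg.2 hle
        gcongr
  · have h4 := tendsto_apply_of_denseRange (l := 𝓝[>] (0 : ℝ))
      (S := fun t : ℝ => ((t⁻¹ : ℝ) : ℂ) • (T t * R - R)) (S₀ := ν • R - 1) (C := L) ?_ hd ?_ z
    · refine h4.congr fun t => ?_
      change ((t⁻¹ : ℝ) : ℂ) • (T t (R z) - R z) = _
      exact Complex.coe_smul _ _
    · filter_upwards [self_mem_nhdsWithin, nhdsWithin_le_nhds (Iio_mem_nhds zero_lt_one)]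
        with t ht ht1
      have ht : 0 < t := ht
      rw [norm_smul, Complex.norm_real, Real.norm_of_nonneg (by positivity), inv_mul_le_iff₀ ht]
      exact (h1 t ht.le (le_of_lt ht1)).trans (le_of_eq (mul_comm _ _))
    · intro y
      rw [tendsto_iff_norm_sub_tendsto_zero]
      have hlim : Tendsto (fun t => |J| * t * ‖y‖) (𝓝[>] (0 : ℝ)) (𝓝 0) := by
        have hc : Continuous fun t => |J| * t * ‖y‖ := by fun_prop
        have := (hc.tendsto 0).mono_left (nhdsWithin_le_nhds (s := Ioi 0))
        simpa using this
      refine squeeze_zero' (Eventually.of_forall fun _ => norm_nonneg _) ?_ hlim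
      filter_upwards [self_mem_nhdsWithin, nhdsWithin_le_nhds (Iio_mem_nhds zero_lt_one)]
        with t ht ht1
      have ht : 0 < t := ht
      have hne : (t : ℂ) ≠ 0 := by exact_mod_cast ht.ne'
      have e : (((t⁻¹ : ℝ) : ℂ) • (T t * R - R)) (R y) - (ν • R - 1 : K →L[ℂ] K) (R y)
          = ((t⁻¹ : ℝ) : ℂ) • (T t * (R * R) - R * R - (t : ℂ) • (ν • (R * R) - R)) y := by
        change ((t⁻¹ : ℝ) : ℂ) • (T t (R (R y)) - R (R y)) - (ν • R (R y) - R y) =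
          ((t⁻¹ : ℝ) : ℂ) • (T t (R (R y)) - R (R y) - (t : ℂ) • (ν • R (R y) - R y))
        rw [smul_sub (((t⁻¹ : ℝ) : ℂ)) (T t (R (R y)) - R (R y)), smul_smul, Complex.ofReal_inv,
          inv_mul_cancel₀ hne, one_smul]
      rw [e, norm_smul, Complex.norm_real, Real.norm_of_nonneg (by positivity),
        inv_mul_le_iff₀ ht]
      refine (ContinuousLinearMap.le_of_opNorm_le _ (h2 t ht.le (le_of_lt ht1)) y).trans ?_
      have : J * t ^ 2 * ‖y‖ ≤ |J| * t ^ 2 * ‖y‖ := by gcongr; exact le_abs_self J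
      linarith [this]

end SGData

end Bounds

section RatExtension

theorem IsClosed.forall_nonneg_mem_of_rat {C : Set ℝ} (hC : IsClosed C)
    (h : ∀ q : ℚ, 0 ≤ q → (q : ℝ) ∈ C) {t : ℝ} (ht : 0 ≤ t) : t ∈ C := by
  have h1 : IsClosed {r : ℝ | max r 0 ∈ C} := hC.preimage (by fun_prop)
  have h2 := Rat.denseRange_cast.induction_on (p := fun r : ℝ => max r 0 ∈ C) t h1 fun q => by
    have := h (max q 0) (le_max_right _ _)
    simpa using this
  simpa [max_eq_left ht] using h2

theorem IsClosed.forall_mem_of_rat_of_le_one {C : Set ℝ} (hC : IsClosed C)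
    (h : ∀ q : ℚ, 0 ≤ q → q ≤ 1 → (q : ℝ) ∈ C) {t : ℝ} (ht : 0 ≤ t) (ht1 : t ≤ 1) : t ∈ C := by
  have h1 : IsClosed {r : ℝ | min r 1 ∈ C} := hC.preimage (by fun_prop)
  have h2 := h1.forall_nonneg_mem_of_rat (fun q hq => by
    have := h (min q 1) (le_min hq zero_le_one) (min_le_right _ _)
    simpa using this) ht
  simpa [min_eq_left ht1] using h2

variable {K : Type*} [NormedAddCommGroup K] [NormedSpace ℂ K] [CompleteSpace K]

variable {S : ℚ → K →L[ℂ] K} {R : K →L[ℂ] K} {ν : ℂ} {M ω L J : ℝ}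

theorem exists_continuous_extension (hM : 0 ≤ M)
    (hadd : ∀ p q : ℚ, 0 ≤ p → 0 ≤ q → S (p + q) = S p * S q)
    (hb : ∀ q : ℚ, 0 ≤ q → ‖S q‖ ≤ M * Real.exp (ω * q))
    (h1 : ∀ q : ℚ, 0 ≤ q → q ≤ 1 → ‖S q * R - R‖ ≤ L * q) :
    ∃ G : ℝ → K →L[ℂ] K, Continuous G ∧ ∀ q : ℚ, 0 ≤ q → G q = S q * R := by
  have key : ∀ p q : ℚ, 0 ≤ p → p ≤ q → q ≤ p + 1 →
      ‖S q * R - S p * R‖ ≤ M * Real.exp (|ω| * p) * (|L| * (q - p : ℝ)) := by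
    intro p q hp hpq hq
    have hp' : (0 : ℝ) ≤ p := by exact_mod_cast hp
    have hpq' : (0 : ℝ) ≤ (q : ℝ) - p := sub_nonneg.2 (by exact_mod_cast hpq)
    have e : S q * R - S p * R = S p * (S (q - p) * R - R) := by
      have := hadd p (q - p) hp (by linarith)
      rw [add_sub_cancel] at this
      rw [this, mul_sub, mul_assoc]
    have h3 := h1 (q - p) (by linarith) (by linarith)
    push_cast at h3
    rw [e]
    refine (norm_mul_le _ _).trans (mul_le_mul ((hb p hp).trans ?_)
      (h3.trans (mul_le_mul_of_nonneg_right (le_abs_self L) hpq')) (norm_nonneg _) (by positivity))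
    have : ω * p ≤ |ω| * p := mul_le_mul_of_nonneg_right (le_abs_self _) hp'
    gcongr
  set f : ℚ → K →L[ℂ] K := fun q => S (max q 0) * R with hf
  have di := Rat.isDenseEmbedding_coe_real.isDenseInducing
  have hlim : ∀ b : ℝ, ∃ c, Tendsto f (comap ((↑) : ℚ → ℝ) (𝓝 b)) (𝓝 c) := by
    intro b
    have : (comap ((↑) : ℚ → ℝ) (𝓝 b)).NeBot := di.comap_nhds_neBot b
    rw [← cauchy_map_iff_exists_tendsto, Metric.cauchy_iff]
    refine ⟨inferInstance, fun ε hε => ?_⟩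
    set D := M * Real.exp (|ω| * (|b| + 1)) * |L| with hD
    have hD0 : 0 ≤ D := by positivity
    set δ := min (1 / 2) (ε / (2 * (D + 1))) with hδ
    have hδ0 : 0 < δ := by positivity
    refine ⟨f '' {q : ℚ | |(q : ℝ) - b| < δ}, image_mem_map
      ⟨Metric.ball b δ, Metric.ball_mem_nhds b hδ0, fun q hq => by
        simpa [Real.dist_eq] using hq⟩, ?_⟩
    have main : ∀ p q : ℚ, |(p : ℝ) - b| < δ → |(q : ℝ) - b| < δ → p ≤ q →
        dist (f q) (f p) < ε := by
      intro p q hp hq hpq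
      have hδ1 : δ ≤ 1 / 2 := min_le_left _ _
      have hδ2 : δ ≤ ε / (2 * (D + 1)) := min_le_right _ _
      rw [le_div_iff₀ (by positivity)] at hδ2
      have hpq' : (p : ℝ) ≤ q := by exact_mod_cast hpq
      have hd : (q : ℝ) - p < 2 * δ := by
        rw [abs_lt] at hp hq; linarith
      have hpb : (p : ℝ) ≤ |b| + 1 := by
        rw [abs_lt] at hp; linarith [le_abs_self b]
      have hq1 : q ≤ p + 1 := by
        have : (q : ℝ) ≤ p + 1 := by linarith
        exact_mod_cast this
      have hmax1 : max p 0 ≤ max q 0 := max_le_max_right 0 hpq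
      have hmax2 : max q 0 ≤ max p 0 + 1 :=
        max_le (hq1.trans (by gcongr; exact le_max_left _ _))
          (by linarith [le_max_right p 0])
      have hmax3 : ((max q 0 : ℚ) : ℝ) - (max p 0 : ℚ) ≤ q - p := by
        push_cast
        rcases le_total 0 (p : ℝ) with h | h
        · rw [max_eq_left h, max_eq_left (h.trans hpq')]
        · rw [max_eq_right h]
          have := max_le (c := (q : ℝ) - p) (by linarith : (q : ℝ) ≤ _)
            (by linarith : (0 : ℝ) ≤ _)
          linarith
      have hmax4 : ((max p 0 : ℚ) : ℝ) ≤ |b| + 1 := by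
        push_cast
        exact max_le hpb (by positivity)
      have hmax5 : (0 : ℝ) ≤ ((max q 0 : ℚ) : ℝ) - (max p 0 : ℚ) :=
        sub_nonneg.2 (by exact_mod_cast hmax1)
      rw [dist_eq_norm]
      calc ‖f q - f p‖ ≤ M * Real.exp (|ω| * (max p 0 : ℚ)) *
            (|L| * ((max q 0 : ℚ) - (max p 0 : ℚ) : ℝ)) := key _ _ (le_max_right _ _) hmax1 hmax2
        _ ≤ M * Real.exp (|ω| * (|b| + 1)) * (|L| * (q - p)) := by gcongr
        _ = D * (q - p) := by rw [hD]; ring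
        _ ≤ D * (2 * δ) := by gcongr
        _ < ε := by nlinarith
    rintro _ ⟨p, hp, rfl⟩ _ ⟨q, hq, rfl⟩
    rcases le_total p q with hpq | hpq
    · rw [dist_comm]; exact main p q hp hq hpq
    · exact main q p hq hp hpq
  refine ⟨di.extend f, di.continuous_extend hlim, fun q hq => ?_⟩
  obtain ⟨c, hc⟩ := hlim q
  rw [← di.nhds_eq_comap] at hc
  rw [di.extend_eq_at (continuousAt_of_tendsto_nhds hc)]
  simp only [hf, max_eq_left hq]

/-- A semigroup over the nonnegative rationals, with norm bounds relative to the resolvent,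
extends to a `C₀`-semigroup. -/
theorem SGData.exists_of_rat (h0 : S 0 = 1)
    (hadd : ∀ p q : ℚ, 0 ≤ p → 0 ≤ q → S (p + q) = S p * S q)
    (hb : ∀ q : ℚ, 0 ≤ q → ‖S q‖ ≤ M * Real.exp (ω * q)) (hinj : Function.Injective R)
    (hd : DenseRange R) (hcomm : ∀ q : ℚ, 0 ≤ q → S q * R = R * S q)
    (h1 : ∀ q : ℚ, 0 ≤ q → q ≤ 1 → ‖S q * R - R‖ ≤ L * q)
    (h2 : ∀ q : ℚ, 0 ≤ q → q ≤ 1 →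
      ‖S q * (R * R) - R * R - ((q : ℝ) : ℂ) • (ν • (R * R) - R)‖ ≤ J * (q : ℝ) ^ 2) :
    ∃ T : ℝ → K →L[ℂ] K, SGData T R ν M ω ∧ ∀ q : ℚ, 0 ≤ q → T q = S q := by
  have hM : 0 ≤ M := by simpa using (norm_nonneg _).trans (hb 0 le_rfl)
  obtain ⟨G, hGc, hG⟩ := exists_continuous_extension hM hadd hb h1
  have hGb : ∀ t : ℝ, 0 ≤ t → ∀ z, ‖G t z‖ ≤ M * Real.exp (ω * t) * ‖R z‖ := by
    intro t ht z
    refine IsClosed.forall_nonneg_mem_of_rat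
      (C := {t : ℝ | ‖G t z‖ ≤ M * Real.exp (ω * t) * ‖R z‖})
      (isClosed_le (by fun_prop) (by fun_prop)) (fun q hq => ?_) ht
    change ‖G q z‖ ≤ _
    rw [hG q hq]
    exact (S q).le_of_opNorm_le (hb q hq) (R z)
  set T : ℝ → K →L[ℂ] K := fun t => (G t).toLinearMap.extendOfNorm R.toLinearMap with hT
  have hTR : ∀ t : ℝ, 0 ≤ t → T t * R = G t := fun t ht => by
    ext z
    exact LinearMap.extendOfNorm_eq (f := (G t).toLinearMap) (e := R.toLinearMap) hd
      ⟨_, hGb t ht⟩ z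
  have hext : ∀ P Q : K →L[ℂ] K, P * R = Q * R → P = Q := fun P Q h =>
    ContinuousLinearMap.coeFn_injective (hd.equalizer P.continuous Q.continuous
      (funext fun z => congrArg (fun U => U z) h))
  have hTq : ∀ q : ℚ, 0 ≤ q → T q = S q := fun q hq =>
    hext _ _ ((hTR q (by exact_mod_cast hq)).trans (hG q hq))
  have hGR : ∀ t : ℝ, 0 ≤ t → G t * R = R * G t := fun t ht =>
    IsClosed.forall_nonneg_mem_of_rat (C := {t : ℝ | G t * R = R * G t})
      (isClosed_eq (by fun_prop) (by fun_prop)) (fun q hq => by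
        change G q * R = R * G q
        rw [hG q hq, hcomm q hq, mul_assoc, hcomm q hq]) ht
  have hTcomm : ∀ t : ℝ, 0 ≤ t → T t * R = R * T t := fun t ht => by
    refine hext _ _ ?_
    rw [hTR t ht, hGR t ht, mul_assoc, hTR t ht]
  refine ⟨T, SGData.of_bounds (L := L) (J := J) ?_ ?_ ?_ hinj hd hTcomm ?_ ?_, hTq⟩
  · have := hTq 0 le_rfl
    rw [h0] at this
    simpa using this
  · intro t u ht hu
    have hq : ∀ q : ℚ, 0 ≤ q → ∀ u : ℝ, 0 ≤ u → G (q + u) * R = G q * G u := fun q hq u hu =>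
      IsClosed.forall_nonneg_mem_of_rat (C := {u : ℝ | G (q + u) * R = G q * G u})
        (isClosed_eq (by fun_prop) (by fun_prop)) (fun p hp => by
          change G (q + p) * R = G q * G p
          have := hG (q + p) (add_nonneg hq hp)
          push_cast at this
          rw [this, hG q hq, hG p hp, hadd q p hq hp, hcomm p hp]
          simp only [mul_assoc]
          rw [← mul_assoc (S p) R R, hcomm p hp, mul_assoc R, hcomm p hp]) hu
    have hr : G (t + u) * R = G t * G u :=
      IsClosed.forall_nonneg_mem_of_rat (C := {t : ℝ | G (t + u) * R = G t * G u})
        (isClosed_eq (by fun_prop) (by fun_prop)) (fun p hp => hq p hp u hu) ht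
    refine hext _ _ (hext _ _ ?_)
    rw [hTR _ (add_nonneg ht hu), hr, ← hTR t ht, ← hTR u hu]
    simp only [mul_assoc]
    rw [← mul_assoc R (T u) R, ← hTcomm u hu, mul_assoc]
  · exact fun t ht => LinearMap.opNorm_extendOfNorm_le hd (by positivity) (hGb t ht)
  · intro t ht ht1
    rw [hTR t ht]
    exact IsClosed.forall_mem_of_rat_of_le_one (C := {t : ℝ | ‖G t - R‖ ≤ L * t})
      (isClosed_le (by fun_prop) (by fun_prop)) (fun q hq hq1 => by
        change ‖G q - R‖ ≤ L * q
        rw [hG q hq]; exact h1 q hq hq1) ht ht1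
  · intro t ht ht1
    rw [← mul_assoc, hTR t ht]
    exact IsClosed.forall_mem_of_rat_of_le_one
      (C := {t : ℝ | ‖G t * R - R * R - (t : ℂ) • (ν • (R * R) - R)‖ ≤ J * t ^ 2})
      (isClosed_le (by fun_prop) (by fun_prop)) (fun q hq hq1 => by
        change ‖G q * R - R * R - ((q : ℝ) : ℂ) • (ν • (R * R) - R)‖ ≤ J * (q : ℝ) ^ 2
        rw [hG q hq, mul_assoc]; exact h2 q hq hq1) ht ht1

end RatExtension

theorem ae_norm_le_of_indicator {Ω H : Type*} [MeasurableSpace Ω] {μ : Measure Ω}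
    [NormedAddCommGroup H] [SigmaFinite μ] (f g : Lp H 2 μ) {C : ℝ} (hC : 0 ≤ C)
    (h : ∀ E, MeasurableSet E →
      eLpNorm (E.indicator f) 2 μ ≤ ENNReal.ofReal C * eLpNorm (E.indicator g) 2 μ) :
    ∀ᵐ s ∂μ, ‖f s‖ ≤ C * ‖g s‖ := by
  have e : ∀ (f : Lp H 2 μ) (E : Set Ω), MeasurableSet E →
      ∫⁻ s in E, ‖f s‖ₑ ^ (2 : ℝ) ∂μ = eLpNorm (E.indicator f) 2 μ ^ (2 : ℝ) := by
    intro f E hE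
    rw [eLpNorm_indicator_eq_eLpNorm_restrict hE, eLpNorm_eq_lintegral_rpow_enorm_toReal
      (by norm_num) (by norm_num), ← ENNReal.rpow_mul]
    norm_num
  have h1 : ∀ᵐ s ∂μ, ‖f s‖ₑ ^ (2 : ℝ) ≤ ENNReal.ofReal C ^ (2 : ℝ) * ‖g s‖ₑ ^ (2 : ℝ) := by
    have hfm : Measurable fun s => ‖f s‖ₑ ^ (2 : ℝ) :=
      (Lp.stronglyMeasurable f).enorm.pow_const _
    have hgm : Measurable fun s => ‖g s‖ₑ ^ (2 : ℝ) :=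
      (Lp.stronglyMeasurable g).enorm.pow_const _
    refine ae_le_of_forall_setLIntegral_le_of_sigmaFinite hfm fun E hE _ => ?_
    rw [lintegral_const_mul _ hgm, e f E hE, e g E hE,
      ← ENNReal.mul_rpow_of_nonneg _ _ (by norm_num)]
    exact ENNReal.rpow_le_rpow (h E hE) (by norm_num)
  filter_upwards [h1] with s hs
  rw [← ENNReal.mul_rpow_of_nonneg _ _ (by norm_num),
    ENNReal.rpow_le_rpow_iff (by norm_num), ← ofReal_norm, ← ofReal_norm,
    ← ENNReal.ofReal_mul hC, ENNReal.ofReal_le_ofReal_iff (by positivity)] at hs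
  exact hs

section Decomposable

variable {Ω : Type*} [MeasurableSpace Ω] {μ : Measure Ω}
variable {H : Type*} [NormedAddCommGroup H] [InnerProductSpace ℂ H]

theorem aestronglyMeasurable_clm_apply {S : Ω → H →L[ℂ] H}
    (hS : ∀ x, AEStronglyMeasurable (fun s => S s x) μ) {f : Ω → H}
    (hf : AEStronglyMeasurable f μ) : AEStronglyMeasurable (fun s => S s (f s)) μ := by
  have hsimple : ∀ g : SimpleFunc Ω H, AEStronglyMeasurable (fun s => S s (g s)) μ := by
    intro g
    induction g using SimpleFunc.induction with
    | @const c E hE =>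
      have : (fun s => S s ((SimpleFunc.piecewise E hE (SimpleFunc.const Ω c)
          (SimpleFunc.const Ω 0)) s)) = E.indicator fun s => S s c := by
        ext s
        by_cases hs : s ∈ E <;> simp [hs]
      rw [this]
      exact (hS c).indicator hE
    | @add f g _ hf hg =>
      refine (hf.add hg).congr (ae_of_all _ fun s => ?_)
      simp
  obtain ⟨g, hg, hfg⟩ := hf
  have h1 : AEStronglyMeasurable (fun s => S s (g s)) μ := by
    refine aestronglyMeasurable_of_tendsto_ae atTop (f := fun n s => S s (hg.approx n s))
      (fun n => hsimple _) (ae_of_all _ fun s => ?_)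
    exact ((S s).continuous.tendsto _).comp (hg.tendsto_approx s)
  refine h1.congr ?_
  filter_upwards [hfg] with s hs
  rw [hs]

/-- `𝒮` acts on `L²(Ω; H)` fibrewise through the field `S`. -/
def Dec (𝒮 : Lp H 2 μ →L[ℂ] Lp H 2 μ) (S : Ω → H →L[ℂ] H) : Prop :=
  ∀ f : Lp H 2 μ, 𝒮 f =ᵐ[μ] fun s => S s (f s)

theorem exists_dec {S : Ω → H →L[ℂ] H} (hS : ∀ x, AEStronglyMeasurable (fun s => S s x) μ)
    {C : ℝ} (hb : ∀ᵐ s ∂μ, ‖S s‖ ≤ C) : ∃ 𝒮 : Lp H 2 μ →L[ℂ] Lp H 2 μ, Dec 𝒮 S := by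
  have hmem : ∀ f : Lp H 2 μ, MemLp (fun s => S s (f s)) 2 μ := fun f =>
    (Lp.memLp f).of_le_mul (c := C)
      (aestronglyMeasurable_clm_apply hS (Lp.aestronglyMeasurable f)) (by
        filter_upwards [hb] with s hs using (S s).le_of_opNorm_le hs _)
  let L : Lp H 2 μ →ₗ[ℂ] Lp H 2 μ :=
    { toFun := fun f => (hmem f).toLp
      map_add' := fun f g => by
        refine Lp.ext ?_
        filter_upwards [(hmem (f + g)).coeFn_toLp, Lp.coeFn_add (hmem f).toLp (hmem g).toLp,
          (hmem f).coeFn_toLp, (hmem g).coeFn_toLp, Lp.coeFn_add f g] with s h1 h2 h3 h4 h5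
        rw [h1, h5, h2, Pi.add_apply, Pi.add_apply, h3, h4, map_add]
      map_smul' := fun c f => by
        refine Lp.ext ?_
        filter_upwards [(hmem (c • f)).coeFn_toLp, Lp.coeFn_smul c (hmem f).toLp,
          (hmem f).coeFn_toLp, Lp.coeFn_smul c f] with s h1 h2 h3 h4
        rw [h1, h4, RingHom.id_apply, h2, Pi.smul_apply, Pi.smul_apply, h3, map_smul] }
  have hL : ∀ f, L f =ᵐ[μ] fun s => S s (f s) := fun f => (hmem f).coeFn_toLp
  refine ⟨L.mkContinuous C fun f => ?_, hL⟩
  refine Lp.norm_le_mul_norm_of_ae_le_mul ?_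
  filter_upwards [hb, hL f] with s h1 h2
  rw [h2]
  exact (S s).le_of_opNorm_le h1 _

namespace Dec

variable {𝒮 𝒮' : Lp H 2 μ →L[ℂ] Lp H 2 μ} {S S' : Ω → H →L[ℂ] H}

theorem norm_le (h : Dec 𝒮 S) {C : ℝ} (hC : 0 ≤ C) (hb : ∀ᵐ s ∂μ, ‖S s‖ ≤ C) : ‖𝒮‖ ≤ C := by
  refine 𝒮.opNorm_le_bound hC fun f => Lp.norm_le_mul_norm_of_ae_le_mul ?_
  filter_upwards [hb, h f] with s h1 h2
  rw [h2]
  exact (S s).le_of_opNorm_le h1 _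

theorem one : Dec (1 : Lp H 2 μ →L[ℂ] Lp H 2 μ) fun _ => 1 := fun _ => EventuallyEq.rfl

theorem mul (h : Dec 𝒮 S) (h' : Dec 𝒮' S') : Dec (𝒮 * 𝒮') fun s => S s * S' s := fun f => by
  filter_upwards [h (𝒮' f), h' f] with s h1 h2
  rw [clm_mul_apply, clm_mul_apply, h1, h2]

theorem add (h : Dec 𝒮 S) (h' : Dec 𝒮' S') : Dec (𝒮 + 𝒮') fun s => S s + S' s := fun f => by
  filter_upwards [h f, h' f, Lp.coeFn_add (𝒮 f) (𝒮' f)] with s h1 h2 h3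
  rw [_root_.add_apply, _root_.add_apply, h3, Pi.add_apply, h1, h2]

theorem sub (h : Dec 𝒮 S) (h' : Dec 𝒮' S') : Dec (𝒮 - 𝒮') fun s => S s - S' s := fun f => by
  filter_upwards [h f, h' f, Lp.coeFn_sub (𝒮 f) (𝒮' f)] with s h1 h2 h3
  rw [_root_.sub_apply, _root_.sub_apply, h3, Pi.sub_apply, h1, h2]

theorem smul (h : Dec 𝒮 S) (c : ℂ) : Dec (c • 𝒮) fun s => c • S s := fun f => by
  filter_upwards [h f, Lp.coeFn_smul c (𝒮 f)] with s h1 h2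
  rw [smul_apply, smul_apply, h2, Pi.smul_apply, h1]

theorem congr (h : Dec 𝒮 S) (hS : ∀ᵐ s ∂μ, S s = S' s) : Dec 𝒮 S' := fun f => by
  filter_upwards [h f, hS] with s h1 h2
  rw [h1, h2]

theorem eq_of_field (h : Dec 𝒮 S) (h' : Dec 𝒮' S) : 𝒮 = 𝒮' := by
  ext1 f
  exact Lp.ext ((h f).trans (h' f).symm)

end Dec

/-- The field of multiplication by the indicator function of `E`. -/
def indField (E : Set Ω) : Ω → H →L[ℂ] H :=
  open Classical in fun s => if s ∈ E then 1 else 0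

theorem exists_dec_indField {E : Set Ω} (hE : MeasurableSet E) :
    ∃ P : Lp H 2 μ →L[ℂ] Lp H 2 μ, Dec P (indField E) := by
  refine exists_dec (C := 1) (fun x => ?_) (ae_of_all _ fun s => ?_)
  · have : (fun s => indField E s x) = E.indicator fun _ => x := by
      ext s; by_cases hs : s ∈ E <;> simp [indField, hs]
    rw [this]
    exact aestronglyMeasurable_const.indicator hE
  · by_cases hs : s ∈ E
    · simp only [indField, hs, if_true]
      exact ContinuousLinearMap.norm_id_le
    · simp [indField, hs]

theorem Dec.coeFn_indField {E : Set Ω} {P : Lp H 2 μ →L[ℂ] Lp H 2 μ} (h : Dec P (indField E))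
    (f : Lp H 2 μ) : P f =ᵐ[μ] E.indicator f := by
  filter_upwards [h f] with s hs
  rw [hs]
  by_cases hs : s ∈ E <;> simp [indField, hs]

/-- The operator commutes with multiplication by indicator functions. -/
def CommInd (𝒮 : Lp H 2 μ →L[ℂ] Lp H 2 μ) : Prop :=
  ∀ E : Set Ω, MeasurableSet E → ∀ P : Lp H 2 μ →L[ℂ] Lp H 2 μ, Dec P (indField E) →
    P * 𝒮 = 𝒮 * P

theorem Dec.commInd {𝒮 : Lp H 2 μ →L[ℂ] Lp H 2 μ} {S : Ω → H →L[ℂ] H} (h : Dec 𝒮 S) :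
    CommInd 𝒮 := fun E _ P hP => by
  refine (hP.mul h).eq_of_field ((h.mul hP).congr (ae_of_all _ fun s => ?_))
  by_cases hs : s ∈ E <;> simp [indField, hs]

theorem CommInd.sub {𝒮 𝒮' : Lp H 2 μ →L[ℂ] Lp H 2 μ} (h : CommInd 𝒮) (h' : CommInd 𝒮') :
    CommInd (𝒮 - 𝒮') := fun E hE P hP => by
  rw [mul_sub, sub_mul, h E hE P hP, h' E hE P hP]

theorem CommInd.ae_norm_apply_le [SigmaFinite μ] {𝒮 : Lp H 2 μ →L[ℂ] Lp H 2 μ} (h : CommInd 𝒮)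
    (g : Lp H 2 μ) : ∀ᵐ s ∂μ, ‖𝒮 g s‖ ≤ ‖𝒮‖ * ‖g s‖ := by
  refine ae_norm_le_of_indicator _ _ (norm_nonneg 𝒮) fun E hE => ?_
  obtain ⟨P, hP⟩ := exists_dec_indField (H := H) (μ := μ) hE
  have h1 : P (𝒮 g) = 𝒮 (P g) := congrArg (fun U => U g) (h E hE P hP)
  have h2 := 𝒮.le_opNorm (P g)
  rw [← h1, ← ENNReal.ofReal_le_ofReal_iff (by positivity), ENNReal.ofReal_mul (norm_nonneg _),
    ofReal_norm (P (𝒮 g)), ofReal_norm (P g), Lp.enorm_def, Lp.enorm_def,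
    eLpNorm_congr_ae (hP.coeFn_indField _), eLpNorm_congr_ae (hP.coeFn_indField _)] at h2
  exact h2

variable (μ H) in
theorem exists_section [SigmaFinite μ] : ∃ φ : Ω → ℂ, AEStronglyMeasurable φ μ ∧
    (∀ s, φ s ≠ 0) ∧ ∃ e : H →ₗ[ℂ] Lp H 2 μ, ∀ x, e x =ᵐ[μ] fun s => φ s • x := by
  obtain ⟨g, hg0, hgm, hgi⟩ := exists_pos_lintegral_lt_of_sigmaFinite μ one_ne_zero
  set φ : Ω → ℂ := fun s => ((Real.sqrt (g s) : ℝ) : ℂ) with hφ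
  have hm : Measurable φ := by fun_prop
  have hmem : MemLp φ 2 μ := by
    refine ⟨hm.aestronglyMeasurable, ?_⟩
    rw [eLpNorm_lt_top_iff_lintegral_rpow_enorm_lt_top (by norm_num) (by norm_num)]
    refine lt_of_eq_of_lt (lintegral_congr fun s => ?_) (hgi.trans ENNReal.one_lt_top)
    rw [hφ, ← ofReal_norm, Complex.norm_real, Real.norm_of_nonneg (Real.sqrt_nonneg _),
      ENNReal.ofReal_rpow_of_nonneg (Real.sqrt_nonneg _) (by norm_num)]
    norm_num
  have hmem' : ∀ x : H, MemLp (fun s => φ s • x) 2 μ := fun x =>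
    hmem.of_le_mul (c := ‖x‖) (hm.aestronglyMeasurable.smul_const x)
      (ae_of_all _ fun s => by rw [norm_smul, mul_comm])
  refine ⟨φ, hm.aestronglyMeasurable, fun s => ?_,
    { toFun := fun x => (hmem' x).toLp
      map_add' := fun x y => ?_
      map_smul' := fun c x => ?_ }, fun x => (hmem' x).coeFn_toLp⟩
  · have := Real.sqrt_pos.2 (NNReal.coe_pos.2 (hg0 s))
    exact Complex.ofReal_ne_zero.2 this.ne'
  · refine Lp.ext ?_
    filter_upwards [(hmem' (x + y)).coeFn_toLp, (hmem' x).coeFn_toLp, (hmem' y).coeFn_toLp,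
      Lp.coeFn_add (hmem' x).toLp (hmem' y).toLp] with s h1 h2 h3 h4
    rw [h1, h4, Pi.add_apply, h2, h3, smul_add]
  · refine Lp.ext ?_
    filter_upwards [(hmem' (c • x)).coeFn_toLp, (hmem' x).coeFn_toLp,
      Lp.coeFn_smul c (hmem' x).toLp] with s h1 h2 h3
    rw [h1, RingHom.id_apply, h3, Pi.smul_apply, h2, smul_comm]

end Decomposable

theorem norm_linearCombination_le {H : Type*} [NormedAddCommGroup H]
    [NormedSpace ℂ H] {d w : ℕ → H} {C : ℝ}
    (h : ∀ n k, ‖∑ i, TopologicalSpace.denseSeq (Fin n → ℂ) k i • w i‖ ≤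
      C * ‖∑ i, TopologicalSpace.denseSeq (Fin n → ℂ) k i • d i‖) (c : ℕ →₀ ℂ) :
    ‖Finsupp.linearCombination ℂ w c‖ ≤ C * ‖Finsupp.linearCombination ℂ d c‖ := by
  have h1 : ∀ n (c : Fin n → ℂ), ‖∑ i, c i • w i‖ ≤ C * ‖∑ i, c i • d i‖ := fun n c =>
    (TopologicalSpace.denseRange_denseSeq (Fin n → ℂ)).induction_on
      (p := fun c : Fin n → ℂ => ‖∑ i, c i • w i‖ ≤ C * ‖∑ i, c i • d i‖) c
      (isClosed_le (by fun_prop) (by fun_prop)) (h n)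
  obtain ⟨n, hn⟩ := c.support.exists_nat_subset_range
  have h2 : ∀ v : ℕ → H, Finsupp.linearCombination ℂ v c = ∑ i : Fin n, c i • v i := fun v => by
    rw [Finsupp.linearCombination_apply, Finsupp.sum_of_support_subset _ hn _ (by simp),
      Finset.sum_range]
  rw [h2, h2]
  exact h1 n fun i => c i

section Decomposable

variable {Ω : Type*} [MeasurableSpace Ω] {μ : Measure Ω} [SigmaFinite μ]
variable {H : Type*} [NormedAddCommGroup H] [InnerProductSpace ℂ H]
  [TopologicalSpace.SeparableSpace H]

theorem Dec.ae_norm_le {𝒮 : Lp H 2 μ →L[ℂ] Lp H 2 μ} {S : Ω → H →L[ℂ] H} (h : Dec 𝒮 S) :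
    ∀ᵐ s ∂μ, ‖S s‖ ≤ ‖𝒮‖ := by
  obtain ⟨φ, -, hφ, e, he⟩ := exists_section μ H
  have h1 : ∀ᵐ s ∂μ, ∀ i, ‖S s (TopologicalSpace.denseSeq H i)‖ ≤
      ‖𝒮‖ * ‖TopologicalSpace.denseSeq H i‖ := by
    refine ae_all_iff.2 fun i => ?_
    filter_upwards [he (TopologicalSpace.denseSeq H i), h (e (TopologicalSpace.denseSeq H i)),
      h.commInd.ae_norm_apply_le (e (TopologicalSpace.denseSeq H i))] with s h1 h2 h3
    rw [h2, h1, map_smul, norm_smul, norm_smul, mul_left_comm] at h3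
    exact le_of_mul_le_mul_left h3 (norm_pos_iff.2 (hφ s))
  filter_upwards [h1] with s hs
  refine (S s).opNorm_le_bound (norm_nonneg 𝒮) fun x => ?_
  exact (TopologicalSpace.denseRange_denseSeq H).induction_on
    (p := fun x => ‖S s x‖ ≤ ‖𝒮‖ * ‖x‖) x
    (isClosed_le (by fun_prop) (by fun_prop)) hs

theorem Dec.ae_eq {𝒮 : Lp H 2 μ →L[ℂ] Lp H 2 μ} {S S' : Ω → H →L[ℂ] H} (h : Dec 𝒮 S)
    (h' : Dec 𝒮 S') : ∀ᵐ s ∂μ, S s = S' s := by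
  filter_upwards [(h.sub h').ae_norm_le] with s hs
  rw [sub_self, norm_zero (E := Lp H 2 μ →L[ℂ] Lp H 2 μ), norm_le_zero_iff] at hs
  exact sub_eq_zero.1 hs

variable [CompleteSpace H]

theorem CommInd.exists_dec {𝒮 : Lp H 2 μ →L[ℂ] Lp H 2 μ} (h : CommInd 𝒮) :
    ∃ S : Ω → H →L[ℂ] H, Dec 𝒮 S := by
  obtain ⟨φ, hφm, hφ, e, he⟩ := exists_section μ H
  set d := TopologicalSpace.denseSeq H with hd
  have hdd : DenseRange d := TopologicalSpace.denseRange_denseSeq H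
  set w : Ω → ℕ → H := fun s i => (φ s)⁻¹ • 𝒮 (e (d i)) s with hw
  have hwm : ∀ i, AEStronglyMeasurable (fun s => w s i) μ := fun i =>
    hφm.inv₀.smul (Lp.aestronglyMeasurable _)
  have h1 : ∀ᵐ s ∂μ, ∀ n k, ‖∑ i, TopologicalSpace.denseSeq (Fin n → ℂ) k i • w s i‖ ≤
      ‖𝒮‖ * ‖∑ i, TopologicalSpace.denseSeq (Fin n → ℂ) k i • d i‖ := by
    refine ae_all_iff.2 fun n => ae_all_iff.2 fun k => ?_
    set c := TopologicalSpace.denseSeq (Fin n → ℂ) k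
    have h2 : ∀ᵐ s ∂μ, 𝒮 (e (∑ i, c i • d i)) s = ∑ i, c i • 𝒮 (e (d i)) s := by
      have h3 : ∀ᵐ s ∂μ, ∀ i, (c i • 𝒮 (e (d i))) s = c i • 𝒮 (e (d i)) s :=
        ae_all_iff.2 fun i => Lp.coeFn_smul _ _
      have h4 : 𝒮 (e (∑ i, c i • d i)) = ∑ i, c i • 𝒮 (e (d i)) := by simp
      filter_upwards [h3, Lp.coeFn_finsetSum Finset.univ fun i => c i • 𝒮 (e (d i))] with s h3 h5
      rw [h4, h5, Finset.sum_apply]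
      exact Finset.sum_congr rfl fun i _ => h3 i
    filter_upwards [h2, h.ae_norm_apply_le (e (∑ i, c i • d i)), he (∑ i, c i • d i)]
      with s h2 h3 h4
    have h5 : ∑ i, c i • w s i = (φ s)⁻¹ • ∑ i, c i • 𝒮 (e (d i)) s := by
      rw [Finset.smul_sum]
      exact Finset.sum_congr rfl fun i _ => smul_comm _ _ _
    rw [h2, h4, norm_smul, mul_left_comm] at h3
    rw [h5, norm_smul, norm_inv, inv_mul_le_iff₀ (norm_pos_iff.2 (hφ s))]
    exact h3
  have hdense : DenseRange (Finsupp.linearCombination ℂ d) := hdd.mono (by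
    rintro _ ⟨i, rfl⟩
    exact ⟨Finsupp.single i 1, by simp⟩)
  set S : Ω → H →L[ℂ] H := fun s =>
    (Finsupp.linearCombination ℂ (w s)).extendOfNorm (Finsupp.linearCombination ℂ d) with hS
  have h2 : ∀ᵐ s ∂μ, ‖S s‖ ≤ ‖𝒮‖ := by
    filter_upwards [h1] with s hs
    exact LinearMap.opNorm_extendOfNorm_le hdense (norm_nonneg 𝒮) (norm_linearCombination_le hs)
  have h3 : ∀ᵐ s ∂μ, ∀ i, S s (d i) = w s i := by
    filter_upwards [h1] with s hs i
    have := LinearMap.extendOfNorm_eq hdense ⟨_, norm_linearCombination_le hs⟩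
      (Finsupp.single i 1)
    simpa using this
  have hSm : ∀ x, AEStronglyMeasurable (fun s => S s x) μ := by
    intro x
    obtain ⟨u, hu, hux⟩ := mem_closure_iff_seq_limit.1 (hdd x)
    choose k hk using hu
    refine aestronglyMeasurable_of_tendsto_ae atTop (f := fun n s => w s (k n))
      (fun n => hwm _) ?_
    filter_upwards [h3] with s hs
    refine (((S s).continuous.tendsto x).comp hux).congr fun n => ?_
    rw [Function.comp_apply, ← hk, hs]
  obtain ⟨𝒮', h𝒮'⟩ := _root_.exists_dec hSm h2
  refine ⟨S, ?_⟩
  suffices 𝒮 - 𝒮' = 0 by rwa [sub_eq_zero.1 this]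
  have h4 : ∀ i, (𝒮 - 𝒮') (e (d i)) = 0 := by
    intro i
    rw [_root_.sub_apply, sub_eq_zero]
    refine Lp.ext ?_
    filter_upwards [h3, h𝒮' (e (d i)), he (d i)] with s h3 h4 h5
    rw [h4, h5, map_smul, h3, hw, smul_smul, mul_inv_cancel₀ (hφ s), one_smul]
  ext1 f
  refine Lp.ext ?_
  have h5 : ∀ᵐ s ∂μ, ∀ i, ‖(𝒮 - 𝒮') f s‖ ≤ ‖𝒮 - 𝒮'‖ * ‖f s - φ s • d i‖ := by
    refine ae_all_iff.2 fun i => ?_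
    filter_upwards [(h.sub h𝒮'.commInd).ae_norm_apply_le (f - e (d i)), he (d i),
      Lp.coeFn_sub f (e (d i))] with s h5 h6 h7
    rwa [map_sub, h4, sub_zero, h7, Pi.sub_apply, h6] at h5
  filter_upwards [h5, Lp.coeFn_zero H 2 μ] with s hs h0
  have h6 := hdd.induction_on (p := fun x => ‖(𝒮 - 𝒮') f s‖ ≤ ‖𝒮 - 𝒮'‖ * ‖f s - φ s • x‖)
    ((φ s)⁻¹ • f s) (isClosed_le (by fun_prop) (by fun_prop)) hs
  rw [smul_smul, mul_inv_cancel₀ (hφ s), one_smul, sub_self, norm_zero, mul_zero,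
    norm_le_zero_iff] at h6
  rw [h6, _root_.zero_apply, h0]
  rfl

end Decomposable

section Integral

theorem aestronglyMeasurable_integral_of_continuous {Ω H : Type*} [MeasurableSpace Ω]
    {μ : Measure Ω} [NormedAddCommGroup H] [NormedSpace ℝ H] {F : Ω → ℝ → H}
    (hF : ∀ w, AEStronglyMeasurable (fun s => F s w) μ) (hc : ∀ᵐ s ∂μ, Continuous (F s)) :
    AEStronglyMeasurable (fun s => ∫ w, F s w) μ := by
  have h1 : ∀ᵐ s ∂μ, Continuous (F s) ∧ ∀ q : ℚ, F s q = (hF q).mk _ s :=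
    hc.and (ae_all_iff.2 fun q => (hF q).ae_eq_mk)
  obtain ⟨N, hN, hNm, hN0⟩ := exists_measurable_superset_of_null h1
  have hN' : ∀ s, s ∉ N → Continuous (F s) ∧ ∀ q : ℚ, F s q = (hF q).mk _ s := fun s hs =>
    by_contra fun h => hs (hN h)
  set G : ℝ → Ω → H := fun w => Nᶜ.indicator fun s => F s w with hG
  have hGc : ∀ s, Continuous fun w => G w s := by
    intro s
    by_cases hs : s ∈ N
    · simpa [hG, hs] using continuous_const
    · simpa [hG, hs] using (hN' s hs).1
  have hGm : ∀ w, StronglyMeasurable (G w) := by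
    intro w
    have hd : DenseRange ((↑) : ℚ → ℝ) := Rat.denseRange_cast
    obtain ⟨u, hu, huw⟩ := mem_closure_iff_seq_limit.1 (hd w)
    choose q hq using hu
    refine stronglyMeasurable_of_tendsto atTop (f := fun n => G (u n)) (fun n => ?_)
      (tendsto_pi_nhds.2 fun s => ((hGc s).tendsto w).comp huw)
    have : G (u n) = Nᶜ.indicator ((hF (q n)).mk _) := by
      ext s
      by_cases hs : s ∈ N
      · simp [hG, hs]
      · simp [hG, hs, ← hq, (hN' s hs).2]
    rw [this]
    exact (hF (q n)).stronglyMeasurable_mk.indicator hNm.compl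
  have h2 := stronglyMeasurable_uncurry_of_continuous_of_stronglyMeasurable hGc hGm
  have h3 : StronglyMeasurable fun s => ∫ w, G w s :=
    (h2.comp_measurable measurable_swap).integral_prod_right' (ν := volume)
  refine h3.aestronglyMeasurable.congr ?_
  filter_upwards [measure_eq_zero_iff_ae_notMem.1 hN0] with s hs
  simp [hG, hs]

end Integral

section Decomposable

variable {Ω : Type*} [MeasurableSpace Ω] {μ : Measure Ω}
variable {H : Type*} [NormedAddCommGroup H]

theorem exists_seq_ae_tendsto {ι : Type*} {b : ι → Lp H 2 μ} (hb : DenseRange b)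
    (g : Lp H 2 μ) : ∃ k : ℕ → ι,
      ∀ᵐ s ∂μ, Tendsto (fun n => b (k n) s) atTop (𝓝 (g s)) := by
  obtain ⟨u, hu, hug⟩ := mem_closure_iff_seq_limit.1 (hb g)
  choose k hk using hu
  obtain ⟨n, -, hn⟩ := (tendstoInMeasure_of_tendsto_Lp hug).exists_seq_tendsto_ae
  refine ⟨fun i => k (n i), ?_⟩
  filter_upwards [hn] with s hs
  simpa only [hk] using hs

variable [InnerProductSpace ℂ H] [SigmaFinite μ]

theorem Dec.aestronglyMeasurable {𝒮 : Lp H 2 μ →L[ℂ] Lp H 2 μ} {S : Ω → H →L[ℂ] H}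
    (h : Dec 𝒮 S) (x : H) : AEStronglyMeasurable (fun s => S s x) μ := by
  obtain ⟨φ, hφm, hφ, e, he⟩ := exists_section μ H
  refine (hφm.inv₀.smul (Lp.aestronglyMeasurable (𝒮 (e x)))).congr ?_
  filter_upwards [he x, h (e x)] with s h1 h2
  rw [Pi.smul_apply', Pi.inv_apply, h2, h1, map_smul, smul_smul, inv_mul_cancel₀ (hφ s), one_smul]

theorem Dec.aestronglyMeasurable_of_mul {𝓑 : Lp H 2 μ →L[ℂ] Lp H 2 μ} {B P : Ω → H →L[ℂ] H}
    (h : Dec 𝓑 B) (hd : DenseRange 𝓑)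
    (hP : ∀ x, AEStronglyMeasurable (fun s => (P s * B s) x) μ) (x : H) :
    AEStronglyMeasurable (fun s => P s x) μ := by
  obtain ⟨φ, hφm, hφ, e, he⟩ := exists_section μ H
  obtain ⟨f, hf⟩ := exists_seq_ae_tendsto hd (e x)
  have h1 : AEStronglyMeasurable (fun s => P s (φ s • x)) μ := by
    refine aestronglyMeasurable_of_tendsto_ae atTop
      (f := fun n s => (P s * B s) (f n s))
      (fun n => aestronglyMeasurable_clm_apply hP (Lp.aestronglyMeasurable _)) ?_
    filter_upwards [hf, he x, ae_all_iff.2 fun n => h (f n)] with s h1 h2 h3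
    rw [← h2]
    refine (((P s).continuous.tendsto _).comp h1).congr fun n => ?_
    rw [Function.comp_apply, h3, clm_mul_apply]
  refine (hφm.inv₀.smul h1).congr (ae_of_all _ fun s => ?_)
  rw [Pi.smul_apply', Pi.inv_apply, map_smul, smul_smul, inv_mul_cancel₀ (hφ s), one_smul]

variable [TopologicalSpace.SeparableSpace H]

theorem Dec.ae_denseRange {𝓑 : Lp H 2 μ →L[ℂ] Lp H 2 μ} {B : Ω → H →L[ℂ] H} (h : Dec 𝓑 B)
    (hd : DenseRange 𝓑) : ∀ᵐ s ∂μ, DenseRange (B s) := by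
  obtain ⟨φ, hφm, hφ, e, he⟩ := exists_section μ H
  choose f hf using fun i => exists_seq_ae_tendsto hd (e (TopologicalSpace.denseSeq H i))
  filter_upwards [ae_all_iff.2 hf, ae_all_iff.2 fun i => he (TopologicalSpace.denseSeq H i),
    ae_all_iff.2 fun i => ae_all_iff.2 fun n => h (f i n)] with s h1 h2 h3 x
  refine closure_minimal (range_subset_iff.2 fun i => ?_) isClosed_closure
    (TopologicalSpace.denseRange_denseSeq H x)
  have h4 := (h1 i).const_smul (φ s)⁻¹
  rw [h2, smul_smul, inv_mul_cancel₀ (hφ s), one_smul] at h4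
  refine mem_closure_of_tendsto h4 (Eventually.of_forall fun n => ?_)
  rw [h3, ← map_smul]
  exact mem_range_self _

variable [CompleteSpace H]

theorem Dec.denseRange {𝓑 : Lp H 2 μ →L[ℂ] Lp H 2 μ} {B : Ω → H →L[ℂ] H} (h : Dec 𝓑 B)
    (hd : ∀ᵐ s ∂μ, DenseRange (B s)) : DenseRange 𝓑 := by
  obtain ⟨φ, hφm, hφ, e, he⟩ := exists_section μ H
  suffices (LinearMap.range 𝓑.toLinearMap).topologicalClosure = ⊤ from
    Submodule.dense_iff_topologicalClosure_eq_top.2 this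
  rw [Submodule.topologicalClosure_eq_top_iff, Submodule.eq_bot_iff]
  intro g hg
  rw [Submodule.mem_orthogonal] at hg
  have h1 : ∀ i, ∀ᵐ s ∂μ, inner ℂ (𝓑 (e (TopologicalSpace.denseSeq H i)) s) (g s) = 0 := by
    intro i
    refine (L2.integrable_inner (𝕜 := ℂ) (𝓑 (e (TopologicalSpace.denseSeq H i))) g
      ).ae_eq_zero_of_forall_setIntegral_eq_zero fun E hE _ => ?_
    obtain ⟨P, hP⟩ := exists_dec_indField (H := H) (μ := μ) hE
    have h2 : P (𝓑 (e (TopologicalSpace.denseSeq H i))) =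
      𝓑 (P (e (TopologicalSpace.denseSeq H i))) :=
      congrArg (fun U => U (e (TopologicalSpace.denseSeq H i))) (h.commInd E hE P hP)
    have h3 := hg (P (𝓑 (e (TopologicalSpace.denseSeq H i)))) (h2 ▸ LinearMap.mem_range_self _ _)
    rw [L2.inner_def] at h3
    rw [← integral_indicator hE, ← h3]
    refine integral_congr_ae ?_
    filter_upwards [hP.coeFn_indField (𝓑 (e (TopologicalSpace.denseSeq H i)))] with s hs
    rw [hs]
    by_cases hs : s ∈ E <;> simp [hs]
  refine Lp.ext ?_
  filter_upwards [ae_all_iff.2 h1, ae_all_iff.2 fun i => he (TopologicalSpace.denseSeq H i),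
    ae_all_iff.2 fun i => h (e (TopologicalSpace.denseSeq H i)), hd, Lp.coeFn_zero H 2 μ]
    with s h1 h2 h3 hd h0
  rw [h0, Pi.zero_apply]
  refine hd.eq_zero_of_inner_left ℂ fun x => ?_
  refine (TopologicalSpace.denseRange_denseSeq H).induction_on
    (p := fun x => inner ℂ (g s) (B s x) = 0) x (isClosed_eq (by fun_prop) (by fun_prop))
    fun i => ?_
  have h4 := h1 i
  rw [h3, h2, map_smul, inner_smul_left, mul_eq_zero] at h4
  exact inner_eq_zero_symm.1 (h4.resolve_left ((map_ne_zero _).2 (hφ s)))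

end Decomposable

section Decomposable

variable {Ω : Type*} [MeasurableSpace Ω] {μ : Measure Ω}
variable {H : Type*} [NormedAddCommGroup H] [InnerProductSpace ℂ H]
variable {ℛ : Lp H 2 μ →L[ℂ] Lp H 2 μ} {R : Ω → H →L[ℂ] H} {ν : ℂ}

theorem Dec.injective {𝒮 : Lp H 2 μ →L[ℂ] Lp H 2 μ} {S : Ω → H →L[ℂ] H} (h : Dec 𝒮 S)
    (hinj : ∀ᵐ s ∂μ, Function.Injective (S s)) : Function.Injective 𝒮 := by
  intro f g hfg
  refine Lp.ext ?_
  filter_upwards [hinj, h f, h g] with s h1 h2 h3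
  exact h1 (by rw [← h2, ← h3, hfg])

theorem Dec.resolventAt (h : Dec ℛ R) {As : Ω → H →ₗ.[ℂ] H}
    (hres : ∀ᵐ s ∂μ, ResolventAt (As s) ν (R s)) {𝒜 : Lp H 2 μ →ₗ.[ℂ] Lp H 2 μ}
    (h𝒜dom : ∀ x : Lp H 2 μ,
      x ∈ 𝒜.domain ↔ ∃ g : Lp H 2 μ, ∀ᵐ s ∂μ, (x s, g s) ∈ (As s).graph)
    (h𝒜val : ∀ x : 𝒜.domain, ∀ᵐ s ∂μ, ((x : Lp H 2 μ) s, (𝒜 x) s) ∈ (As s).graph) :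
    ResolventAt 𝒜 ν ℛ := by
  have hsub : ∀ f g : Lp H 2 μ, ∀ᵐ s ∂μ, (ν • f - g) s = ν • f s - g s := fun f g => by
    filter_upwards [Lp.coeFn_sub (ν • f) g, Lp.coeFn_smul ν f] with s h1 h2
    rw [h1, Pi.sub_apply, h2, Pi.smul_apply]
  refine ⟨fun y => ?_, fun x => ?_⟩
  · have hy : ℛ y ∈ 𝒜.domain := by
      refine (h𝒜dom _).2 ⟨ν • ℛ y - y, ?_⟩
      filter_upwards [hres, h y, hsub (ℛ y) y] with s h1 h2 h3
      rw [h1.mem_graph_iff, h3, h2, sub_sub_cancel]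
    refine ⟨hy, Lp.ext ?_⟩
    filter_upwards [hres, h y, hsub (ℛ y) (𝒜 ⟨ℛ y, hy⟩), h𝒜val ⟨ℛ y, hy⟩] with s h1 h2 h3 h4
    rw [h1.mem_graph_iff] at h4
    rw [h3]
    exact h1.injective (h4.trans h2)
  · refine Lp.ext ?_
    filter_upwards [hres, h (ν • (x : Lp H 2 μ) - 𝒜 x), hsub (x : Lp H 2 μ) (𝒜 x), h𝒜val x]
      with s h1 h2 h3 h4
    rw [h1.mem_graph_iff] at h4
    rw [h2, h3, h4]

variable [SigmaFinite μ] [TopologicalSpace.SeparableSpace H] [CompleteSpace H]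
variable {T : Ω → ℝ → H →L[ℂ] H} {M ω : ℝ}

theorem Dec.aestronglyMeasurable_res (h : Dec ℛ R) {lam : ℂ} {S : Ω → H →L[ℂ] H}
    (hS : ∀ᵐ s ∂μ, ResolventPair (R s) ν lam (S s)) (x : H) :
    AEStronglyMeasurable (fun s => S s x) μ := by
  have hB : Dec (1 + (lam - ν) • ℛ) fun s => 1 + (lam - ν) • R s := Dec.one.add (h.smul _)
  refine hB.aestronglyMeasurable_of_mul (hB.denseRange ?_) (fun y => ?_) x
  · filter_upwards [hS] with s hs
    refine Function.Surjective.denseRange fun y => ?_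
    obtain ⟨U, hU⟩ := hs.isUnit
    exact ⟨(↑U⁻¹ : H →L[ℂ] H) y, by rw [← hU, ← clm_mul_apply, Units.mul_inv]; rfl⟩
  · refine (h.aestronglyMeasurable y).congr ?_
    filter_upwards [hS] with s hs
    have : S s * (1 + (lam - ν) • R s) = R s := by
      rw [mul_add, mul_one, mul_smul_comm, hs.2]
    rw [this]

theorem Dec.denseRange_of_sgData (h : Dec ℛ R) (hT : ∀ᵐ s ∂μ, SGData (T s) (R s) ν M ω) :
    DenseRange ℛ :=
  h.denseRange (hT.mono fun _ hs => hs.denseRange)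

theorem Dec.aestronglyMeasurable_semigroup (h : Dec ℛ R)
    (hT : ∀ᵐ s ∂μ, SGData (T s) (R s) ν M ω) {t : ℝ} (ht : 0 ≤ t) (x : H) :
    AEStronglyMeasurable (fun s => T s t x) μ := by
  rcases ht.eq_or_lt with rfl | ht
  · refine (aestronglyMeasurable_const (b := x)).congr ?_
    filter_upwards [hT] with s hs
    rw [hs.zero_apply]
  have hd := h.denseRange_of_sgData hT
  refine (h.mul h).aestronglyMeasurable_of_mul (hd.comp hd ℛ.continuous) (fun y => ?_) x
  have hσ : ω < ω + 1 := by linarith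
  have hR : ∀ w y, AEStronglyMeasurable (fun s => Res (R s) ν (vline (ω + 1) w) y) μ :=
    fun w => h.aestronglyMeasurable_res
      (hT.mono fun s hs => hs.resolventPair (by rwa [vline_re]))
  have h1 : AEStronglyMeasurable (fun s => ∫ w : ℝ, Complex.exp (vline (ω + 1) w * t) •
      Res (R s) ν (vline (ω + 1) w) (Res (R s) ν (vline (ω + 1) w) (R s (R s y)))) μ := by
    refine aestronglyMeasurable_integral_of_continuous (fun w => ?_) ?_
    · exact (aestronglyMeasurable_clm_apply (hR w) (aestronglyMeasurable_clm_apply (hR w)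
        (aestronglyMeasurable_clm_apply h.aestronglyMeasurable
          (h.aestronglyMeasurable y)))).const_smul _
    · filter_upwards [hT] with s hs
      have h2 := hs.continuous_res hσ
      have h3 := continuous_vline (ω + 1)
      fun_prop
  refine (h1.const_smul t⁻¹).congr ?_
  filter_upwards [hT] with s hs
  rw [Pi.smul_apply, hs.inversion hσ y ht, smul_smul, inv_mul_cancel₀ ht.ne', one_smul]
  rfl

theorem Dec.exists_semigroup (h : Dec ℛ R) (hT : ∀ᵐ s ∂μ, SGData (T s) (R s) ν M ω)
    (hM : 0 ≤ M) : ∃ 𝒯 : ℝ → Lp H 2 μ →L[ℂ] Lp H 2 μ, SGData 𝒯 ℛ ν M ω ∧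
      ∀ t, 0 ≤ t → Dec (𝒯 t) fun s => T s t := by
  have hex : ∀ t : ℝ, ∃ 𝒮 : Lp H 2 μ →L[ℂ] Lp H 2 μ, 0 ≤ t → Dec 𝒮 fun s => T s t := by
    intro t
    by_cases ht : 0 ≤ t
    · obtain ⟨𝒮, h𝒮⟩ := exists_dec (h.aestronglyMeasurable_semigroup hT ht)
        (hT.mono fun s hs => hs.bound t ht)
      exact ⟨𝒮, fun _ => h𝒮⟩
    · exact ⟨0, fun h => absurd h ht⟩
  choose 𝒯 h𝒯 using hex
  refine ⟨𝒯, SGData.of_bounds (L := M * Real.exp |ω| * (‖ν‖ * ‖ℛ‖ + 1))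
    (J := M * Real.exp |ω| * (‖ν‖ * ‖ℛ‖ + 1) ^ 2) ?_ (fun t u ht hu => ?_) (fun t ht => ?_)
    (h.injective (hT.mono fun s hs => hs.inj)) (h.denseRange_of_sgData hT) (fun t ht => ?_)
    (fun t ht ht1 => ?_) (fun t ht ht1 => ?_), h𝒯⟩
  · exact ((h𝒯 0 le_rfl).congr (hT.mono fun s hs => hs.c0.1)).eq_of_field Dec.one
  · exact ((h𝒯 _ (add_nonneg ht hu)).congr (hT.mono fun s hs => hs.c0.2.1 t u ht hu)).eq_of_field
      ((h𝒯 t ht).mul (h𝒯 u hu))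
  · exact (h𝒯 t ht).norm_le (by positivity) (hT.mono fun s hs => hs.bound t ht)
  · refine (((h𝒯 t ht).mul h).congr (hT.mono fun s hs => ?_)).eq_of_field (h.mul (h𝒯 t ht))
    ext z
    exact hs.comm t ht z
  · refine (((h𝒯 t ht).mul h).sub h).norm_le (by positivity) ?_
    filter_upwards [hT, h.ae_norm_le] with s hs hρ
    exact ContinuousLinearMap.opNorm_le_bound _ (by positivity) (hs.norm_apply_sub_le hρ ht ht1)
  · refine ((((h𝒯 t ht).mul (h.mul h)).sub (h.mul h)).sub
      ((((h.mul h).smul ν).sub h).smul (t : ℂ))).norm_le (by positivity) ?_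
    filter_upwards [hT, h.ae_norm_le] with s hs hρ
    exact ContinuousLinearMap.opNorm_le_bound _ (by positivity)
      (hs.norm_apply_sub_sub_le hρ ht ht1)

end Decomposable

section Factor

variable {K : Type*} [NormedAddCommGroup K] [NormedSpace ℂ K] [CompleteSpace K]
variable {T : ℝ → K →L[ℂ] K} {R : K →L[ℂ] K} {ν : ℂ} {M ω : ℝ}

theorem exists_factor_of_forall_mem_range {S R : K →L[ℂ] K} (hR : Function.Injective R)
    (h : ∀ x, ∃ y, R y = S x) : ∃ Q : K →L[ℂ] K, S = R * Q := by
  choose g hg using h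
  let L : K →ₗ[ℂ] K :=
    { toFun := g
      map_add' := fun x y => hR (by rw [map_add, hg, hg, hg, map_add])
      map_smul' := fun c x => hR (by rw [RingHom.id_apply, map_smul, hg, hg, map_smul]) }
  refine ⟨ContinuousLinearMap.ofSeqClosedGraph (g := L) fun u x y hu hy => hR ?_, ?_⟩
  · refine tendsto_nhds_unique ((R.continuous.tendsto y).comp hy) ?_
    change Tendsto _ _ (𝓝 (R (g x)))
    rw [hg]
    exact ((S.continuous.tendsto x).comp hu).congr fun n => (hg _).symm
  · ext x
    exact (hg x).symm

theorem SGData.exists_factor_of_differentiableAt (h : SGData T R ν M ω) {A : K →ₗ.[ℂ] K}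
    (hR : ResolventAt A ν R) {t : ℝ} (ht : 0 ≤ t)
    (hd : ∀ x, DifferentiableAt ℝ (fun r => T r x) t) : ∃ Q : K →L[ℂ] K, T t = R * Q := by
  refine exists_factor_of_forall_mem_range h.inj fun x => ?_
  have hx : T t x ∈ A.domain := by
    refine ((h.isGenerator hR).1 _).2 ⟨_, ((hd x).hasDerivAt.tendsto_slope_zero_right).congr' ?_⟩
    filter_upwards [self_mem_nhdsWithin] with r hr
    rw [add_comm t r, h.add_apply (le_of_lt hr) ht]
  exact ⟨_, hR.2 ⟨T t x, hx⟩⟩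

theorem SGData.differentiableOn_of_factor (h : SGData T R ν M ω) {t : ℝ} (ht : 0 ≤ t)
    {Q : K →L[ℂ] K} (hQ : T t = R * Q) (x : K) :
    DifferentiableOn ℝ (fun r => T r x) (Ioi t) := by
  intro u hu
  have h1 : HasDerivAt (fun r => T (r - t) (R (Q x))) (T (u - t) (ν • R (Q x) - Q x)) u :=
    (h.hasDerivAt (Q x) (sub_pos.2 hu)).comp_sub_const u t
  refine (h1.congr_of_eventuallyEq ?_).differentiableAt.differentiableWithinAt
  filter_upwards [Ioi_mem_nhds hu] with r hr
  change _ = T (r - t) ((R * Q) x)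
  rw [← hQ, ← h.add_apply (sub_nonneg.2 (le_of_lt hr)) ht, sub_add_cancel]

end Factor

section Decomposable

variable {Ω : Type*} [MeasurableSpace Ω] {μ : Measure Ω} [SigmaFinite μ]
variable {H : Type*} [NormedAddCommGroup H] [InnerProductSpace ℂ H] [CompleteSpace H]
  [TopologicalSpace.SeparableSpace H]
variable {ℛ : Lp H 2 μ →L[ℂ] Lp H 2 μ} {R : Ω → H →L[ℂ] H} {ν : ℂ} {M ω : ℝ}

theorem Dec.exists_factor (h : Dec ℛ R) {T : Ω → ℝ → H →L[ℂ] H}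
    (hT : ∀ᵐ s ∂μ, SGData (T s) (R s) ν M ω) {a b C : ℝ} (hM : 0 ≤ M) (ha : 0 < a) (hb : 0 < b)
    (hC : 0 ≤ C) (hreg : ∀ᵐ s ∂μ, RegionBound (R s) ν a b C ω)
    {𝒯 : ℝ → Lp H 2 μ →L[ℂ] Lp H 2 μ} (h𝒯 : ∀ t, 0 ≤ t → Dec (𝒯 t) fun s => T s t) :
    ∃ t, 0 ≤ t ∧ ∃ 𝒬, 𝒯 t = ℛ * 𝒬 := by
  obtain ⟨t, N, ht, -, hN⟩ := SGData.exists_factor (K := H) ν hM ha hb hC (ω := ω)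
  have h1 : ∀ s, ∃ Q : H →L[ℂ] H, SGData (T s) (R s) ν M ω → RegionBound (R s) ν a b C ω →
      ‖Q‖ ≤ N ∧ T s t = R s * Q := by
    intro s
    by_cases hs : SGData (T s) (R s) ν M ω ∧ RegionBound (R s) ν a b C ω
    · obtain ⟨Q, hQ⟩ := hN _ _ hs.1 hs.2
      exact ⟨Q, fun _ _ => hQ⟩
    · exact ⟨0, fun h h' => absurd ⟨h, h'⟩ hs⟩
  choose Q hQ using h1
  have hQm : ∀ x, AEStronglyMeasurable (fun s => Q s x) μ := by
    refine h.aestronglyMeasurable_of_mul (h.denseRange_of_sgData hT) fun x => ?_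
    refine ((h𝒯 t ht.le).aestronglyMeasurable x).congr ?_
    filter_upwards [hT, hreg] with s h1 h2
    refine h1.inj ?_
    rw [← h1.comm t ht.le, (hQ s h1 h2).2]
    rfl
  obtain ⟨𝒬, h𝒬⟩ := exists_dec hQm (C := N) (by
    filter_upwards [hT, hreg] with s h1 h2 using (hQ s h1 h2).1)
  refine ⟨t, ht.le, 𝒬, ((h𝒯 t ht.le).congr ?_).eq_of_field (h.mul h𝒬)⟩
  filter_upwards [hT, hreg] with s h1 h2 using (hQ s h1 h2).2

theorem Dec.exists_fiber_semigroup (h : Dec ℛ R) (hinj : ∀ᵐ s ∂μ, Function.Injective (R s))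
    {𝒯 : ℝ → Lp H 2 μ →L[ℂ] Lp H 2 μ} (h𝒯 : SGData 𝒯 ℛ ν M ω) :
    ∃ T : Ω → ℝ → H →L[ℂ] H, (∀ᵐ s ∂μ, SGData (T s) (R s) ν M ω) ∧
      ∀ q : ℚ, 0 ≤ q → Dec (𝒯 q) fun s => T s q := by
  have hM := h𝒯.nonneg_bound
  have hex : ∀ q : ℚ, ∃ S : Ω → H →L[ℂ] H, 0 ≤ q → Dec (𝒯 q) S := by
    intro q
    by_cases hq : 0 ≤ q
    · have hc : CommInd (𝒯 q) := fun E hE P hP =>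
        h𝒯.commute (h.commInd E hE P hP) (by exact_mod_cast hq)
      obtain ⟨S, hS⟩ := hc.exists_dec
      exact ⟨S, fun _ => hS⟩
    · exact ⟨0, fun h => absurd h hq⟩
  choose S hS using hex
  have hq0 : ∀ {q : ℚ}, 0 ≤ q → (0 : ℝ) ≤ q := fun hq => by exact_mod_cast hq
  have e0 : ∀ᵐ s ∂μ, S 0 s = 1 := by
    have := hS 0 le_rfl
    rw [Rat.cast_zero, h𝒯.c0.1] at this
    exact this.ae_eq Dec.one
  have eadd : ∀ᵐ s ∂μ, ∀ p q : ℚ, 0 ≤ p → 0 ≤ q → S (p + q) s = S p s * S q s := by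
    simp only [ae_all_iff]
    intro p q hp hq
    have h1 := hS (p + q) (add_nonneg hp hq)
    rw [Rat.cast_add, h𝒯.c0.2.1 p q (hq0 hp) (hq0 hq)] at h1
    exact h1.ae_eq ((hS p hp).mul (hS q hq))
  have ebound : ∀ᵐ s ∂μ, ∀ q : ℚ, 0 ≤ q → ‖S q s‖ ≤ M * Real.exp (ω * q) := by
    simp only [ae_all_iff]
    intro q hq
    exact (hS q hq).ae_norm_le.mono fun s hs => hs.trans (h𝒯.bound q (hq0 hq))
  have ecomm : ∀ᵐ s ∂μ, ∀ q : ℚ, 0 ≤ q → S q s * R s = R s * S q s := by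
    simp only [ae_all_iff]
    intro q hq
    have h1 : 𝒯 q * ℛ = ℛ * 𝒯 q := ContinuousLinearMap.ext (h𝒯.comm q (hq0 hq))
    have h2 := (hS q hq).mul h
    rw [h1] at h2
    exact h2.ae_eq (h.mul (hS q hq))
  have e1 : ∀ᵐ s ∂μ, ∀ q : ℚ, 0 ≤ q → q ≤ 1 →
      ‖S q s * R s - R s‖ ≤ M * Real.exp |ω| * (‖ν‖ * ‖ℛ‖ + 1) * q := by
    simp only [ae_all_iff]
    intro q hq hq1
    have := hq0 hq
    refine (((hS q hq).mul h).sub h).ae_norm_le.mono fun s hs => hs.trans ?_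
    exact ContinuousLinearMap.opNorm_le_bound _ (by positivity)
      (h𝒯.norm_apply_sub_le le_rfl this (by exact_mod_cast hq1))
  have e2 : ∀ᵐ s ∂μ, ∀ q : ℚ, 0 ≤ q → q ≤ 1 →
      ‖S q s * (R s * R s) - R s * R s - ((q : ℝ) : ℂ) • (ν • (R s * R s) - R s)‖
        ≤ M * Real.exp |ω| * (‖ν‖ * ‖ℛ‖ + 1) ^ 2 * (q : ℝ) ^ 2 := by
    simp only [ae_all_iff]
    intro q hq hq1
    have := hq0 hq
    refine ((((hS q hq).mul (h.mul h)).sub (h.mul h)).sub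
      ((((h.mul h).smul ν).sub h).smul ((q : ℝ) : ℂ))).ae_norm_le.mono fun s hs => hs.trans ?_
    exact ContinuousLinearMap.opNorm_le_bound _ (by positivity)
      (h𝒯.norm_apply_sub_sub_le le_rfl this (by exact_mod_cast hq1))
  have hfib : ∀ᵐ s ∂μ, ∃ T : ℝ → H →L[ℂ] H, SGData T (R s) ν M ω ∧
      ∀ q : ℚ, 0 ≤ q → T q = S q s := by
    filter_upwards [e0, eadd, ebound, ecomm, e1, e2, hinj, h.ae_denseRange h𝒯.denseRange]
      with s h0 h1 h2 h3 h4 h5 h6 h7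
    exact SGData.exists_of_rat (S := fun q => S q s) h0 h1 h2 h6 h7 h3 h4 h5
  obtain ⟨T, hT⟩ := skolem.1 hfib
  refine ⟨T, hT.mono fun s hs => hs.1, fun q hq => (hS q hq).congr ?_⟩
  exact hT.mono fun s hs => (hs.2 q hq).symm

theorem Dec.exists_fiber_factor (h : Dec ℛ R) {𝒯 𝒬 : Lp H 2 μ →L[ℂ] Lp H 2 μ}
    {T : Ω → H →L[ℂ] H} (hinj : Function.Injective ℛ) (hT : Dec 𝒯 T) (h𝒬 : 𝒯 = ℛ * 𝒬) :
    ∃ Q : Ω → H →L[ℂ] H, ∀ᵐ s ∂μ, ‖Q s‖ ≤ ‖𝒬‖ ∧ T s = R s * Q s := by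
  have hc : CommInd 𝒬 := by
    intro E hE P hP
    ext1 f
    refine hinj ?_
    have h1 := congrArg (fun U => U (𝒬 f)) (h.commInd E hE P hP)
    have h2 := congrArg (fun U => U f) (hT.commInd E hE P hP)
    rw [h𝒬] at h2
    exact h1.symm.trans h2
  obtain ⟨Q, hQ⟩ := hc.exists_dec
  exact ⟨Q, hQ.ae_norm_le.and ((h𝒬 ▸ hT).ae_eq (h.mul hQ))⟩

end Decomposable

variable {Ω : Type*} [MeasurableSpace Ω] {μ : Measure Ω} [SigmaFinite μ]
variable {H : Type*} [NormedAddCommGroup H] [InnerProductSpace ℂ H] [CompleteSpace H]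
  [TopologicalSpace.SeparableSpace H]

/-- The decomposable operator `𝒜` generates an eventually differentiable
`C₀`-semigroup bounded by `M e^{ω t}` iff a.e. fibre `A s` generates a `C₀`-semigroup with the
same bound and there are `a, b, C > 0` such that, uniformly a.e. in `s`, the region
`Θ = {lam : a e^{-b Re lam} ≤ |Im lam|}` lies in `ρ(A s)` with
`‖R(lam, A s)‖ ≤ C |Im lam|` for `lam ∈ Θ`, `Re lam ≤ ω`. -/
theorem decomposable_eventually_differentiable_iff
    (ν : ℂ) (R : Ω → H →L[ℂ] H)
    (hmeasR : ∀ x : H, StronglyMeasurable fun s => R s x)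
    (hbddR : ∃ C : ℝ, ∀ᵐ s ∂μ, ‖R s‖ ≤ C)
    (hinj : ∀ᵐ s ∂μ, Function.Injective (R s))
    (As : Ω → H →ₗ.[ℂ] H)
    (hres : ∀ᵐ s ∂μ, ResolventAt (As s) ν (R s))
    (𝒜 : Lp H 2 μ →ₗ.[ℂ] Lp H 2 μ)
    (h𝒜dom : ∀ x : Lp H 2 μ,
      x ∈ 𝒜.domain ↔ ∃ g : Lp H 2 μ, ∀ᵐ s ∂μ, (x s, g s) ∈ (As s).graph)
    (h𝒜val : ∀ x : 𝒜.domain, ∀ᵐ s ∂μ, ((x : Lp H 2 μ) s, (𝒜 x) s) ∈ (As s).graph)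
    (M ω : ℝ) (hM : 1 ≤ M) :
    (∃ 𝒯 : ℝ → Lp H 2 μ →L[ℂ] Lp H 2 μ, IsC0Semigroup 𝒯 ∧ IsGenerator 𝒯 𝒜 ∧
        (∃ t₀ : ℝ, 0 ≤ t₀ ∧ ∀ x : Lp H 2 μ,
          DifferentiableOn ℝ (fun t => 𝒯 t x) (Set.Ioi t₀)) ∧
        ∀ t : ℝ, 0 ≤ t → ‖𝒯 t‖ ≤ M * Real.exp (ω * t)) ↔
      ((∃ T : Ω → ℝ → H →L[ℂ] H, ∀ᵐ s ∂μ, IsC0Semigroup (T s) ∧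
          IsGenerator (T s) (As s) ∧
          ∀ t : ℝ, 0 ≤ t → ‖T s t‖ ≤ M * Real.exp (ω * t)) ∧
       ∃ a b C : ℝ, 0 < a ∧ 0 < b ∧ 0 < C ∧ ∀ᵐ s ∂μ, ∀ lam : ℂ,
         a * Real.exp (-b * lam.re) ≤ |lam.im| →
           (∃ Rs : H →L[ℂ] H, ResolventAt (As s) lam Rs) ∧
           (lam.re ≤ ω → ∀ Rs : H →L[ℂ] H, ResolventAt (As s) lam Rs →
             ‖Rs‖ ≤ C * |lam.im|)) := by
  obtain ⟨Cb, hCb⟩ := hbddR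
  obtain ⟨ℛ, hℛ⟩ := exists_dec (fun x => (hmeasR x).aestronglyMeasurable) hCb
  have h𝒜 : ResolventAt 𝒜 ν ℛ := hℛ.resolventAt hres h𝒜dom h𝒜val
  have hM0 : 0 ≤ M := zero_le_one.trans hM
  constructor
  · rintro ⟨𝒯, hc0, hgen, ⟨t₀, ht₀, hdiff⟩, hbound⟩
    have h𝒯 := hgen.sgData hc0 h𝒜 hbound
    obtain ⟨T, hT, hTq⟩ := hℛ.exists_fiber_semigroup hinj h𝒯
    obtain ⟨q, hq⟩ := exists_rat_gt t₀
    have hq0 : (0 : ℝ) < q := ht₀.trans_lt hq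
    obtain ⟨𝒬, h𝒬⟩ := h𝒯.exists_factor_of_differentiableAt h𝒜 hq0.le fun x =>
      (hdiff x q hq).differentiableAt (Ioi_mem_nhds hq)
    obtain ⟨Q, hQ⟩ := hℛ.exists_fiber_factor h𝒯.inj (hTq q (by exact_mod_cast hq0.le)) h𝒬
    refine ⟨⟨T, ?_⟩, ?_⟩
    · filter_upwards [hT, hres] with s h1 h2
      exact ⟨h1.c0, h1.isGenerator h2, h1.bound⟩
    · obtain ⟨a, b, C, ha, hb, hC, hreg⟩ :=
        SGData.exists_region (K := H) ν (ω := ω) hM0 (norm_nonneg 𝒬) hq0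
      refine ⟨a, b, C, ha, hb, hC, ?_⟩
      filter_upwards [hT, hres, hQ] with s h1 h2 h3 lam hlam
      obtain ⟨S, hS, hSb⟩ := hreg _ _ _ h1 h3.1 h3.2 lam hlam
      refine ⟨⟨S, (h2.resolventAt_iff lam S).2 hS⟩, fun hre S' hS' => ?_⟩
      rw [((h2.resolventAt_iff lam S').1 hS').unique hS]
      exact hSb hre
  · rintro ⟨⟨T, hT⟩, a, b, C, ha, hb, hC, hreg⟩
    have hT' : ∀ᵐ s ∂μ, SGData (T s) (R s) ν M ω := by
      filter_upwards [hT, hres] with s h1 h2 using h1.2.1.sgData h1.1 h2 h1.2.2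
    have hreg' : ∀ᵐ s ∂μ, RegionBound (R s) ν a b C ω := by
      filter_upwards [hreg, hres] with s h1 h2 lam hlam
      obtain ⟨⟨S, hS⟩, hSb⟩ := h1 lam hlam
      have hp := ((h2.resolventAt_iff lam S).1 hS).res
      exact ⟨hp, fun hre => hSb hre _ ((h2.resolventAt_iff lam _).2 hp)⟩
    obtain ⟨𝒯, h𝒯, hdec⟩ := hℛ.exists_semigroup hT' hM0
    obtain ⟨t, ht, 𝒬, h𝒬⟩ := hℛ.exists_factor hT' hM0 ha hb hC.le hreg' hdec
    exact ⟨𝒯, h𝒯.c0, h𝒯.isGenerator h𝒜, ⟨t, ht, h𝒯.differentiableOn_of_factor ht h𝒬⟩, h𝒯.bound⟩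
end
end

section
/- Assume there exist M ≥ 1 and ω ∈ ℝ such that for a.e. s ∈ Ω, ‖T(s,t)‖ ≤ M e^{ωt} for all t ≥ 0, and let t₀ ≥ 0. Suppose the family is norm-continuous for t > t₀ uniformly a.e. on Ω: for every t > t₀ and every ε > 0 there exists δ > 0 such that for a.e. s ∈ Ω, ‖T(s,t) − T(s,t₁)‖ < ε for all t₁ ≥ 0 with |t − t₁| < δ. Then (𝒯(t))_{t≥0} is a C₀-semigroup on L²(Ω, μ; H) and the map t ↦ 𝒯(t) is continuous in the operator norm on (t₀, ∞). -/
open MeasureTheory Filter Topology Set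

noncomputable section

/-- Dominated convergence in `L²`. -/
lemma Lp_two_tendsto_of_dominated {α E : Type*} [MeasurableSpace α] {ν : Measure α}
    [NormedAddCommGroup E] [NormedSpace ℝ E] {f : ℕ → Lp E 2 ν} {g : Lp E 2 ν} (b : Lp E 2 ν)
    (C : ℝ) (hC : 0 ≤ C) (hle : ∀ᶠ n in atTop, ∀ᵐ s ∂ν, ‖f n s - g s‖ ≤ C * ‖b s‖)
    (hlim : ∀ᵐ s ∂ν, Tendsto (fun n => f n s) atTop (𝓝 (g s))) :
    Tendsto f atTop (𝓝 g) := by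
  rw [Lp.tendsto_Lp_iff_tendsto_eLpNorm']
  have key : Tendsto (fun n => ∫⁻ s, ‖f n s - g s‖ₑ ^ (2 : ℝ) ∂ν) atTop
      (𝓝 (∫⁻ _, 0 ∂ν)) := by
    refine tendsto_lintegral_filter_of_dominated_convergence'
      (fun s => ‖(C • b : Lp E 2 ν) s‖ₑ ^ (2 : ℝ)) ?_ ?_ ?_ ?_
    · exact Eventually.of_forall fun n =>
        (((Lp.aestronglyMeasurable _).sub (Lp.aestronglyMeasurable _)).enorm).pow_const _
    · filter_upwards [hle] with n hn
      filter_upwards [hn, Lp.coeFn_smul C b] with s hs hb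
      refine ENNReal.rpow_le_rpow ?_ (by norm_num)
      rw [enorm_le_iff_norm_le, hb]
      simpa [norm_smul, abs_of_nonneg hC] using hs
    · have := lintegral_rpow_enorm_lt_top_of_eLpNorm_lt_top (p := 2) (by simp) (by simp)
        (Lp.eLpNorm_lt_top (C • b))
      simpa using this.ne
    · filter_upwards [hlim] with s hs
      have h0 : Tendsto (fun n => ‖f n s - g s‖ₑ) atTop (𝓝 0) := by
        simpa using (hs.sub_const (g s)).enorm
      simpa using h0.ennrpow_const 2
  rw [lintegral_zero] at key
  have h := key.ennrpow_const (1 / 2)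
  rw [ENNReal.zero_rpow_of_pos (by norm_num)] at h
  refine h.congr fun n => ?_
  rw [eLpNorm_eq_lintegral_rpow_enorm_toReal (by simp) (by simp)]
  simp

variable {Ω : Type*} [MeasurableSpace Ω] {μ : Measure Ω} [SigmaFinite μ]
variable {H : Type*} [NormedAddCommGroup H] [InnerProductSpace ℂ H] [CompleteSpace H]
  [TopologicalSpace.SeparableSpace H]

/-- If the fibre semigroups are uniformly a.e. exponentially bounded and
norm-continuous for `t > t₀` uniformly a.e. on `Ω`, then the direct integral family `𝒯` is a
`C₀`-semigroup which is operator-norm continuous on `(t₀, ∞)`. -/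
theorem directIntegral_eventually_norm_continuous (T : Ω → ℝ → H →L[ℂ] H)
    (hsg : ∀ᵐ s ∂μ, IsC0Semigroup (T s))
    (hmeas : ∀ t : ℝ, 0 ≤ t → ∀ x : H, StronglyMeasurable fun s => T s t x)
    (𝒯 : ℝ → Lp H 2 μ →L[ℂ] Lp H 2 μ)
    (h𝒯 : ∀ t : ℝ, 0 ≤ t → ∀ x : Lp H 2 μ, ⇑(𝒯 t x) =ᵐ[μ] fun s => T s t (x s))
    (M ω : ℝ) (hM : 1 ≤ M)
    (hbdd : ∀ᵐ s ∂μ, ∀ t : ℝ, 0 ≤ t → ‖T s t‖ ≤ M * Real.exp (ω * t))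
    (t₀ : ℝ) (ht₀ : 0 ≤ t₀)
    (hnc : ∀ t : ℝ, t₀ < t → ∀ ε : ℝ, 0 < ε → ∃ δ : ℝ, 0 < δ ∧
      ∀ᵐ s ∂μ, ∀ t₁ : ℝ, 0 ≤ t₁ → |t - t₁| < δ → ‖T s t - T s t₁‖ < ε) :
    IsC0Semigroup 𝒯 ∧ ContinuousOn 𝒯 (Set.Ioi t₀) := by
  have hsub : ∀ t u : ℝ, 0 ≤ t → 0 ≤ u → ∀ x : Lp H 2 μ,
      ⇑(𝒯 t x - 𝒯 u x) =ᵐ[μ] fun s => (T s t - T s u) (x s) := by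
    intro t u ht hu x
    filter_upwards [h𝒯 t ht x, h𝒯 u hu x, Lp.coeFn_sub (𝒯 t x) (𝒯 u x)] with s h₁ h₂ h₃
    rw [h₃, Pi.sub_apply, h₁, h₂, sub_apply]
  refine ⟨⟨?_, ?_, ?_⟩, ?_⟩
  · ext1 x
    refine Lp.ext ?_
    filter_upwards [h𝒯 0 le_rfl x, hsg] with s h₁ h₂
    simp [h₁, h₂.1]
  · intro t u ht hu
    ext1 x
    refine Lp.ext ?_
    filter_upwards [h𝒯 (t + u) (add_nonneg ht hu) x, h𝒯 t ht (𝒯 u x), h𝒯 u hu x, hsg]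
      with s h₁ h₂ h₃ h₄
    simp [h₁, h₂, h₃, h₄.2.1 t u ht hu]
  · intro x t ht
    rw [ContinuousWithinAt, tendsto_iff_seq_tendsto]
    intro u hu
    have hu0 : ∀ᶠ n in atTop, 0 ≤ u n := (tendsto_nhdsWithin_iff.1 hu).2
    have hut : Tendsto u atTop (𝓝 t) := (tendsto_nhdsWithin_iff.1 hu).1
    have hu1 : ∀ᶠ n in atTop, u n < t + 1 := hut.eventually_lt_const (by linarith)
    have ht' : (0 : ℝ) ≤ t := ht
    have hexp : ∀ r : ℝ, 0 ≤ r → r ≤ t + 1 →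
        M * Real.exp (ω * r) ≤ M * Real.exp (|ω| * (t + 1)) := by
      intro r hr hr'
      have : ω * r ≤ |ω| * (t + 1) :=
        mul_le_mul (le_abs_self ω) hr' hr (abs_nonneg ω)
      gcongr
    refine Lp_two_tendsto_of_dominated x (2 * (M * Real.exp (|ω| * (t + 1)))) (by positivity) ?_ ?_
    · filter_upwards [hu0, hu1] with n hn hn'
      filter_upwards [h𝒯 (u n) hn x, h𝒯 t ht x, hbdd] with s h₁ h₂ h₃
      have e₁ := (T s (u n)).le_of_opNorm_le ((h₃ _ hn).trans (hexp _ hn hn'.le)) (x s)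
      have e₂ := (T s t).le_of_opNorm_le ((h₃ _ ht').trans (hexp _ ht' (by linarith))) (x s)
      simp only [Function.comp_apply, h₁, h₂]
      linarith [norm_sub_le (T s (u n) (x s)) (T s t (x s))]
    · have hall : ∀ᵐ s ∂μ, ∀ n, 0 ≤ u n → 𝒯 (u n) x s = T s (u n) (x s) :=
        ae_all_iff.2 fun n => by
          by_cases hn : 0 ≤ u n
          · filter_upwards [h𝒯 (u n) hn x] with s hs _ using hs
          · exact Eventually.of_forall fun s h => absurd h hn
      filter_upwards [hall, h𝒯 t ht x, hsg] with s h₁ h₂ h₃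
      rw [h₂]
      refine ((h₃.2.2 (x s) t ht).tendsto.comp hu).congr' ?_
      filter_upwards [hu0] with n hn
      simp [h₁ n hn]
  · intro t ht
    have ht' : t₀ < t := ht
    refine ContinuousAt.continuousWithinAt (Metric.continuousAt_iff.2 fun ε hε => ?_)
    obtain ⟨δ, hδ, h⟩ := hnc t ht' (ε / 2) (by positivity)
    refine ⟨min δ t, lt_min hδ (by linarith), fun {t₁} h₁ => ?_⟩
    rw [Real.dist_eq, abs_sub_comm, lt_min_iff] at h₁
    have h₁0 : 0 ≤ t₁ := by linarith [le_abs_self (t - t₁)]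
    rw [dist_comm, dist_eq_norm]
    refine lt_of_le_of_lt (ContinuousLinearMap.opNorm_le_bound _ (half_pos hε).le fun x => ?_)
      (half_lt_self hε)
    refine Lp.norm_le_mul_norm_of_ae_le_mul ?_
    filter_upwards [hsub t t₁ (by linarith) h₁0 x, h] with s h₂ h₃
    rw [sub_apply, h₂]
    exact ContinuousLinearMap.le_of_opNorm_le _ (h₃ t₁ h₁0 h₁.1).le _
end
end
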